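/- Suppose δ_□(W_{Q_n},W)→0 for some W∈𝒲, limsup_{n→∞}‖W_{Q_n}‖_{qΔ}<∞ for some q∈(1,∞], the tail assumption (T) holds for some p ≥ v, and 1/p+1/q ≤ 1. Then for every θ∈ℝ, Z_n(θ) := (1/n) log E_{μ^{⊗n}}[e^{nθU_n(X)}] is finite for all large n and converges, as n→∞, to Z(θ) := sup{ θ·T_{W,φ}(ν) − D(ν|ρ) : ν∈𝒯ℳ, D(ν|ρ)<∞ }, which is finite. -/

import Mathlib

open MeasureTheory Filter Set
open scoped ENNReal NNReal

noncomputable section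

/-- The uniform probability measure on `[0,1]`. -/
def unif01 : Measure ℝ := volume.restrict (Set.Icc 0 1)

instance : IsProbabilityMeasure unif01 :=
  ⟨by rw [unif01, Measure.restrict_apply_univ, Real.volume_Icc]; norm_num⟩

/-- The `L^r` norm (`r : ℝ≥0∞`) of a kernel, viewed as a function on `[0,1]²`. -/
def kerNorm (W : ℝ → ℝ → ℝ) (r : ℝ≥0∞) : ℝ≥0∞ :=
  eLpNorm (fun z : ℝ × ℝ => W z.1 z.2) r (unif01.prod unif01)

/-- The (strong) cut distance `d_□` between two kernels on `[0,1]²`. -/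
def cutDist (W₁ W₂ : ℝ → ℝ → ℝ) : ℝ :=
  ⨆ S : {S : Set ℝ // MeasurableSet S}, ⨆ T : {T : Set ℝ // MeasurableSet T},
    |∫ x in Set.Icc (0:ℝ) 1 ∩ S.1, ∫ y in Set.Icc (0:ℝ) 1 ∩ T.1, (W₁ x y - W₂ x y)|

/-- A Lebesgue-measure-preserving bijection of `[0,1]`. -/
def MPB (σ : ℝ → ℝ) : Prop :=
  Set.BijOn σ (Set.Icc 0 1) (Set.Icc 0 1) ∧ MeasurePreserving σ unif01 unif01

/-- The weak cut distance `δ_□`. -/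
def weakCutDist (W₁ W₂ : ℝ → ℝ → ℝ) : ℝ :=
  ⨅ σ : {σ : ℝ → ℝ // MPB σ}, cutDist (fun x y => W₁ (σ.1 x) (σ.1 y)) W₂

/-- The step kernel `W_{Q_n}` associated to an `n × n` matrix `Q`:
it equals `Q i j` when `⌈n x⌉ = i, ⌈n y⌉ = j`. -/
def stepKernel (n : ℕ) (Q : Fin n → Fin n → ℝ) : ℝ → ℝ → ℝ := fun x y =>
  ∑ i : Fin n, ∑ j : Fin n,
    if x ∈ Set.Ioc (((i : ℕ) : ℝ)/n) ((((i : ℕ) : ℝ)+1)/n) ∧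
       y ∈ Set.Ioc (((j : ℕ) : ℝ)/n) ((((j : ℕ) : ℝ)+1)/n)
    then Q i j else 0

/-- Product over the edges of `H` (each edge counted once) of `f a b`. -/
def edgeProd {v : ℕ} (G : SimpleGraph (Fin v)) [DecidableRel G.Adj]
    (f : Fin v → Fin v → ℝ) : ℝ :=
  ∏ p ∈ Finset.univ.filter (fun p : Fin v × Fin v => G.Adj p.1 p.2 ∧ p.1 < p.2), f p.1 p.2

/-- The number of edges `|E(H)|`. -/
def edgeCard {v : ℕ} (G : SimpleGraph (Fin v)) [DecidableRel G.Adj] : ℕ :=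
  (Finset.univ.filter (fun p : Fin v × Fin v => G.Adj p.1 p.2 ∧ p.1 < p.2)).card

/-- The inhomogeneous U-statistic `U_n(X)` (sum over distinct indices). -/
def Ustat {X : Type*} {v : ℕ} (G : SimpleGraph (Fin v)) [DecidableRel G.Adj]
    (φ : (Fin v → X) → ℝ) (n : ℕ) (Q : Fin n → Fin n → ℝ) (x : Fin n → X) : ℝ :=
  (∑ i ∈ Finset.univ.filter (fun i : Fin v → Fin n => Function.Injective i),
      φ (x ∘ i) * edgeProd G (fun a b => Q (i a) (i b))) / (n : ℝ) ^ v

/-- The inhomogeneous V-statistic `V_n(X)` (sum over all indices). -/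
def Vstat {X : Type*} {v : ℕ} (G : SimpleGraph (Fin v)) [DecidableRel G.Adj]
    (φ : (Fin v → X) → ℝ) (n : ℕ) (Q : Fin n → Fin n → ℝ) (x : Fin n → X) : ℝ :=
  (∑ i : Fin v → Fin n, φ (x ∘ i) * edgeProd G (fun a b => Q (i a) (i b))) / (n : ℝ) ^ v

open Classical in
/-- Kullback-Leibler divergence `D(ν | ρ) ∈ [0,∞]`. -/
def KLdiv {α : Type*} [MeasurableSpace α] (ν ρ : Measure α) : ℝ≥0∞ :=
  if ν ≪ ρ ∧ Integrable (llr ν ρ) ν then ENNReal.ofReal (∫ a, llr ν ρ a ∂ν) else ⊤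

open Classical in
/-- `ν` itself if it is a probability measure, junk value `0` otherwise. -/
def probOr {α : Type*} [MeasurableSpace α] (ν : Measure α) : Measure α :=
  if IsProbabilityMeasure ν then ν else 0

instance {α : Type*} [MeasurableSpace α] (ν : Measure α) : SigmaFinite (probOr ν) := by
  unfold probOr
  split_ifs with h
  · haveI := h; infer_instance
  · infer_instance

/-- `v`-fold product of a (probability) measure. -/
def piProb {α : Type*} [MeasurableSpace α] (v : ℕ) (ν : Measure α) : Measure (Fin v → α) :=
  Measure.pi fun _ => probOr ν

/-- The functional `T_{W,φ}(ν) = E[φ(B₁,…,B_v) ∏_{(a,b) ∈ E(H)} W(A_a,A_b)]`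
for `(A_a,B_a)` i.i.d. with law `ν`. -/
def TWphi {X : Type*} [MeasurableSpace X] {v : ℕ} (G : SimpleGraph (Fin v))
    [DecidableRel G.Adj] (W : ℝ → ℝ → ℝ) (φ : (Fin v → X) → ℝ)
    (ν : Measure (ℝ × X)) : ℝ :=
  ∫ z : Fin v → ℝ × X,
    φ (fun a => (z a).2) * edgeProd G (fun a b => W (z a).1 (z b).1) ∂(piProb v ν)

/-- Membership in `𝒯ℳ`: probability measures on `[0,1] × 𝒳` whose first marginal
is uniform on `[0,1]`. -/
def inTM {X : Type*} [MeasurableSpace X] (ν : Measure (ℝ × X)) : Prop :=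
  IsProbabilityMeasure ν ∧ ν.map Prod.fst = unif01

/-- The rate function `I₀(t) = inf { D(ν|ρ) : ν ∈ 𝒯ℳ, D(ν|ρ) < ∞, T_{W,φ}(ν) = t }`. -/
def rate0 {X : Type*} [MeasurableSpace X] {v : ℕ} (G : SimpleGraph (Fin v))
    [DecidableRel G.Adj] (W : ℝ → ℝ → ℝ) (φ : (Fin v → X) → ℝ) (μ : Measure X)
    (t : ℝ) : ℝ≥0∞ :=
  ⨅ ν : {ν : Measure (ℝ × X) //
      inTM ν ∧ KLdiv ν (unif01.prod μ) ≠ ⊤ ∧ TWphi G W φ ν = t},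
    KLdiv ν.1 (unif01.prod μ)

/-- Tail assumption (T): `E_μ[e^{λ ψ(X)^p}] < ∞` for all `λ > 0`; for `p = ∞`
it means `ψ` is bounded. -/
def TailCond {X : Type*} [MeasurableSpace X] (μ : Measure X) (ψ : X → ℝ)
    (p : ℝ≥0∞) : Prop :=
  if p = ⊤ then ∃ C : ℝ, ∀ x, ψ x ≤ C
  else ∀ lam : ℝ, 0 < lam →
    ∫⁻ x, ENNReal.ofReal (Real.exp (lam * ψ x ^ p.toReal)) ∂μ < ⊤

/-- A sequence of random elements `T n` defined on probability spaces `(Ω n, P n)`,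
taking values in a topological space `E`, satisfies a large deviation principle at
speed `n` with good rate function `I`. -/
def SatisfiesLDP {E : Type*} [TopologicalSpace E] {Ω : ℕ → Type*}
    [∀ n, MeasurableSpace (Ω n)] (P : ∀ n, Measure (Ω n)) (T : ∀ n, Ω n → E)
    (I : E → ℝ≥0∞) : Prop :=
  (∀ c : ℝ≥0∞, c ≠ ⊤ → IsCompact {x | I x ≤ c}) ∧
  ∀ F : Set E, MeasurableSet[borel E] F →
    (-(⨅ x ∈ interior F, (I x : EReal)) ≤
      Filter.atTop.liminf fun n : ℕ =>
        (((n : ℝ)⁻¹ : ℝ) : EReal) * ENNReal.log (P n {ω | T n ω ∈ F})) ∧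
    (Filter.atTop.limsup (fun n : ℕ =>
        (((n : ℝ)⁻¹ : ℝ) : EReal) * ENNReal.log (P n {ω | T n ω ∈ F})) ≤
      -(⨅ x ∈ closure F, (I x : EReal)))

end
/-- The log-normalizing constant `Z_n(θ) = (1/n) log E_{μ^{⊗n}}[e^{nθ f_n(X)}]`. -/
noncomputable def ZnGen {X : Type*} [MeasurableSpace X] (μ : Measure X)
    [IsProbabilityMeasure μ] (f : ∀ n : ℕ, (Fin n → X) → ℝ) (n : ℕ) (θ : ℝ) : ℝ :=
  (n : ℝ)⁻¹ *
    Real.log (∫ x, Real.exp (n * θ * f n x) ∂(Measure.pi fun _ : Fin n => μ))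

/-- The Gibbs measure `R_{n,θ}` with Hamiltonian `f n`, having density
`exp(nθ f_n(x) − n Z_n(θ))` with respect to `μ^{⊗n}`. -/
noncomputable def GibbsMeasure {X : Type*} [MeasurableSpace X] (μ : Measure X)
    [IsProbabilityMeasure μ] (f : ∀ n : ℕ, (Fin n → X) → ℝ) (n : ℕ) (θ : ℝ) :
    Measure (Fin n → X) :=
  (Measure.pi fun _ : Fin n => μ).withDensity fun x =>
    ENNReal.ofReal (Real.exp (n * θ * f n x - n * ZnGen μ f n θ))

/-- The set `{θ T_{W,φ}(ν) − D(ν|ρ) : ν ∈ 𝒯ℳ, D(ν|ρ) < ∞}` whose supremum is `Z(θ)`. -/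
def Zset {X : Type*} [MeasurableSpace X] {v : ℕ} (G : SimpleGraph (Fin v))
    [DecidableRel G.Adj] (W : ℝ → ℝ → ℝ) (φ : (Fin v → X) → ℝ) (μ : Measure X)
    (θ : ℝ) : Set ℝ :=
  {z : ℝ | ∃ ν : Measure (ℝ × X), inTM ν ∧ KLdiv ν (unif01.prod μ) ≠ ⊤ ∧
    z = θ * TWphi G W φ ν - (KLdiv ν (unif01.prod μ)).toReal}

/-- One-variable Hölder step with at most `D` factors on a probability space. -/
lemma gp_holder_few {Y κ : Type*} [MeasurableSpace Y] (μ : Measure Y) [IsProbabilityMeasure μ]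
    (s : Finset κ) (f : κ → Y → ℝ≥0∞) (hf : ∀ k, Measurable (f k)) (D : ℕ) (hD : 1 ≤ D)
    (hs : s.card ≤ D) :
    ∫⁻ y, ∏ k ∈ s, f k y ^ (1 / (D : ℝ)) ∂μ ≤ ∏ k ∈ s, (∫⁻ y, f k y ∂μ) ^ (1 / (D : ℝ)) := by
  have hD0 : (0 : ℝ) < D := by exact_mod_cast hD
  have h := ENNReal.lintegral_mul_prod_norm_pow_le (μ := μ) s (g := fun _ => 1) (f := f)
    aemeasurable_const (fun i _ => (hf i).aemeasurable) (1 - s.card * (1 / (D : ℝ)))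
    (p := fun _ => 1 / (D : ℝ)) (by simp) (by
      have : (s.card : ℝ) ≤ D := by exact_mod_cast hs
      have h2 : (s.card : ℝ) * (1 / (D : ℝ)) ≤ 1 := by
        rw [mul_one_div, div_le_one hD0]; exact this
      linarith) (fun _ _ => by positivity)
  simpa using h

/-- Finner's generalized Hölder inequality. -/
lemma gp_finner {ι κ Y : Type*} [Fintype ι] [DecidableEq ι] [MeasurableSpace Y] [Nonempty Y]
    (μ : ι → Measure Y) [∀ i, IsProbabilityMeasure (μ i)]
    (s : Finset κ) (f : κ → (ι → Y) → ℝ≥0∞) (hf : ∀ k, Measurable (f k))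
    (S : κ → Finset ι)
    (hdep : ∀ k, ∀ i ∉ S k, ∀ x y, f k (Function.update x i y) = f k x)
    (D : ℕ) (hD : 1 ≤ D) (hdeg : ∀ i, (s.filter (fun k => i ∈ S k)).card ≤ D) :
    ∫⁻ x, ∏ k ∈ s, f k x ^ (1 / (D : ℝ)) ∂(Measure.pi μ)
      ≤ ∏ k ∈ s, (∫⁻ x, f k x ∂(Measure.pi μ)) ^ (1 / (D : ℝ)) := by
  classical
  have hD0 : (0 : ℝ) < D := by exact_mod_cast hD
  have hmeas : Measurable (fun x => ∏ k ∈ s, f k x ^ (1 / (D : ℝ))) :=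
    Finset.measurable_prod _ fun k _ => (hf k).pow_const _
  -- general claim over marginals
  have key : ∀ t : Finset ι, ∀ x : ι → Y,
      (∫⋯∫⁻_t, (fun x => ∏ k ∈ s, f k x ^ (1 / (D : ℝ))) ∂μ) x ≤
        ∏ k ∈ s, ((∫⋯∫⁻_t, f k ∂μ) x) ^ (1 / (D : ℝ)) := by
    intro t
    induction t using Finset.induction with
    | empty => intro x; simp
    | insert j t hj ih =>
      intro x
      rw [lmarginal_insert _ hmeas hj]
      have hsplit : ∀ (g : κ → ℝ≥0∞), ∏ k ∈ s, g k =
          (∏ k ∈ s.filter (fun k => j ∈ S k), g k) * ∏ k ∈ s.filter (fun k => ¬ j ∈ S k), g k :=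
        fun g => (Finset.prod_filter_mul_prod_filter_not s _ g).symm
      have hconst : ∀ k, j ∉ S k → ∀ y,
          (∫⋯∫⁻_t, f k ∂μ) (Function.update x j y) = (∫⋯∫⁻_t, f k ∂μ) x := by
        intro k hk y
        rw [lmarginal_update_of_notMem (hf k) hj]
        congr 1
        ext z
        exact hdep k j hk z y
      have hins : ∀ k, (∫⋯∫⁻_insert j t, f k ∂μ) x
          = ∫⁻ y, (∫⋯∫⁻_t, f k ∂μ) (Function.update x j y) ∂(μ j) :=
        fun k => lmarginal_insert _ (hf k) hj x
      calc ∫⁻ y, (∫⋯∫⁻_t, (fun x => ∏ k ∈ s, f k x ^ (1 / (D : ℝ))) ∂μ)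
              (Function.update x j y) ∂(μ j)
          ≤ ∫⁻ y, ∏ k ∈ s, ((∫⋯∫⁻_t, f k ∂μ) (Function.update x j y)) ^ (1 / (D : ℝ)) ∂(μ j) :=
            lintegral_mono fun y => ih _
        _ = ∫⁻ y, (∏ k ∈ s.filter (fun k => j ∈ S k),
              ((∫⋯∫⁻_t, f k ∂μ) (Function.update x j y)) ^ (1 / (D : ℝ))) *
              (∏ k ∈ s.filter (fun k => ¬ j ∈ S k),
              ((∫⋯∫⁻_t, f k ∂μ) x) ^ (1 / (D : ℝ))) ∂(μ j) := by
            refine lintegral_congr fun y => ?_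
            rw [hsplit]
            congr 1
            refine Finset.prod_congr rfl fun k hk => ?_
            rw [hconst k (Finset.mem_filter.1 hk).2]
        _ = (∫⁻ y, (∏ k ∈ s.filter (fun k => j ∈ S k),
              ((∫⋯∫⁻_t, f k ∂μ) (Function.update x j y)) ^ (1 / (D : ℝ))) ∂(μ j)) *
              (∏ k ∈ s.filter (fun k => ¬ j ∈ S k),
              ((∫⋯∫⁻_t, f k ∂μ) x) ^ (1 / (D : ℝ))) := by
            rw [lintegral_mul_const]
            exact Finset.measurable_prod _ fun k _ =>
              (((hf k).lmarginal μ).comp (measurable_update x)).pow_const _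
        _ ≤ (∏ k ∈ s.filter (fun k => j ∈ S k),
              ((∫⋯∫⁻_insert j t, f k ∂μ) x) ^ (1 / (D : ℝ))) *
              (∏ k ∈ s.filter (fun k => ¬ j ∈ S k),
              ((∫⋯∫⁻_insert j t, f k ∂μ) x) ^ (1 / (D : ℝ))) := by
            refine mul_le_mul' ?_ ?_
            · refine (gp_holder_few (μ j) _
                (fun k y => (∫⋯∫⁻_t, f k ∂μ) (Function.update x j y))
                (fun k => ((hf k).lmarginal μ).comp (measurable_update x)) D hD (hdeg j)).trans ?_
              refine Finset.prod_le_prod' fun k _ => ?_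
              rw [hins]
            · refine Finset.prod_le_prod' fun k hk => ?_
              rw [hins]
              simp_rw [hconst k (Finset.mem_filter.1 hk).2]
              simp
        _ = _ := (hsplit _).symm
  have := key Finset.univ (fun _ => Classical.arbitrary Y)
  simpa using this

/-- Marginal of the product measure on two distinct coordinates. -/
lemma gp_map_pair {ι Y : Type*} [Fintype ι] [DecidableEq ι] [MeasurableSpace Y]
    (P : Measure Y) [IsProbabilityMeasure P] (a b : ι) (hab : a ≠ b) :
    (Measure.pi fun _ : ι => P).map (fun z => (z a, z b)) = P.prod P := by
  symm
  refine Measure.prod_eq fun s t hs ht => ?_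
  rw [Measure.map_apply (by fun_prop) (hs.prod ht)]
  have : (fun z : ι → Y => (z a, z b)) ⁻¹' (s ×ˢ t) =
      Set.pi univ (fun i => if i = a then s else if i = b then t else univ) := by
    ext z
    simp only [mem_preimage, mem_prod, Set.mem_pi, mem_univ, true_implies]
    constructor
    · rintro ⟨h1, h2⟩ i
      split_ifs with h h'
      · rwa [h]
      · rwa [h']
      · trivial
    · intro h
      have h1 := h a
      have h2 := h b
      simp [hab.symm] at h1 h2
      exact ⟨h1, h2⟩
  rw [this, Measure.pi_pi]
  have : ∀ i, P (if i = a then s else if i = b then t else univ)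
      = (if i = a then P s else 1) * (if i = b then P t else 1) := by
    intro i
    by_cases h : i = a
    · subst h; simp [hab]
    · by_cases h' : i = b
      · simp [h', hab.symm]
      · simp [h, h']
  simp_rw [this]
  rw [Finset.prod_mul_distrib]
  simp

/-- Hölder bound for kernels on the edges of a graph with degrees at most `D`. -/
lemma gp_holder_edges {v : ℕ} {Y : Type*} [MeasurableSpace Y] (P : Measure Y)
    [IsProbabilityMeasure P] (E : Finset (Fin v × Fin v)) (hE : ∀ e ∈ E, e.1 ≠ e.2)
    (D : ℕ) (hD : 1 ≤ D)
    (hdeg : ∀ i, (E.filter (fun e => e.1 = i ∨ e.2 = i)).card ≤ D)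
    (p q : ℝ) (hpq : p.HolderConjugate q)
    (w : Fin v × Fin v → Y → Y → ℝ) (hw : ∀ e, Measurable (Function.uncurry (w e)))
    (g : (Fin v → Y) → ℝ≥0∞) (hg : Measurable g) :
    ∫⁻ z, g z * ∏ e ∈ E, ‖w e (z e.1) (z e.2)‖ₑ ∂(Measure.pi fun _ => P)
      ≤ (∫⁻ z, g z ^ p ∂(Measure.pi fun _ => P)) ^ (1 / p) *
        ∏ e ∈ E, (∫⁻ y, ‖w e y.1 y.2‖ₑ ^ (q * D) ∂(P.prod P)) ^ (1 / (q * D)) := by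
  classical
  have hD0 : (0 : ℝ) < D := by exact_mod_cast hD
  have hq0 : 0 < q := hpq.symm.pos
  have : Nonempty Y := by
    by_contra h
    rw [not_nonempty_iff] at h
    have h1 := measure_univ (μ := P)
    simp [Set.univ_eq_empty_iff.2 h] at h1
  have hwm : ∀ e : Fin v × Fin v, Measurable (fun z : Fin v → Y => ‖w e (z e.1) (z e.2)‖ₑ) := by
    intro e
    have : Measurable (fun z : Fin v → Y => (z e.1, z e.2)) := by fun_prop
    exact ((hw e).comp this).enorm
  refine (ENNReal.lintegral_mul_le_Lp_mul_Lq _ hpq hg.aemeasurable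
    (Finset.measurable_prod _ fun e _ => hwm e).aemeasurable).trans ?_
  refine mul_le_mul_right ?_ _
  have hF := gp_finner (fun _ : Fin v => P) E
    (fun e z => ‖w e (z e.1) (z e.2)‖ₑ ^ (q * D)) (fun e => (hwm e).pow_const _)
    (fun e => {e.1, e.2}) (by
      intro e i hi x y
      simp only [Finset.mem_insert, Finset.mem_singleton, not_or] at hi
      rw [Function.update_of_ne (Ne.symm hi.1), Function.update_of_ne (Ne.symm hi.2)]) D hD (by
      intro i
      refine le_trans (le_of_eq ?_) (hdeg i)
      congr 1
      ext e
      simp [eq_comm])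
  have h1 : ∀ z : Fin v → Y, (∏ e ∈ E, ‖w e (z e.1) (z e.2)‖ₑ) ^ q =
      ∏ e ∈ E, (‖w e (z e.1) (z e.2)‖ₑ ^ (q * D)) ^ (1 / (D : ℝ)) := by
    intro z
    rw [← ENNReal.prod_rpow_of_nonneg hq0.le]
    refine Finset.prod_congr rfl fun e _ => ?_
    rw [← ENNReal.rpow_mul]
    congr 1
    field_simp
  simp_rw [h1]
  refine (ENNReal.rpow_le_rpow hF (by positivity)).trans (le_of_eq ?_)
  rw [← ENNReal.prod_rpow_of_nonneg (by positivity)]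
  refine Finset.prod_congr rfl fun e he => ?_
  rw [← ENNReal.rpow_mul]
  have : (1 / (D : ℝ)) * (1 / q) = 1 / (q * D) := by field_simp
  rw [this]
  congr 1
  rw [← gp_map_pair P e.1 e.2 (hE e he), lintegral_map]
  · exact ((hw e).enorm).pow_const _
  · fun_prop

lemma gp_KLdiv_eq {α : Type*} [MeasurableSpace α] (ν ρ : Measure α)
    [IsProbabilityMeasure ν] [IsProbabilityMeasure ρ] :
    KLdiv ν ρ = InformationTheory.klDiv ν ρ := by
  unfold KLdiv
  rw [InformationTheory.klDiv_def]
  simp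

/-- Entropy (Young) inequality. -/
lemma gp_young {α : Type*} [MeasurableSpace α] (ν ρ : Measure α)
    [IsProbabilityMeasure ν] [IsProbabilityMeasure ρ] (F : α → ℝ) (hF : Measurable F) :
    ∫⁻ x, ENNReal.ofReal (F x) ∂ν ≤ InformationTheory.klDiv ν ρ +
      ∫⁻ x, ENNReal.ofReal (Real.exp (F x) - 1) ∂ρ := by
  by_cases hac : ν ≪ ρ
  swap
  · rw [InformationTheory.klDiv_of_not_ac hac]; simp
  rw [InformationTheory.klDiv_eq_lintegral_klFun_of_ac hac,
    ← lintegral_rnDeriv_mul hac hF.ennreal_ofReal.aemeasurable, ← lintegral_add_right]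
  swap
  · exact ((Real.measurable_exp.comp hF).sub_const _).ennreal_ofReal
  refine lintegral_mono_ae ?_
  filter_upwards [Measure.rnDeriv_lt_top ν ρ] with x hx
  set r := (ν.rnDeriv ρ x).toReal with hr
  have hr0 : 0 ≤ r := ENNReal.toReal_nonneg
  have h1 : ν.rnDeriv ρ x = ENNReal.ofReal r := (ENNReal.ofReal_toReal hx.ne).symm
  rw [h1, ← ENNReal.ofReal_mul hr0]
  refine le_trans (ENNReal.ofReal_le_ofReal ?_) ENNReal.ofReal_add_le
  rw [InformationTheory.klFun_apply]
  rcases hr0.eq_or_lt with h0 | h0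
  · rw [← h0]; simp; positivity
  · have h2 := Real.add_one_le_exp (F x - Real.log r)
    have h3 : r * Real.exp (F x - Real.log r) = Real.exp (F x) := by
      rw [Real.exp_sub, Real.exp_log h0]; field_simp
    nlinarith

/-- Tonelli for products over finite index types. -/
lemma gp_lintegral_pi_prod {ι α : Type*} [Fintype ι] [MeasurableSpace α] (ρ : ι → Measure α)
    [∀ i, IsProbabilityMeasure (ρ i)] (f : ι → α → ℝ≥0∞) (hf : ∀ i, Measurable (f i)) :
    ∫⁻ z, ∏ i, f i (z i) ∂(Measure.pi ρ) = ∏ i, ∫⁻ x, f i x ∂(ρ i) := by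
  have h := ProbabilityTheory.lintegral_prod_eq_prod_lintegral_of_indepFun (μ := Measure.pi ρ)
    Finset.univ (fun i (z : ι → α) => f i (z i))
    (ProbabilityTheory.iIndepFun_pi (X := f) fun i => (hf i).aemeasurable)
    (fun i => (hf i).comp (measurable_pi_apply i))
  rw [h]
  refine Finset.prod_congr rfl fun i _ => ?_
  exact (measurePreserving_eval ρ i).lintegral_comp (hf i)

lemma gp_pi_withDensity {n : ℕ} {α : Type*} [MeasurableSpace α] (ρ : Fin n → Measure α)
    [∀ i, IsProbabilityMeasure (ρ i)] (f : Fin n → α → ℝ≥0∞) (hf : ∀ i, Measurable (f i))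
    [∀ i, SigmaFinite ((ρ i).withDensity (f i))] :
    Measure.pi (fun i => (ρ i).withDensity (f i)) =
      (Measure.pi ρ).withDensity (fun z => ∏ i, f i (z i)) := by
  refine Measure.pi_eq fun s hs => ?_
  rw [withDensity_apply _ (MeasurableSet.univ_pi hs), ← lintegral_indicator (MeasurableSet.univ_pi hs)]
  have : ∀ z : Fin n → α, (Set.pi univ s).indicator (fun z => ∏ i, f i (z i)) z =
      ∏ i, (s i).indicator (f i) (z i) := by
    intro z
    by_cases hz : z ∈ Set.pi univ s
    · rw [indicator_of_mem hz]
      refine Finset.prod_congr rfl fun i _ => ?_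
      rw [indicator_of_mem (hz i (mem_univ i))]
    · rw [indicator_of_notMem hz]
      simp only [Set.mem_pi, mem_univ, true_implies, not_forall] at hz
      obtain ⟨i, hi⟩ := hz
      symm
      refine Finset.prod_eq_zero (Finset.mem_univ i) ?_
      rw [indicator_of_notMem hi]
  simp_rw [this]
  rw [gp_lintegral_pi_prod ρ _ (fun i => ((hf i).indicator (hs i)))]
  refine Finset.prod_congr rfl fun i _ => ?_
  rw [lintegral_indicator (hs i), withDensity_apply _ (hs i)]

/-- The stratified pieces of a measure. -/
noncomputable def gpStrat {α : Type*} [MeasurableSpace α] {n : ℕ} (τ : α → Fin n)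
    (ν : Measure α) (i : Fin n) : Measure α :=
  (n : ℝ≥0∞) • ν.restrict (τ ⁻¹' {i})

lemma gpStrat_prob {α : Type*} [MeasurableSpace α] {n : ℕ} {τ : α → Fin n}
    {ν : Measure α} (i : Fin n) (h : ν (τ ⁻¹' {i}) = (n : ℝ≥0∞)⁻¹) :
    IsProbabilityMeasure (gpStrat τ ν i) := by
  refine ⟨?_⟩
  have : (n : ℝ≥0∞) ≠ 0 := by
    have := i.pos
    exact_mod_cast this.ne'
  simp [gpStrat, h, ENNReal.mul_inv_cancel this]

/-- Gibbs variational lower bound for stratified product measures. -/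
lemma gp_gibbs_lower {α : Type*} [MeasurableSpace α] {n : ℕ} (ν ρ : Measure α)
    [IsProbabilityMeasure ν] [IsProbabilityMeasure ρ] (τ : α → Fin n) (hτ : Measurable τ)
    (hν : ∀ i, ν (τ ⁻¹' {i}) = (n : ℝ≥0∞)⁻¹) (hρ : ∀ i, ρ (τ ⁻¹' {i}) = (n : ℝ≥0∞)⁻¹)
    (hKL : InformationTheory.klDiv ν ρ ≠ ⊤) (G : (Fin n → α) → ℝ) (hG : Measurable G)
    (B : ℝ) (hB : ∀ z, |G z| ≤ B) :
    ∫ z, G z ∂(Measure.pi (gpStrat τ ν)) ≤ n * (InformationTheory.klDiv ν ρ).toReal +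
      Real.log (∫ z, Real.exp (G z) ∂(Measure.pi (gpStrat τ ρ))) := by
  obtain ⟨hac, hIntegr⟩ := InformationTheory.klDiv_ne_top_iff.1 hKL
  have hPν : ∀ i, IsProbabilityMeasure (gpStrat τ ν i) := fun i => gpStrat_prob i (hν i)
  have hPρ : ∀ i, IsProbabilityMeasure (gpStrat τ ρ i) := fun i => gpStrat_prob i (hρ i)
  set f := ν.rnDeriv ρ with hf
  have hfm : Measurable f := Measure.measurable_rnDeriv ν ρ
  have hdens : ∀ i, gpStrat τ ν i = (gpStrat τ ρ i).withDensity f := by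
    intro i
    unfold gpStrat
    rw [withDensity_smul_measure, ← restrict_withDensity (hτ (measurableSet_singleton i)),
      hf, Measure.withDensity_rnDeriv_eq _ _ hac]
  have : ∀ i, SigmaFinite ((gpStrat τ ρ i).withDensity f) := fun i => by
    rw [← hdens i]; infer_instance
  have hpi : Measure.pi (gpStrat τ ν) =
      (Measure.pi (gpStrat τ ρ)).withDensity (fun z => ∏ i, f (z i)) := by
    rw [← gp_pi_withDensity (gpStrat τ ρ) (fun _ => f) (fun _ => hfm)]
    congr 1
    ext1 i
    exact hdens i
  have hexp_int : Integrable (fun z => Real.exp (G z)) (Measure.pi (gpStrat τ ρ)) := by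
    refine Integrable.of_bound (Real.measurable_exp.comp hG).aestronglyMeasurable
      (Real.exp B) (ae_of_all _ fun z => ?_)
    rw [Real.norm_eq_abs, Real.abs_exp]
    exact Real.exp_le_exp.2 ((le_abs_self _).trans (hB z))
  set c := Real.log (∫ z, Real.exp (G z) ∂(Measure.pi (gpStrat τ ρ))) with hc
  have hpos : 0 < ∫ z, Real.exp (G z) ∂(Measure.pi (gpStrat τ ρ)) :=
    integral_exp_pos hexp_int
  have hacs : ∀ i, gpStrat τ ν i ≪ ν := fun i =>
    Measure.AbsolutelyContinuous.smul_left Measure.absolutelyContinuous_restrict _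
  -- a.e. positivity and finiteness of the density
  have hae1 : ∀ᵐ x ∂ν, 0 < f x := Measure.rnDeriv_pos hac
  have hae2 : ∀ᵐ x ∂ν, f x < ⊤ := hac.ae_le (Measure.rnDeriv_lt_top ν ρ)
  have haeP : ∀ᵐ z ∂(Measure.pi (gpStrat τ ν)), ∀ i, 0 < f (z i) ∧ f (z i) < ⊤ := by
    rw [ae_all_iff]
    intro i
    have h1 : ∀ᵐ x ∂(gpStrat τ ν i), 0 < f x ∧ f x < ⊤ :=
      (hacs i).ae_le (hae1.and hae2)
    exact (Measure.quasiMeasurePreserving_eval (μ := gpStrat τ ν) i).ae h1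
  have hllr_i : ∀ i, Integrable (llr ν ρ) (gpStrat τ ν i) := fun i =>
    (hIntegr.restrict).smul_measure (by simp)
  have hmp : ∀ i, MeasurePreserving (Function.eval i) (Measure.pi (gpStrat τ ν)) (gpStrat τ ν i) :=
    fun i => measurePreserving_eval _ i
  have hllr_z : ∀ i, Integrable (fun z => llr ν ρ (z i)) (Measure.pi (gpStrat τ ν)) := fun i =>
    (hmp i).integrable_comp_of_integrable (hllr_i i)
  have hsum : ∑ i, ∫ z, llr ν ρ (z i) ∂(Measure.pi (gpStrat τ ν)) =
      n * (InformationTheory.klDiv ν ρ).toReal := by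
    rw [InformationTheory.toReal_klDiv_of_measure_eq hac (by simp)]
    have h1 : ∀ i, ∫ z, llr ν ρ (z i) ∂(Measure.pi (gpStrat τ ν)) =
        n * ∫ x in τ ⁻¹' {i}, llr ν ρ x ∂ν := by
      intro i
      have := integral_map (hmp i).aemeasurable (f := llr ν ρ) (by
        exact (measurable_llr ν ρ).aestronglyMeasurable)
      rw [(hmp i).map_eq] at this
      simp only [Function.eval] at this
      rw [← this]
      simp [gpStrat, integral_smul_measure]
    simp_rw [h1]
    rw [← Finset.mul_sum, ← integral_iUnion_fintype (fun i => hτ (measurableSet_singleton i))]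
    · have hU : (⋃ i, τ ⁻¹' {i}) = univ := by ext x; simp
      rw [hU, Measure.restrict_univ]
    · intro i j hij
      exact Disjoint.preimage _ (by simpa using hij)
    · intro i; exact hIntegr.integrableOn
  -- the exponential martingale bound
  set h : (Fin n → α) → ℝ := fun z => Real.exp (G z - c - ∑ i, llr ν ρ (z i)) with hh
  have hhm : Measurable h := by
    refine Real.measurable_exp.comp ((hG.sub_const c).sub ?_)
    exact Finset.measurable_sum _ fun i _ => (measurable_llr ν ρ).comp (measurable_pi_apply i)
  have hL : ∫⁻ z, ENNReal.ofReal (h z) ∂(Measure.pi (gpStrat τ ν)) ≤ 1 := by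
    have h1 : ∫⁻ z, ENNReal.ofReal (h z) ∂(Measure.pi (gpStrat τ ν)) =
        ∫⁻ z, ENNReal.ofReal (Real.exp (G z - c)) * ∏ i, (f (z i))⁻¹
          ∂(Measure.pi (gpStrat τ ν)) := by
      refine lintegral_congr_ae ?_
      filter_upwards [haeP] with z hz
      simp only [hh]
      rw [sub_eq_add_neg, Real.exp_add, ENNReal.ofReal_mul (Real.exp_pos _).le,
        ← Finset.sum_neg_distrib, Real.exp_sum, ENNReal.ofReal_prod_of_nonneg
          (fun i _ => (Real.exp_pos _).le)]
      congr 1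
      refine Finset.prod_congr rfl fun i _ => ?_
      have hp : 0 < (f (z i)).toReal := ENNReal.toReal_pos (hz i).1.ne' (hz i).2.ne
      rw [llr, Real.exp_neg, Real.exp_log hp, ENNReal.ofReal_inv_of_pos hp,
        ENNReal.ofReal_toReal (hz i).2.ne]
    have hm2 : Measurable (fun z : Fin n → α => ∏ i, f (z i)) :=
      Finset.measurable_prod _ fun i _ => hfm.comp (measurable_pi_apply i)
    have hm3 : Measurable (fun z : Fin n → α =>
        ENNReal.ofReal (Real.exp (G z - c)) * ∏ i, (f (z i))⁻¹) :=
      (Real.measurable_exp.comp (hG.sub_const c)).ennreal_ofReal.mul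
        (Finset.measurable_prod _ fun i _ => (hfm.comp (measurable_pi_apply i)).inv)
    rw [h1, hpi, lintegral_withDensity_eq_lintegral_mul _ hm2 hm3]
    calc _ ≤ ∫⁻ z, ENNReal.ofReal (Real.exp (G z - c)) ∂(Measure.pi (gpStrat τ ρ)) := by
            refine lintegral_mono fun z => ?_
            simp only [Pi.mul_apply]
            rw [mul_left_comm, ← Finset.prod_mul_distrib]
            calc _ ≤ ENNReal.ofReal (Real.exp (G z - c)) * 1 := by
                  gcongr
                  exact Finset.prod_le_one' fun i _ => ENNReal.mul_inv_le_one _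
              _ = _ := mul_one _
      _ = 1 := by
            rw [← ofReal_integral_eq_lintegral_ofReal]
            · simp_rw [Real.exp_sub]
              rw [integral_div, hc, Real.exp_log hpos, div_self hpos.ne']
              simp
            · simp_rw [Real.exp_sub]
              exact hexp_int.div_const _
            · exact ae_of_all _ fun z => (Real.exp_pos _).le
  have hHIntegr : Integrable h (Measure.pi (gpStrat τ ν)) := by
    refine ⟨hhm.aestronglyMeasurable, ?_⟩
    rw [hasFiniteIntegral_iff_ofReal (ae_of_all _ fun z => (Real.exp_pos _).le)]
    exact hL.trans_lt ENNReal.one_lt_top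
  have hle1 : ∫ z, h z ∂(Measure.pi (gpStrat τ ν)) ≤ 1 := by
    rw [integral_eq_lintegral_of_nonneg_ae (ae_of_all _ fun z => (Real.exp_pos _).le)
      hhm.aestronglyMeasurable]
    exact ENNReal.toReal_le_of_le_ofReal zero_le_one (by simpa using hL)
  have hGint : Integrable G (Measure.pi (gpStrat τ ν)) :=
    Integrable.of_bound hG.aestronglyMeasurable B (ae_of_all _ hB)
  have hsumint : Integrable (fun z => ∑ i, llr ν ρ (z i)) (Measure.pi (gpStrat τ ν)) :=
    integrable_finsetSum _ fun i _ => hllr_z i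
  have hfin : ∫ z, ((G z - ∑ i, llr ν ρ (z i)) + (1 - c)) ∂(Measure.pi (gpStrat τ ν)) ≤ 1 := by
    refine (integral_mono ((hGint.sub hsumint).add (integrable_const _)) hHIntegr ?_).trans hle1
    intro z
    have := Real.add_one_le_exp (G z - c - ∑ i, llr ν ρ (z i))
    simp only [hh]
    simp only [Pi.add_apply, Pi.sub_apply]
    linarith
  have hadd := integral_add (f := fun z => G z - ∑ i, llr ν ρ (z i)) (g := fun _ => 1 - c)
    (hGint.sub hsumint) (integrable_const _)
  rw [hadd, integral_sub hGint hsumint,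
    integral_finsetSum _ (fun i _ => hllr_z i), hsum] at hfin
  simp at hfin
  linarith

/-- Standing combinatorial hypotheses. -/
structure GpSetup (v : ℕ) (E : Finset (Fin v × Fin v)) (D : ℕ) (p q : ℝ) : Prop where
  hE : ∀ e ∈ E, e.1 < e.2
  hD : 1 ≤ D
  hdeg : ∀ i, (E.filter (fun e => e.1 = i ∨ e.2 = i)).card ≤ D
  hpq : p.HolderConjugate q

/-- Kernels with norm at most `M`. -/
structure GpKer {Y : Type*} [MeasurableSpace Y] (P : Measure Y) (r M : ℝ)
    (w : Y → Y → ℝ) : Prop where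
  meas : Measurable (Function.uncurry w)
  norm : eLpNorm' (fun y : Y × Y => w y.1 y.2) r (P.prod P) ≤ ENNReal.ofReal M

lemma gp_holder_le {v : ℕ} {E : Finset (Fin v × Fin v)} {D : ℕ} {p q : ℝ}
    (S : GpSetup v E D p q) {Y : Type*} [MeasurableSpace Y] (P : Measure Y)
    [IsProbabilityMeasure P] {M : ℝ} (hM : 0 ≤ M)
    (w : Fin v × Fin v → Y → Y → ℝ) (hw : ∀ e, GpKer P (q * D) M (w e))
    (g : (Fin v → Y) → ℝ≥0∞) (hg : Measurable g) :
    ∫⁻ z, g z * ∏ e ∈ E, ‖w e (z e.1) (z e.2)‖ₑ ∂(Measure.pi fun _ => P)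
      ≤ (∫⁻ z, g z ^ p ∂(Measure.pi fun _ => P)) ^ (1 / p) * ENNReal.ofReal (M ^ E.card) := by
  refine (gp_holder_edges P E (fun e he => (S.hE e he).ne) D S.hD S.hdeg p q S.hpq w
    (fun e => (hw e).meas) g hg).trans ?_
  gcongr
  rw [ENNReal.ofReal_pow hM]
  exact Finset.prod_le_pow_card _ _ _ fun e _ => (hw e).norm

lemma gp_prodw_meas {v : ℕ} (E : Finset (Fin v × Fin v)) {Y : Type*} [MeasurableSpace Y]
    (w : Fin v × Fin v → Y → Y → ℝ) (hw : ∀ e, Measurable (Function.uncurry (w e))) :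
    Measurable (fun z : Fin v → Y => ∏ e ∈ E, w e (z e.1) (z e.2)) := by
  refine Finset.measurable_prod _ fun e _ => ?_
  have : Measurable (fun z : Fin v → Y => (z e.1, z e.2)) := by fun_prop
  exact (hw e).comp this

lemma gp_enorm_prod {κ : Type*} (E : Finset κ) (f : κ → ℝ) :
    ‖∏ e ∈ E, f e‖ₑ = ∏ e ∈ E, ‖f e‖ₑ := by
  classical
  induction E using Finset.induction_on with
  | empty => simp
  | insert a s ha ih => rw [Finset.prod_insert ha, Finset.prod_insert ha, enorm_mul, ih]

/-- Bilinear form bound by the cut norm. -/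
lemma gp_half {Y : Type*} [MeasurableSpace Y] (P : Measure Y) [IsProbabilityMeasure P]
    (k u : Y → ℝ) (hk : Integrable k P) (hum : Measurable u) (hu : ∀ s, |u s| ≤ 1) (η : ℝ)
    (hη : ∀ S, MeasurableSet S → |∫ s in S, k s ∂P| ≤ η) :
    |∫ s, u s * k s ∂P| ≤ 2 * η := by
  obtain ⟨k', hk'm, hkk'⟩ := hk.1
  have hkint' : Integrable k' P := hk.congr hkk'
  have hS : MeasurableSet {s | 0 ≤ k' s} := measurableSet_le measurable_const hk'm.measurable
  calc |∫ s, u s * k s ∂P| ≤ ∫ s, |k' s| ∂P := by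
        rw [← Real.norm_eq_abs]
        refine (norm_integral_le_integral_norm _).trans ?_
        refine integral_mono_ae ?_ hkint'.abs ?_
        · refine (Integrable.bdd_mul (c := 1) hk hum.aestronglyMeasurable ?_).norm
          exact ae_of_all _ fun s => by rw [Real.norm_eq_abs]; exact hu s
        · filter_upwards [hkk'] with s hs
          rw [norm_mul, Real.norm_eq_abs, Real.norm_eq_abs, hs]
          exact mul_le_of_le_one_left (abs_nonneg _) (hu s)
    _ = ∫ s in {s | 0 ≤ k' s}, |k' s| ∂P + ∫ s in {s | 0 ≤ k' s}ᶜ, |k' s| ∂P :=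
        (integral_add_compl hS hkint'.abs).symm
    _ = ∫ s in {s | 0 ≤ k' s}, k' s ∂P + ∫ s in {s | 0 ≤ k' s}ᶜ, - k' s ∂P := by
        congr 1
        · exact setIntegral_congr_fun hS fun s hs => abs_of_nonneg hs
        · exact setIntegral_congr_fun hS.compl fun s hs => abs_of_neg (by simpa using hs)
    _ ≤ η + η := by
        rw [integral_neg]
        refine add_le_add ?_ ?_
        · rw [← integral_congr_ae (ae_restrict_of_ae hkk')]
          exact (le_abs_self _).trans (hη _ hS)
        · rw [← integral_congr_ae (ae_restrict_of_ae hkk')]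
          exact (neg_le_abs _).trans (hη _ hS.compl)
    _ = 2 * η := by ring

lemma gp_bilin {Y : Type*} [MeasurableSpace Y] (P : Measure Y) [IsProbabilityMeasure P]
    (k : Y → Y → ℝ) (hk : Integrable (Function.uncurry k) (P.prod P))
    (u w : Y → ℝ) (hum : Measurable u) (hu : ∀ s, |u s| ≤ 1)
    (hwm : Measurable w) (hw : ∀ s, |w s| ≤ 1) (η : ℝ)
    (hη : ∀ S T, MeasurableSet S → MeasurableSet T → |∫ s in S, ∫ t in T, k s t ∂P ∂P| ≤ η) :
    |∫ s, ∫ t, u s * k s t * w t ∂P ∂P| ≤ 4 * η := by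
  have hkw : Integrable (fun z : Y × Y => w z.2 * k z.1 z.2) (P.prod P) :=
    Integrable.bdd_mul (c := 1) hk (hwm.comp measurable_snd).aestronglyMeasurable
      (ae_of_all _ fun z => by rw [Real.norm_eq_abs]; exact hw _)
  have h1 : ∀ s, ∫ t, u s * k s t * w t ∂P = u s * ∫ t, w t * k s t ∂P := by
    intro s
    rw [← integral_const_mul]
    congr 1; ext t; ring
  simp_rw [h1]
  have := gp_half P (fun s => ∫ t, w t * k s t ∂P) u hkw.integral_prod_left hum hu (2 * η) ?_
  · linarith
  intro S hS
  have hkS : Integrable (fun z : Y × Y => k z.1 z.2) ((P.restrict S).prod P) := by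
    have := hk.restrict (s := S ×ˢ univ)
    rwa [← Measure.prod_restrict, Measure.restrict_univ] at this
  have hkwS : Integrable (fun z : Y × Y => w z.2 * k z.1 z.2) ((P.restrict S).prod P) := by
    have := hkw.restrict (s := S ×ˢ univ)
    rwa [← Measure.prod_restrict, Measure.restrict_univ] at this
  rw [integral_integral_swap (f := fun s t => w t * k s t) hkwS]
  simp_rw [integral_const_mul]
  refine gp_half P (fun t => ∫ s in S, k s t ∂P) w hkS.integral_prod_right hwm hw η ?_
  intro T hT
  have hkST : Integrable (fun z : Y × Y => k z.1 z.2) ((P.restrict S).prod (P.restrict T)) := by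
    have := hk.restrict (s := S ×ˢ T)
    rwa [← Measure.prod_restrict] at this
  rw [← integral_integral_swap (f := fun s t => k s t) hkST]
  exact hη S T hS hT

lemma gp_resample {v : ℕ} {Y : Type*} [MeasurableSpace Y] (P : Measure Y)
    [IsProbabilityMeasure P] (a : Fin v) :
    MeasurePreserving (fun z : (Fin v → Y) × Y => Function.update z.1 a z.2)
      ((Measure.pi fun _ => P).prod P) (Measure.pi fun _ => P) := by
  have hm : Measurable (fun z : (Fin v → Y) × Y => Function.update z.1 a z.2) :=
    measurable_update'
  refine ⟨hm, ?_⟩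
  symm
  refine Measure.pi_eq fun s hs => ?_
  rw [Measure.map_apply hm (MeasurableSet.univ_pi hs)]
  have : (fun z : (Fin v → Y) × Y => Function.update z.1 a z.2) ⁻¹' (Set.pi univ s) =
      (Set.pi univ (Function.update s a univ)) ×ˢ (s a) := by
    ext z
    simp only [mem_preimage, Set.mem_pi, mem_univ, true_implies, mem_prod]
    constructor
    · intro h
      refine ⟨fun i => ?_, by simpa using h a⟩
      by_cases hi : i = a
      · subst hi; simp
      · simpa [hi] using h i
    · rintro ⟨h1, h2⟩ i
      by_cases hi : i = a
      · subst hi; simpa using h2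
      · simpa [hi] using h1 i
  rw [this, Measure.prod_prod, Measure.pi_pi, ← Finset.prod_erase_mul _ _ (Finset.mem_univ a),
    ← Finset.prod_erase_mul (s := Finset.univ) (fun i => P (s i)) (Finset.mem_univ a)]
  simp only [Function.update_self, measure_univ, mul_one]
  congr 1
  refine Finset.prod_congr rfl fun i hi => ?_
  rw [Function.update_of_ne (Finset.ne_of_mem_erase hi)]

lemma gp_resample_int {v : ℕ} {Y : Type*} [MeasurableSpace Y] (P : Measure Y)
    [IsProbabilityMeasure P] (a : Fin v) (Φ : (Fin v → Y) → ℝ)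
    (hΦ : Integrable Φ (Measure.pi fun _ => P)) :
    ∫ z, Φ z ∂(Measure.pi fun _ => P) =
      ∫ z, ∫ s, Φ (Function.update z a s) ∂P ∂(Measure.pi fun _ => P) ∧
    Integrable (fun z => ∫ s, Φ (Function.update z a s) ∂P) (Measure.pi fun _ => P) := by
  have h := gp_resample (v := v) P a
  have h1 : Integrable (fun z : (Fin v → Y) × Y => Φ (Function.update z.1 a z.2))
      ((Measure.pi fun _ => P).prod P) := h.integrable_comp_of_integrable hΦ
  refine ⟨?_, h1.integral_prod_left⟩
  rw [← integral_prod _ h1]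
  conv_lhs => rw [← h.map_eq]
  rw [integral_map h.aemeasurable]
  rw [h.map_eq]; exact hΦ.1

lemma gp_count_UV {v : ℕ} {Y : Type*} [MeasurableSpace Y] (P : Measure Y)
    [IsProbabilityMeasure P] (a b : Fin v) (hab : a ≠ b) (U V : (Fin v → Y) → ℝ)
    (hU : Measurable U) (hV : Measurable V) (hU1 : ∀ z, |U z| ≤ 1) (hV1 : ∀ z, |V z| ≤ 1)
    (hUb : ∀ z t, U (Function.update z b t) = U z)
    (hVa : ∀ z s, V (Function.update z a s) = V z)
    (k : Y → Y → ℝ) (hk : Integrable (Function.uncurry k) (P.prod P)) (η : ℝ)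
    (hη : ∀ S T, MeasurableSet S → MeasurableSet T → |∫ s in S, ∫ t in T, k s t ∂P ∂P| ≤ η) :
    |∫ z, U z * k (z a) (z b) * V z ∂(Measure.pi fun _ => P)| ≤ 4 * η := by
  have hkz : Integrable (fun z : Fin v → Y => k (z a) (z b)) (Measure.pi fun _ => P) := by
    have hm : MeasurePreserving (fun z : Fin v → Y => (z a, z b)) (Measure.pi fun _ => P)
      (P.prod P) := ⟨by fun_prop, gp_map_pair P a b hab⟩
    exact hm.integrable_comp_of_integrable hk
  have hΦ : Integrable (fun z : Fin v → Y => U z * k (z a) (z b) * V z)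
      (Measure.pi fun _ => P) := by
    refine Integrable.mul_bdd (c := 1) (Integrable.bdd_mul (c := 1) hkz hU.aestronglyMeasurable ?_)
      hV.aestronglyMeasurable ?_
    · exact ae_of_all _ fun z => by rw [Real.norm_eq_abs]; exact hU1 _
    · exact ae_of_all _ fun z => by rw [Real.norm_eq_abs]; exact hV1 _
  obtain ⟨h1, h2⟩ := gp_resample_int P b _ hΦ
  obtain ⟨h3, h4⟩ := gp_resample_int P a _ h2
  rw [h1, h3, ← Real.norm_eq_abs]
  have hb : ∀ x : Fin v → Y, ‖∫ s, ∫ t,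
      U (Function.update (Function.update x a s) b t) *
        k (Function.update (Function.update x a s) b t a)
          (Function.update (Function.update x a s) b t b) *
        V (Function.update (Function.update x a s) b t) ∂P ∂P‖ ≤ 4 * η := by
    intro x
    have hV2 : ∀ s t, V (Function.update (Function.update x a s) b t) =
        V (Function.update x b t) := by
      intro s t
      rw [Function.update_comm hab, hVa]
    simp only [hUb, hV2, Function.update_self, Function.update_of_ne hab]
    rw [Real.norm_eq_abs]
    exact gp_bilin P k hk (fun s => U (Function.update x a s)) (fun t => V (Function.update x b t))
      (hU.comp (measurable_update x)) (fun s => hU1 _) (hV.comp (measurable_update x))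
      (fun s => hV1 _) η hη
  refine (norm_integral_le_of_norm_le_const (ae_of_all _ hb)).trans ?_
  simp

/-- Truncated kernel. -/
noncomputable def gpTr {Y : Type*} (R : ℝ) (w : Y → Y → ℝ) (s t : Y) : ℝ :=
  if |w s t| ≤ R then w s t else 0

lemma gpTr_abs {Y : Type*} {R : ℝ} (hR : 0 ≤ R) (w : Y → Y → ℝ) (s t : Y) :
    |gpTr R w s t| ≤ R := by
  unfold gpTr; split_ifs with h
  · exact h
  · simpa using hR

lemma gpTr_meas {Y : Type*} [MeasurableSpace Y] (R : ℝ) (w : Y → Y → ℝ)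
    (hw : Measurable (Function.uncurry w)) : Measurable (Function.uncurry (gpTr R w)) := by
  have : Function.uncurry (gpTr R w) =
      fun z : Y × Y => if |Function.uncurry w z| ≤ R then Function.uncurry w z else 0 := by
    ext z; rfl
  rw [this]
  exact Measurable.ite (measurableSet_le hw.abs measurable_const) hw measurable_const

lemma gp_ker_markov {Y : Type*} [MeasurableSpace Y] (P : Measure Y) [IsProbabilityMeasure P]
    {r M R : ℝ} (hr : 1 ≤ r) (hR : 1 ≤ R) (hM : 0 ≤ M) (w : Y → Y → ℝ) (hw : GpKer P r M w) :
    (P.prod P) {y | ¬ |w y.1 y.2| ≤ R} ≤ ENNReal.ofReal (M ^ r / R) := by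
  have hr0 : 0 < r := by linarith
  have h1 : ∫⁻ y, ‖w y.1 y.2‖ₑ ^ r ∂(P.prod P) ≤ ENNReal.ofReal (M ^ r) := by
    have := ENNReal.rpow_le_rpow hw.norm hr0.le
    rw [eLpNorm', ← ENNReal.rpow_mul, one_div_mul_cancel hr0.ne', ENNReal.rpow_one,
      ENNReal.ofReal_rpow_of_nonneg hM hr0.le] at this
    exact this
  have h2 := mul_meas_ge_le_lintegral (μ := P.prod P) (f := fun y => ‖w y.1 y.2‖ₑ ^ r)
    (hw.meas.enorm.pow_const r) (ENNReal.ofReal R)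
  have h3 : {y : Y × Y | ¬ |w y.1 y.2| ≤ R} ⊆ {y | ENNReal.ofReal R ≤ ‖w y.1 y.2‖ₑ ^ r} := by
    intro y hy
    simp only [mem_ofPred_eq, not_le] at hy ⊢
    rw [← ofReal_norm, Real.norm_eq_abs, ENNReal.ofReal_rpow_of_nonneg (abs_nonneg _) hr0.le]
    refine ENNReal.ofReal_le_ofReal (hy.le.trans ?_)
    exact Real.self_le_rpow_of_one_le (hR.trans hy.le) hr
  rw [ENNReal.ofReal_div_of_pos (by linarith), ENNReal.le_div_iff_mul_le (by simp; left; linarith)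
    (by simp), mul_comm]
  exact (mul_le_mul_right (measure_mono h3) _).trans (h2.trans h1)

lemma gp_ker_int {Y : Type*} [MeasurableSpace Y] (P : Measure Y) [IsProbabilityMeasure P]
    {r M : ℝ} (hr : 1 ≤ r) (w : Y → Y → ℝ) (hw : GpKer P r M w) :
    Integrable (Function.uncurry w) (P.prod P) := by
  have h : MemLp (Function.uncurry w) (ENNReal.ofReal r) (P.prod P) := by
    refine ⟨hw.meas.aestronglyMeasurable, ?_⟩
    rw [eLpNorm_eq_eLpNorm' (by simp; linarith) (by simp), ENNReal.toReal_ofReal (by linarith)]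
    exact hw.norm.trans_lt ENNReal.ofReal_lt_top
  exact h.integrable (by simpa using hr)

lemma GpSetup.one_le_r {v : ℕ} {E : Finset (Fin v × Fin v)} {D : ℕ} {p q : ℝ}
    (S : GpSetup v E D p q) : 1 ≤ q * D := by
  have h1 : 1 < q := S.hpq.symm.lt
  have h2 : (1 : ℝ) ≤ D := by exact_mod_cast S.hD
  nlinarith

lemma gp_ker_intg {v : ℕ} {E : Finset (Fin v × Fin v)} {D : ℕ} {p q : ℝ}
    (S : GpSetup v E D p q) {Y : Type*} [MeasurableSpace Y] (P : Measure Y)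
    [IsProbabilityMeasure P] {M : ℝ} (hM : 0 ≤ M)
    (w : Fin v × Fin v → Y → Y → ℝ) (hw : ∀ e, GpKer P (q * D) M (w e))
    (g : (Fin v → Y) → ℝ) (hg : Measurable g)
    (hgp : ∫⁻ z, ‖g z‖ₑ ^ p ∂(Measure.pi fun _ => P) < ⊤) :
    Integrable (fun z => g z * ∏ e ∈ E, w e (z e.1) (z e.2)) (Measure.pi fun _ => P) := by
  refine ⟨(hg.mul (gp_prodw_meas E w fun e => (hw e).meas)).aestronglyMeasurable, ?_⟩
  rw [hasFiniteIntegral_iff_enorm]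
  simp_rw [enorm_mul, gp_enorm_prod]
  refine (gp_holder_le S P hM w hw _ hg.enorm).trans_lt (ENNReal.mul_lt_top ?_ (by simp))
  exact ENNReal.rpow_lt_top_of_nonneg (by have := S.hpq.pos; positivity) hgp.ne

lemma gp_int_bound {v : ℕ} {E : Finset (Fin v × Fin v)} {D : ℕ} {p q : ℝ}
    (S : GpSetup v E D p q) {Y : Type*} [MeasurableSpace Y] (P : Measure Y)
    [IsProbabilityMeasure P] {M : ℝ} (hM : 0 ≤ M)
    (w : Fin v × Fin v → Y → Y → ℝ) (hw : ∀ e, GpKer P (q * D) M (w e))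
    (g : (Fin v → Y) → ℝ) (hg : Measurable g) (A : ℝ) (hA : 0 ≤ A)
    (hgp : (∫⁻ z, ‖g z‖ₑ ^ p ∂(Measure.pi fun _ => P)) ^ (1 / p) ≤ ENNReal.ofReal A) :
    |∫ z, g z * ∏ e ∈ E, w e (z e.1) (z e.2) ∂(Measure.pi fun _ => P)| ≤ A * M ^ E.card := by
  rw [← Real.norm_eq_abs]
  refine (norm_integral_le_lintegral_norm _).trans ?_
  refine ENNReal.toReal_le_of_le_ofReal (by positivity) ?_
  simp_rw [ofReal_norm, enorm_mul, gp_enorm_prod]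
  refine (gp_holder_le S P hM w hw _ hg.enorm).trans ?_
  rw [ENNReal.ofReal_mul hA]
  gcongr

lemma gp_abs_prod_le {κ : Type*} (s E : Finset κ) (hs : s ⊆ E) (f : κ → ℝ) (R : ℝ) (hR : 1 ≤ R)
    (hf : ∀ e, |f e| ≤ R) : |∏ e ∈ s, f e| ≤ R ^ E.card := by
  rw [Finset.abs_prod]
  calc ∏ e ∈ s, |f e| ≤ ∏ e ∈ s, R := Finset.prod_le_prod (fun _ _ => abs_nonneg _) fun e _ => hf e
    _ = R ^ s.card := by simp
    _ ≤ R ^ E.card := pow_le_pow_right₀ hR (Finset.card_le_card hs)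

lemma gp_abs_prod_le_one {κ : Type*} (s : Finset κ) (f : κ → ℝ) 
    (hf : ∀ e, |f e| ≤ 1) : |∏ e ∈ s, f e| ≤ 1 := by
  simpa using gp_abs_prod_le s s subset_rfl f 1 le_rfl hf

lemma gp_count_tr {v : ℕ} {E : Finset (Fin v × Fin v)} (hE : ∀ e ∈ E, e.1 < e.2)
    {Y : Type*} [MeasurableSpace Y] (P : Measure Y)
    [IsProbabilityMeasure P] (w : Fin v × Fin v → Y → Y → ℝ)
    (hw : ∀ e, Measurable (Function.uncurry (w e))) (R : ℝ) (hR : 1 ≤ R)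
    (hwR : ∀ e s t, |w e s t| ≤ R)
    (f : Fin v → Y → ℝ) (hfm : ∀ a, Measurable (f a)) (hf : ∀ a y, |f a y| ≤ 1)
    (e0 : Fin v × Fin v) (he0 : e0 ∈ E) (k : Y → Y → ℝ)
    (hk : Integrable (Function.uncurry k) (P.prod P)) (η : ℝ)
    (hη : ∀ S T, MeasurableSet S → MeasurableSet T → |∫ s in S, ∫ t in T, k s t ∂P ∂P| ≤ η) :
    |∫ z, (∏ a, f a (z a)) * (k (z e0.1) (z e0.2) * ∏ e ∈ E.erase e0, w e (z e.1) (z e.2))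
      ∂(Measure.pi fun _ => P)| ≤ (R ^ E.card * R ^ E.card) * (4 * η) := by
  set a := e0.1
  set b := e0.2
  have hab : a < b := hE e0 he0
  set R' := R ^ E.card with hR'
  have hR'1 : 1 ≤ R' := one_le_pow₀ hR
  have hR'0 : 0 < R' := by linarith
  set U : (Fin v → Y) → ℝ := fun z => (∏ a' ∈ Finset.univ.erase b, f a' (z a')) *
    (∏ e ∈ (E.erase e0).filter (fun e => ¬ (e.1 = b ∨ e.2 = b)), w e (z e.1) (z e.2)) / R' with hU
  set V : (Fin v → Y) → ℝ := fun z => f b (z b) *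
    (∏ e ∈ (E.erase e0).filter (fun e => (e.1 = b ∨ e.2 = b)), w e (z e.1) (z e.2)) / R' with hV
  have hfz : ∀ a' : Fin v, Measurable (fun z : Fin v → Y => f a' (z a')) := fun a' =>
    (hfm a').comp (measurable_pi_apply a')
  have hmain := gp_count_UV P a b hab.ne U V
    (((Finset.measurable_prod _ fun a' _ => hfz a').mul (gp_prodw_meas _ w hw)).div_const _)
    (((hfz b).mul (gp_prodw_meas _ w hw)).div_const _) ?_ ?_ ?_ ?_ k hk η hη
  · have : ∀ z : Fin v → Y, (∏ a, f a (z a)) *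
        (k (z a) (z b) * ∏ e ∈ E.erase e0, w e (z e.1) (z e.2)) =
        (R' * R') * (U z * k (z a) (z b) * V z) := by
      intro z
      simp only [hU, hV]
      rw [← Finset.prod_filter_not_mul_prod_filter (E.erase e0) (fun e => (e.1 = b ∨ e.2 = b)),
        ← Finset.prod_erase_mul Finset.univ _ (Finset.mem_univ b)]
      field_simp
    simp_rw [this]
    rw [integral_const_mul, abs_mul, abs_of_pos (mul_pos hR'0 hR'0)]
    gcongr
  · intro z
    simp only [hU]
    rw [abs_div, abs_of_pos hR'0, div_le_one hR'0, abs_mul]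
    calc _ ≤ 1 * R' := by
          gcongr
          · exact gp_abs_prod_le_one _ _ fun a' => hf a' _
          · exact gp_abs_prod_le _ E ((Finset.filter_subset _ _).trans (Finset.erase_subset _ _))
              _ R hR fun e => hwR e _ _
      _ = R' := one_mul _
  · intro z
    simp only [hV]
    rw [abs_div, abs_of_pos hR'0, div_le_one hR'0, abs_mul]
    calc _ ≤ 1 * R' := by
          gcongr
          · exact hf b _
          · exact gp_abs_prod_le _ E ((Finset.filter_subset _ _).trans (Finset.erase_subset _ _))
              _ R hR fun e => hwR e _ _
      _ = R' := one_mul _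
  · intro z t
    simp only [hU]
    congr 2
    · refine Finset.prod_congr rfl fun a' ha' => ?_
      rw [Function.update_of_ne (Finset.ne_of_mem_erase ha')]
    · refine Finset.prod_congr rfl fun e he => ?_
      have := (Finset.mem_filter.1 he).2
      push Not at this
      rw [Function.update_of_ne this.1, Function.update_of_ne this.2]
  · intro z s
    simp only [hV]
    rw [Function.update_of_ne hab.ne']
    congr 2
    refine Finset.prod_congr rfl fun e he => ?_
    obtain ⟨he1, he2⟩ := Finset.mem_filter.1 he
    have hne := Finset.ne_of_mem_erase he1
    have hlt := hE e (Finset.mem_of_mem_erase he1)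
    have h1 : e.1 ≠ a := by
      intro h
      rcases he2 with h2 | h2
      · rw [h] at h2; exact hab.ne h2
      · exact hne (Prod.ext h h2)
    have h2 : e.2 ≠ a := by
      intro h
      rcases he2 with h2 | h2
      · rw [h2, h] at hlt; exact absurd hlt hab.asymm
      · rw [h] at h2; exact hab.ne h2
    rw [Function.update_of_ne h1, Function.update_of_ne h2]

lemma gp_count_edge {v : ℕ} {E : Finset (Fin v × Fin v)} {D : ℕ} {p q : ℝ}
    (S : GpSetup v E D p q) {Y : Type*} [MeasurableSpace Y] (P : Measure Y)
    [IsProbabilityMeasure P] {M : ℝ} (hM : 0 ≤ M)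
    (w : Fin v × Fin v → Y → Y → ℝ) (hw : ∀ e, GpKer P (q * D) M (w e))
    (f : Fin v → Y → ℝ) (hfm : ∀ a, Measurable (f a)) (hf : ∀ a y, |f a y| ≤ 1)
    (e0 : Fin v × Fin v) (he0 : e0 ∈ E) (η : ℝ) (R : ℝ) (hR : 1 ≤ R)
    (hη : ∀ S T, MeasurableSet S → MeasurableSet T →
      |∫ s in S, ∫ t in T, w e0 s t ∂P ∂P| ≤ η) :
    |∫ z, (∏ a, f a (z a)) * ∏ e ∈ E, w e (z e.1) (z e.2) ∂(Measure.pi fun _ => P)| ≤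
      (R ^ E.card * R ^ E.card) * (4 * η) +
      (E.card * (M ^ (q * D) / R)) ^ (1 / p) * M ^ E.card := by
  classical
  have hp := S.hpq.pos
  set A : Set (Fin v → Y) := {z | ∃ e ∈ E.erase e0, ¬ |w e (z e.1) (z e.2)| ≤ R} with hA
  have hpair : ∀ e : Fin v × Fin v, Measurable (fun z : Fin v → Y => (z e.1, z e.2)) := by
    intro e; fun_prop
  have hBm : ∀ e, MeasurableSet {z : Fin v → Y | ¬ |w e (z e.1) (z e.2)| ≤ R} := by
    intro e
    exact (measurableSet_le ((hw e).meas.comp (hpair e)).abs measurable_const).compl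
  have hAU : A = ⋃ e ∈ E.erase e0, {z | ¬ |w e (z e.1) (z e.2)| ≤ R} := by
    ext z; simp [hA]
  have hAm : MeasurableSet A := by
    rw [hAU]; exact Finset.measurableSet_biUnion _ fun e _ => hBm e
  have hF : Measurable (fun z : Fin v → Y => ∏ a, f a (z a)) :=
    Finset.measurable_prod _ fun a _ => (hfm a).comp (measurable_pi_apply a)
  have hF1 : ∀ z : Fin v → Y, |∏ a, f a (z a)| ≤ 1 := fun z =>
    gp_abs_prod_le_one _ _ fun a => hf a _
  have hAP : (Measure.pi fun _ : Fin v => P) A ≤ ENNReal.ofReal (E.card * (M ^ (q * D) / R)) := by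
    rw [hAU]
    refine (measure_biUnion_finset_le _ _).trans ?_
    have h1 : ∀ e ∈ E.erase e0, (Measure.pi fun _ : Fin v => P) {z | ¬ |w e (z e.1) (z e.2)| ≤ R}
        ≤ ENNReal.ofReal (M ^ (q * D) / R) := by
      intro e he
      refine le_trans (le_of_eq ?_) (gp_ker_markov P S.one_le_r hR hM (w e) (hw e))
      have hms : MeasurableSet {y : Y × Y | ¬ |w e y.1 y.2| ≤ R} :=
        (measurableSet_le (hw e).meas.abs measurable_const).compl
      rw [← gp_map_pair P e.1 e.2 (S.hE e (Finset.mem_of_mem_erase he)).ne,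
        Measure.map_apply (hpair e) hms]
      rfl
    refine (Finset.sum_le_card_nsmul _ _ _ h1).trans ?_
    rw [ENNReal.ofReal_mul (by positivity), nsmul_eq_mul, ENNReal.ofReal_natCast]
    gcongr
    exact Finset.erase_subset _ _
  set g : (Fin v → Y) → ℝ := A.indicator (fun z => ∏ a, f a (z a)) with hg
  have hgm : Measurable g := hF.indicator hAm
  have hgp : (∫⁻ z, ‖g z‖ₑ ^ p ∂(Measure.pi fun _ => P)) ≤
      ENNReal.ofReal (E.card * (M ^ (q * D) / R)) := by
    refine le_trans ?_ hAP
    rw [← lintegral_indicator_one hAm]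
    refine lintegral_mono fun z => ?_
    by_cases hz : z ∈ A
    · rw [indicator_of_mem hz, hg, indicator_of_mem hz, Pi.one_apply]
      refine ENNReal.rpow_le_one ?_ hp.le
      rw [← ofReal_norm, Real.norm_eq_abs]
      exact ENNReal.ofReal_le_one.2 (hF1 z)
    · rw [hg, indicator_of_notMem hz, indicator_of_notMem hz]
      simp [hp]
  have hbound := gp_int_bound S P hM w hw g hgm
    ((E.card * (M ^ (q * D) / R)) ^ (1 / p)) (by positivity) (by
      rw [← ENNReal.ofReal_rpow_of_nonneg (by positivity) (by positivity)]
      exact ENNReal.rpow_le_rpow hgp (by positivity))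
  have hintg := gp_ker_intg S P hM w hw g hgm (hgp.trans_lt ENNReal.ofReal_lt_top)
  have htr := gp_count_tr S.hE P (fun e => gpTr R (w e)) (fun e => gpTr_meas R _ (hw e).meas) R hR
    (fun e s t => gpTr_abs (by linarith) _ _ _) f hfm hf e0 he0 (w e0)
    (gp_ker_int P S.one_le_r _ (hw e0)) η hη
  have hsplit : ∀ z : Fin v → Y, (∏ a, f a (z a)) * ∏ e ∈ E, w e (z e.1) (z e.2) =
      (∏ a, f a (z a)) * (w e0 (z e0.1) (z e0.2) *
        ∏ e ∈ E.erase e0, gpTr R (w e) (z e.1) (z e.2)) +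
      g z * ∏ e ∈ E, w e (z e.1) (z e.2) := by
    intro z
    by_cases hz : z ∈ A
    · rw [hg, indicator_of_mem hz]
      obtain ⟨e, he, hez⟩ := hz
      have : ∏ e ∈ E.erase e0, gpTr R (w e) (z e.1) (z e.2) = 0 := by
        refine Finset.prod_eq_zero he ?_
        rw [gpTr, if_neg hez]
      rw [this]; ring
    · rw [hg, indicator_of_notMem hz, ← Finset.mul_prod_erase E _ he0]
      have : ∏ e ∈ E.erase e0, gpTr R (w e) (z e.1) (z e.2) =
          ∏ e ∈ E.erase e0, w e (z e.1) (z e.2) := by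
        refine Finset.prod_congr rfl fun e he => ?_
        rw [gpTr, if_pos]
        by_contra h
        exact hz ⟨e, he, h⟩
      rw [this]; ring
  have hintall := gp_ker_intg S P hM w hw _ hF (by
    refine lt_of_le_of_lt (lintegral_mono (g := fun _ => 1) fun z => ?_) (by simp)
    refine ENNReal.rpow_le_one ?_ hp.le
    rw [← ofReal_norm, Real.norm_eq_abs]
    exact ENNReal.ofReal_le_one.2 (hF1 z))
  have hinttr : Integrable (fun z : Fin v → Y => (∏ a, f a (z a)) * (w e0 (z e0.1) (z e0.2) *
        ∏ e ∈ E.erase e0, gpTr R (w e) (z e.1) (z e.2))) (Measure.pi fun _ => P) := by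
    refine (hintall.sub hintg).congr (ae_of_all _ fun z => ?_)
    simp only [Pi.sub_apply]
    rw [hsplit z]; ring
  simp_rw [hsplit]
  rw [integral_add hinttr hintg]
  exact (abs_add_le _ _).trans (add_le_add htr hbound)

lemma GpKer.mono {Y : Type*} [MeasurableSpace Y] {P : Measure Y} {r M M' : ℝ}
    {w : Y → Y → ℝ} (h : GpKer P r M w) (hM : M ≤ M') : GpKer P r M' w :=
  ⟨h.meas, h.norm.trans (ENNReal.ofReal_le_ofReal hM)⟩

lemma GpKer.sub {Y : Type*} [MeasurableSpace Y] {P : Measure Y} {r M M' : ℝ}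
    (hr : 1 ≤ r) (hM : 0 ≤ M) (hM' : 0 ≤ M')
    {w w' : Y → Y → ℝ} (h : GpKer P r M w) (h' : GpKer P r M' w') :
    GpKer P r (M + M') (fun s t => w s t - w' s t) := by
  refine ⟨h.meas.sub h'.meas, ?_⟩
  have h1 := eLpNorm'_add_le (q := r) (f := fun y : Y × Y => w y.1 y.2)
    (g := fun y : Y × Y => - w' y.1 y.2) (μ := P.prod P)
    h.meas.aestronglyMeasurable h'.meas.neg.aestronglyMeasurable hr
  have h2 : eLpNorm' (fun y : Y × Y => - w' y.1 y.2) r (P.prod P) =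
      eLpNorm' (fun y : Y × Y => w' y.1 y.2) r (P.prod P) := by
    simp [eLpNorm']
  rw [h2] at h1
  rw [ENNReal.ofReal_add hM hM']
  refine le_trans (le_of_eq ?_) (h1.trans (add_le_add h.norm h'.norm))
  congr 1

lemma gp_count_tele {v : ℕ} {E : Finset (Fin v × Fin v)} {D : ℕ} {p q : ℝ}
    (S : GpSetup v E D p q) {Y : Type*} [MeasurableSpace Y] (P : Measure Y)
    [IsProbabilityMeasure P] {M : ℝ} (hM : 0 ≤ M)
    (w w' : Y → Y → ℝ) (hw : GpKer P (q * D) M w) (hw' : GpKer P (q * D) M w')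
    (f : Fin v → Y → ℝ) (hfm : ∀ a, Measurable (f a)) (hf : ∀ a y, |f a y| ≤ 1)
    (η : ℝ) (R : ℝ) (hR : 1 ≤ R)
    (hη : ∀ S T, MeasurableSet S → MeasurableSet T →
      |∫ s in S, ∫ t in T, (w s t - w' s t) ∂P ∂P| ≤ η) :
    |∫ z, (∏ a, f a (z a)) * ∏ e ∈ E, w (z e.1) (z e.2) ∂(Measure.pi fun _ => P) -
      ∫ z, (∏ a, f a (z a)) * ∏ e ∈ E, w' (z e.1) (z e.2) ∂(Measure.pi fun _ => P)| ≤
      E.card * ((R ^ E.card * R ^ E.card) * (4 * η) +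
      (E.card * ((M + M) ^ (q * D) / R)) ^ (1 / p) * (M + M) ^ E.card) := by
  classical
  set C := (R ^ E.card * R ^ E.card) * (4 * η) +
      (E.card * ((M + M) ^ (q * D) / R)) ^ (1 / p) * (M + M) ^ E.card with hC
  have hp := S.hpq.pos
  have hF : Measurable (fun z : Fin v → Y => ∏ a, f a (z a)) :=
    Finset.measurable_prod _ fun a _ => (hfm a).comp (measurable_pi_apply a)
  have hF1 : ∀ z : Fin v → Y, |∏ a, f a (z a)| ≤ 1 := fun z =>
    gp_abs_prod_le_one _ _ fun a => hf a _
  have hFp : ∫⁻ z, ‖∏ a, f a (z a)‖ₑ ^ p ∂(Measure.pi fun _ : Fin v => P) < ⊤ := by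
    refine lt_of_le_of_lt (lintegral_mono (g := fun _ => 1) fun z => ?_) (by simp)
    refine ENNReal.rpow_le_one ?_ hp.le
    rw [← ofReal_norm, Real.norm_eq_abs]
    exact ENNReal.ofReal_le_one.2 (hF1 z)
  have key : ∀ E' : Finset (Fin v × Fin v), E' ⊆ E →
      |∫ z, (∏ a, f a (z a)) * ∏ e ∈ E, (if e ∈ E' then w else w') (z e.1) (z e.2)
          ∂(Measure.pi fun _ => P) -
      ∫ z, (∏ a, f a (z a)) * ∏ e ∈ E, w' (z e.1) (z e.2) ∂(Measure.pi fun _ => P)| ≤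
      E'.card * C := by
    intro E'
    induction E' using Finset.induction_on with
    | empty => intro _; simp
    | insert e0 E' he0 ih =>
      intro hsub
      have hsub' : E' ⊆ E := (Finset.subset_insert _ _).trans hsub
      have he0E : e0 ∈ E := hsub (Finset.mem_insert_self _ _)
      have ih' := ih hsub'
      have hker : ∀ E'' : Finset (Fin v × Fin v), ∀ e,
          GpKer P (q * D) M (if e ∈ E'' then w else w') := by
        intro E'' e; split_ifs
        · exact hw
        · exact hw'
      have hIntegr : ∀ E'' : Finset (Fin v × Fin v), Integrable (fun z : Fin v → Y =>
          (∏ a, f a (z a)) * ∏ e ∈ E, (if e ∈ E'' then w else w') (z e.1) (z e.2))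
          (Measure.pi fun _ => P) := fun E'' => gp_ker_intg S P hM
            (fun e => if e ∈ E'' then w else w') (hker E'') _ hF hFp
      have hstep := gp_count_edge S P (M := M + M) (by linarith)
        (fun e => if e = e0 then (fun s t => w s t - w' s t) else if e ∈ E' then w else w')
        (by
          intro e
          by_cases h : e = e0
          · simp only [h, if_true]
            exact hw.sub S.one_le_r hM hM hw'
          · simp only [h, if_false]
            exact (hker E' e).mono (by linarith)) f hfm hf e0 he0E η R hR (by simpa using hη)
      have heq : ∫ z, (∏ a, f a (z a)) * ∏ e ∈ E, (if e ∈ insert e0 E' then w else w') (z e.1) (z e.2)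
          ∂(Measure.pi fun _ => P) -
        ∫ z, (∏ a, f a (z a)) * ∏ e ∈ E, (if e ∈ E' then w else w') (z e.1) (z e.2)
          ∂(Measure.pi fun _ => P) = 
        ∫ z, (∏ a, f a (z a)) * ∏ e ∈ E, (if e = e0 then (fun s t => w s t - w' s t)
          else if e ∈ E' then w else w') (z e.1) (z e.2) ∂(Measure.pi fun _ => P) := by
        rw [← integral_sub (hIntegr _) (hIntegr _)]
        congr 1
        ext z
        rw [← Finset.mul_prod_erase E _ he0E, ← Finset.mul_prod_erase E _ he0E,
          ← Finset.mul_prod_erase E _ he0E]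
        have h1 : ∏ e ∈ E.erase e0, (if e ∈ insert e0 E' then w else w') (z e.1) (z e.2) =
            ∏ e ∈ E.erase e0, (if e ∈ E' then w else w') (z e.1) (z e.2) := by
          refine Finset.prod_congr rfl fun e he => ?_
          simp [Finset.mem_insert, Finset.ne_of_mem_erase he]
        have h2 : ∏ e ∈ E.erase e0, (if e = e0 then (fun s t => w s t - w' s t)
            else if e ∈ E' then w else w') (z e.1) (z e.2) =
            ∏ e ∈ E.erase e0, (if e ∈ E' then w else w') (z e.1) (z e.2) := by
          refine Finset.prod_congr rfl fun e he => ?_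
          simp [Finset.ne_of_mem_erase he]
        rw [h1, h2]
        simp [he0]
        ring
      rw [← heq] at hstep
      rw [Finset.card_insert_of_notMem he0]
      push_cast
      have := abs_add_le (∫ z, (∏ a, f a (z a)) * ∏ e ∈ E,
          (if e ∈ insert e0 E' then w else w') (z e.1) (z e.2)
          ∂(Measure.pi fun _ => P) -
        ∫ z, (∏ a, f a (z a)) * ∏ e ∈ E, (if e ∈ E' then w else w') (z e.1) (z e.2)
          ∂(Measure.pi fun _ => P)) (∫ z, (∏ a, f a (z a)) * ∏ e ∈ E,
          (if e ∈ E' then w else w') (z e.1) (z e.2) ∂(Measure.pi fun _ => P) -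
      ∫ z, (∏ a, f a (z a)) * ∏ e ∈ E, w' (z e.1) (z e.2) ∂(Measure.pi fun _ => P))
      rw [sub_add_sub_cancel] at this
      linarith
  have hk := key E subset_rfl
  have h1 : ∀ z : Fin v → Y, ∏ e ∈ E, (if e ∈ E then w else w') (z e.1) (z e.2) =
      ∏ e ∈ E, w (z e.1) (z e.2) := by
    intro z
    refine Finset.prod_congr rfl fun e he => ?_
    rw [if_pos he]
  simp_rw [h1] at hk
  exact hk

/-- Averaging out the second coordinate. -/
lemma gp_transfer {v : ℕ} {α Y : Type*} [MeasurableSpace α] [MeasurableSpace Y]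
    (ν : Measure α) [IsProbabilityMeasure ν] (P : Measure Y) [IsProbabilityMeasure P]
    (pr : α → Y) (hpr : Measurable pr) (hνP : ν.map pr = P)
    (F : Fin v → α → ℝ) (hFm : ∀ a, Measurable (F a)) (hF0 : ∀ a y, 0 ≤ F a y)
    (hF1 : ∀ a y, F a y ≤ 1) :
    ∃ f : Fin v → Y → ℝ, (∀ a, Measurable (f a)) ∧ (∀ a y, |f a y| ≤ 1) ∧
      ∀ H : (Fin v → Y) → ℝ, Measurable H →
        ∫ z, (∏ a, F a (z a)) * H (fun a => pr (z a)) ∂(Measure.pi fun _ : Fin v => ν) =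
        ∫ x, (∏ a, f a (x a)) * H x ∂(Measure.pi fun _ : Fin v => P) := by
  set F' : Fin v → α → ℝ≥0∞ := fun a y => ENNReal.ofReal (F a y) with hF'
  have hF'm : ∀ a, Measurable (F' a) := fun a => (hFm a).ennreal_ofReal
  have hfin : ∀ a, IsFiniteMeasure (ν.withDensity (F' a)) := fun a => by
    refine isFiniteMeasure_withDensity ?_
    refine ne_of_lt (lt_of_le_of_lt (lintegral_mono (g := fun _ => 1) fun z => ?_) (by simp))
    exact ENNReal.ofReal_le_one.2 (hF1 a z)
  set L : Fin v → Measure Y := fun a => (ν.withDensity (F' a)).map pr with hL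
  have hLfin : ∀ a, IsFiniteMeasure (L a) := fun a => by rw [hL]; infer_instance
  have hLle : ∀ a, L a ≤ P := by
    intro a
    rw [← hνP]
    refine Measure.map_mono ?_ hpr
    calc ν.withDensity (F' a) ≤ ν.withDensity 1 := withDensity_mono (ae_of_all _ fun z => by
          exact ENNReal.ofReal_le_one.2 (hF1 a z))
      _ = ν := withDensity_one
  set f' : Fin v → Y → ℝ≥0∞ := fun a y => min ((L a).rnDeriv P y) 1 with hf'
  have hf'm : ∀ a, Measurable (f' a) := fun a =>
    (Measure.measurable_rnDeriv _ _).min measurable_const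
  have hLf : ∀ a, L a = P.withDensity (f' a) := by
    intro a
    conv_lhs => rw [← Measure.withDensity_rnDeriv_eq (L a) P (hLle a).absolutelyContinuous]
    refine withDensity_congr_ae ?_
    filter_upwards [Measure.rnDeriv_le_one_of_le (hLle a)] with y hy
    simp only [hf']
    exact (min_eq_left hy).symm
  have hf'1 : ∀ a y, f' a y ≤ 1 := fun a y => min_le_right _ _
  have hSF : ∀ a, SigmaFinite (P.withDensity (f' a)) := fun a => by
    rw [← hLf a]; infer_instance
  refine ⟨fun a y => (f' a y).toReal, fun a => (hf'm a).ennreal_toReal, fun a y => ?_, ?_⟩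
  · rw [abs_of_nonneg ENNReal.toReal_nonneg]
    exact ENNReal.toReal_le_of_le_ofReal zero_le_one (by simpa using hf'1 a y)
  intro H hH
  have hHm : Measurable (fun z : Fin v → α => H (fun a => pr (z a))) :=
    hH.comp (measurable_pi_lambda _ fun a => hpr.comp (measurable_pi_apply a))
  have h1 : ∫ z, (∏ a, F a (z a)) * H (fun a => pr (z a)) ∂(Measure.pi fun _ : Fin v => ν) =
      ∫ z, H (fun a => pr (z a)) ∂(Measure.pi fun a => ν.withDensity (F' a)) := by
    rw [gp_pi_withDensity (fun _ => ν) F' hF'm, integral_withDensity_eq_integral_toReal_smul]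
    · congr 1
      ext z
      rw [ENNReal.toReal_prod, smul_eq_mul]
      congr 1
      refine Finset.prod_congr rfl fun a _ => ?_
      rw [hF', ENNReal.toReal_ofReal (hF0 a _)]
    · exact Finset.measurable_prod _ fun a _ => (hF'm a).comp (measurable_pi_apply a)
    · exact ae_of_all _ fun z => ENNReal.prod_lt_top fun a _ => ENNReal.ofReal_lt_top
  have h2 : ∫ x, (∏ a, (f' a (x a)).toReal) * H x ∂(Measure.pi fun _ : Fin v => P) =
      ∫ x, H x ∂(Measure.pi fun a => P.withDensity (f' a)) := by
    rw [gp_pi_withDensity (fun _ => P) f' hf'm, integral_withDensity_eq_integral_toReal_smul]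
    · congr 1
      ext z
      rw [ENNReal.toReal_prod, smul_eq_mul]
    · exact Finset.measurable_prod _ fun a _ => (hf'm a).comp (measurable_pi_apply a)
    · exact ae_of_all _ fun z => ENNReal.prod_lt_top fun a _ =>
        (hf'1 a _).trans_lt ENNReal.one_lt_top
  rw [h1, h2]
  have h3 : (Measure.pi fun a => P.withDensity (f' a)) =
      (Measure.pi fun a => ν.withDensity (F' a)).map (fun z a => pr (z a)) := by
    rw [Measure.pi_map_pi (fun a => hpr.aemeasurable)]
    congr 1
    ext1 a
    exact (hLf a).symm
  rw [h3, integral_map]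
  · exact (measurable_pi_lambda _ fun a => hpr.comp (measurable_pi_apply a)).aemeasurable
  · exact hH.aestronglyMeasurable

/-- The functional with a general test function. -/
noncomputable def gpT {v : ℕ} (E : Finset (Fin v × Fin v)) {X : Type*} [MeasurableSpace X]
    (w : ℝ → ℝ → ℝ) (g : (Fin v → ℝ × X) → ℝ) (ν : Measure (ℝ × X)) : ℝ :=
  ∫ z, g z * ∏ e ∈ E, w (z e.1).1 (z e.2).1 ∂(Measure.pi fun _ : Fin v => ν)

/-- Pull back a kernel by the first coordinate. -/
def gpLift {Y X : Type*} (w : Y → Y → ℝ) (s t : Y × X) : ℝ := w s.1 t.1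

lemma gpLift_ker {X Y : Type*} [MeasurableSpace X] [MeasurableSpace Y] {P : Measure Y}
    [IsProbabilityMeasure P] {ν : Measure (Y × X)} [IsProbabilityMeasure ν]
    (hν : ν.map Prod.fst = P) {r M : ℝ} {w : Y → Y → ℝ} (hw : GpKer P r M w) :
    GpKer ν r M (gpLift w) := by
  have hm : Measurable (fun y : (Y × X) × (Y × X) => (y.1.1, y.2.1)) := by fun_prop
  refine ⟨hw.meas.comp hm, ?_⟩
  refine le_trans (le_of_eq ?_) hw.norm
  unfold eLpNorm'
  have : P.prod P = (ν.prod ν).map (Prod.map Prod.fst Prod.fst) := by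
    rw [← Measure.map_prod_map _ _ measurable_fst measurable_fst, hν]
  rw [this, lintegral_map (f := fun y : Y × Y => ‖w y.1 y.2‖ₑ ^ r)
    (hw.meas.enorm.pow_const r) (by fun_prop)]
  rfl

lemma gpT_bound {v : ℕ} {E : Finset (Fin v × Fin v)} {D : ℕ} {p q : ℝ}
    (S : GpSetup v E D p q) {X : Type*} [MeasurableSpace X] {ν : Measure (ℝ × X)}
    (hν : inTM ν) {M : ℝ} (hM : 0 ≤ M) {w : ℝ → ℝ → ℝ} (hw : GpKer unif01 (q * D) M w)
    (g : (Fin v → ℝ × X) → ℝ) (hg : Measurable g) (A : ℝ) (hA : 0 ≤ A)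
    (hgp : (∫⁻ z, ‖g z‖ₑ ^ p ∂(Measure.pi fun _ => ν)) ^ (1 / p) ≤ ENNReal.ofReal A) :
    |gpT E w g ν| ≤ A * M ^ E.card := by
  have := hν.1
  exact gp_int_bound S ν hM (fun _ => gpLift w) (fun _ => gpLift_ker hν.2 hw) g hg A hA hgp

lemma gpT_intg {v : ℕ} {E : Finset (Fin v × Fin v)} {D : ℕ} {p q : ℝ}
    (S : GpSetup v E D p q) {X : Type*} [MeasurableSpace X] {ν : Measure (ℝ × X)}
    (hν : inTM ν) {M : ℝ} (hM : 0 ≤ M) {w : ℝ → ℝ → ℝ} (hw : GpKer unif01 (q * D) M w)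
    (g : (Fin v → ℝ × X) → ℝ) (hg : Measurable g)
    (hgp : ∫⁻ z, ‖g z‖ₑ ^ p ∂(Measure.pi fun _ => ν) < ⊤) :
    Integrable (fun z => g z * ∏ e ∈ E, w (z e.1).1 (z e.2).1) (Measure.pi fun _ => ν) := by
  have := hν.1
  exact gp_ker_intg S ν hM (fun _ => gpLift w) (fun _ => gpLift_ker hν.2 hw) g hg hgp

lemma gp_bdd_pow {Y : Type*} [MeasurableSpace Y] (ν : Measure Y) [IsProbabilityMeasure ν]
    {p : ℝ} (hp : 0 < p) (g : Y → ℝ) (B : ℝ) (hB : ∀ z, |g z| ≤ B) :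
    ∫⁻ z, ‖g z‖ₑ ^ p ∂ν < ⊤ := by
  refine lt_of_le_of_lt (lintegral_mono (g := fun _ => ENNReal.ofReal B ^ p) fun z => ?_) ?_
  · refine ENNReal.rpow_le_rpow ?_ hp.le
    rw [← ofReal_norm, Real.norm_eq_abs]
    exact ENNReal.ofReal_le_ofReal (hB z)
  · simp only [lintegral_const, measure_univ, mul_one]
    exact ENNReal.rpow_lt_top_of_nonneg hp.le ENNReal.ofReal_ne_top

lemma gp_counting {v : ℕ} {E : Finset (Fin v × Fin v)} {D : ℕ} {p q : ℝ}
    (S : GpSetup v E D p q) {X : Type*} [MeasurableSpace X] {M : ℝ} (hM : 0 ≤ M)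
    {κ : Type*} [Fintype κ] [MeasurableSpace κ] [MeasurableSingletonClass κ]
    (c : X → κ) (hc : Measurable c) (h : (Fin v → κ) → ℝ) (ε : ℝ) (hε : 0 < ε) :
    ∃ η > 0, ∀ w w' : ℝ → ℝ → ℝ, GpKer unif01 (q * D) M w → GpKer unif01 (q * D) M w' →
      (∀ S T, MeasurableSet S → MeasurableSet T →
        |∫ s in S, ∫ t in T, (w s t - w' s t) ∂unif01 ∂unif01| ≤ η) →
      ∀ ν : Measure (ℝ × X), inTM ν →
        |gpT E w (fun z => h (fun a => c (z a).2)) ν -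
          gpT E w' (fun z => h (fun a => c (z a).2)) ν| ≤ ε := by
  classical
  have hp := S.hpq.pos
  set H := ∑ k, |h k| with hH
  have hH0 : 0 ≤ H := Finset.sum_nonneg fun _ _ => abs_nonneg _
  -- choose R
  have hlim : Tendsto (fun R : ℝ => (E.card * ((M + M) ^ (q * D) / R)) ^ (1 / p) *
      (M + M) ^ E.card * E.card * H) atTop (nhds 0) := by
    have h1 : Tendsto (fun R : ℝ => E.card * ((M + M) ^ (q * D) / R)) atTop (nhds 0) := by
      have := (tendsto_const_nhds (x := (M + M) ^ (q * D))).div_atTop (tendsto_id (α := ℝ))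
      simpa using this.const_mul (E.card : ℝ)
    have h2 := h1.rpow_const (p := 1 / p) (Or.inr (by positivity))
    rw [Real.zero_rpow (by positivity)] at h2
    simpa using ((h2.mul_const ((M + M) ^ E.card)).mul_const (E.card : ℝ)).mul_const H
  obtain ⟨R, hR1, hR2⟩ := ((hlim.eventually_lt_const (show (0 : ℝ) < ε / 2 by linarith)).and
    (eventually_ge_atTop 1)).exists
  set K := H * (E.card * ((R ^ E.card * R ^ E.card) * 4)) with hK
  have hK0 : 0 ≤ K := by positivity
  refine ⟨ε / 2 / (K + 1), by positivity, ?_⟩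
  intro w w' hw hw' hcut ν hν
  have := hν.1
  set η := ε / 2 / (K + 1) with hη
  have hKη : K * η ≤ ε / 2 := by
    rw [hη, mul_div_assoc', div_le_iff₀ (by positivity)]
    nlinarith
  have hexp : ∀ z : Fin v → ℝ × X, h (fun a => c (z a).2) =
      ∑ k, h k * ∏ a, (if c (z a).2 = k a then (1 : ℝ) else 0) := by
    intro z
    rw [Finset.sum_eq_single (fun a => c (z a).2)]
    · simp
    · intro k _ hk
      have : ∃ a, c (z a).2 ≠ k a := by
        by_contra hcon
        push Not at hcon
        exact hk (funext fun a => (hcon a).symm)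
      obtain ⟨a, ha⟩ := this
      rw [Finset.prod_eq_zero (Finset.mem_univ a), mul_zero]
      rw [if_neg ha]
    · simp
  have hFm : ∀ (k : Fin v → κ) (a : Fin v), Measurable (fun y : ℝ × X =>
      if c y.2 = k a then (1 : ℝ) else 0) := by
    intro k a
    refine Measurable.ite ?_ measurable_const measurable_const
    exact (hc.comp measurable_snd) (measurableSet_singleton (k a))
  have hPm : ∀ k : Fin v → κ, Measurable (fun z : Fin v → ℝ × X =>
      ∏ a, (if c (z a).2 = k a then (1 : ℝ) else 0)) := fun k =>
    Finset.measurable_prod _ fun a _ => (hFm k a).comp (measurable_pi_apply a)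
  have hP1 : ∀ (k : Fin v → κ) (z : Fin v → ℝ × X),
      |∏ a, (if c (z a).2 = k a then (1 : ℝ) else 0)| ≤ 1 := fun k z =>
    gp_abs_prod_le_one _ _ fun a => by split_ifs <;> simp
  have hTexp : ∀ u : ℝ → ℝ → ℝ, GpKer unif01 (q * D) M u →
      gpT E u (fun z => h (fun a => c (z a).2)) ν = ∑ k, h k *
        ∫ z, (∏ a, (if c (z a).2 = k a then (1 : ℝ) else 0)) *
          ∏ e ∈ E, u (z e.1).1 (z e.2).1 ∂(Measure.pi fun _ : Fin v => ν) := by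
    intro u hu
    unfold gpT
    simp_rw [hexp, Finset.sum_mul, mul_assoc]
    rw [integral_finsetSum]
    · simp_rw [integral_const_mul]
    · intro k _
      exact (gpT_intg S hν hM hu _ (hPm k) (gp_bdd_pow _ hp _ 1 (hP1 k))).const_mul _
  rw [hTexp w hw, hTexp w' hw', ← Finset.sum_sub_distrib]
  set C := E.card * ((R ^ E.card * R ^ E.card) * (4 * η) +
      (E.card * ((M + M) ^ (q * D) / R)) ^ (1 / p) * (M + M) ^ E.card) with hC
  have hterm : ∀ k : Fin v → κ, |h k * ∫ z, (∏ a, (if c (z a).2 = k a then (1 : ℝ) else 0)) *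
          ∏ e ∈ E, w (z e.1).1 (z e.2).1 ∂(Measure.pi fun _ : Fin v => ν) -
        h k * ∫ z, (∏ a, (if c (z a).2 = k a then (1 : ℝ) else 0)) *
          ∏ e ∈ E, w' (z e.1).1 (z e.2).1 ∂(Measure.pi fun _ : Fin v => ν)| ≤ |h k| * C := by
    intro k
    rw [← mul_sub, abs_mul]
    refine mul_le_mul_of_nonneg_left ?_ (abs_nonneg _)
    obtain ⟨f, hfm, hf, hfH⟩ := gp_transfer ν unif01 Prod.fst measurable_fst hν.2
      (fun a (y : ℝ × X) => if c y.2 = k a then (1 : ℝ) else 0) (hFm k)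
      (fun a y => by split_ifs <;> simp) (fun a y => by split_ifs <;> simp)
    have e1 := hfH (fun x => ∏ e ∈ E, w (x e.1) (x e.2)) (gp_prodw_meas E _ fun _ => hw.meas)
    have e2 := hfH (fun x => ∏ e ∈ E, w' (x e.1) (x e.2)) (gp_prodw_meas E _ fun _ => hw'.meas)
    dsimp only at e1 e2
    rw [e1, e2]
    exact gp_count_tele S unif01 hM w w' hw hw' f hfm hf η R hR2 hcut
  refine (Finset.abs_sum_le_sum_abs _ _).trans ((Finset.sum_le_sum fun k _ => hterm k).trans ?_)
  rw [← Finset.sum_mul, ← hH]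
  calc H * C = K * η + (E.card * ((M + M) ^ (q * D) / R)) ^ (1 / p) *
      (M + M) ^ E.card * E.card * H := by rw [hC, hK]; ring
    _ ≤ ε / 2 + ε / 2 := add_le_add hKη hR1.le
    _ = ε := by ring

/-- Approximability in `L¹` by functions of finitely many cells. -/
def gpApprox {v : ℕ} {X : Type*} [MeasurableSpace X] (μ : Measure X)
    (f : (Fin v → X) → ℝ) : Prop :=
  ∀ ε : ℝ≥0∞, ε ≠ 0 → ∃ m : ℕ, ∃ c : X → Fin m, Measurable c ∧
    ∃ h : (Fin v → Fin m) → ℝ,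
      ∫⁻ z, ‖f z - h (fun a => c (z a))‖ₑ ∂(Measure.pi fun _ => μ) ≤ ε

lemma gp_cell_meas {v : ℕ} {X : Type*} [MeasurableSpace X] {κ : Type*} [Fintype κ]
    [MeasurableSpace κ] [MeasurableSingletonClass κ]
    {c : X → κ} (hc : Measurable c) (h : (Fin v → κ) → ℝ) :
    Measurable (fun z : Fin v → X => h (fun a => c (z a))) :=
  (measurable_of_countable h).comp
    (measurable_pi_lambda _ fun a => hc.comp (measurable_pi_apply a))

lemma gpApprox_add {v : ℕ} {X : Type*} [MeasurableSpace X] (μ : Measure X)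
    [IsProbabilityMeasure μ] {f g : (Fin v → X) → ℝ}
    (hgm : AEMeasurable g (Measure.pi fun _ => μ))
    (hf : gpApprox μ f) (hg : gpApprox μ g) : gpApprox μ (f + g) := by
  intro ε hε
  obtain ⟨m, c, hc, h, hh⟩ := hf (ε / 2) (by simpa using hε)
  obtain ⟨m', c', hc', h', hh'⟩ := hg (ε / 2) (by simpa using hε)
  refine ⟨m * m', fun x => finProdFinEquiv (c x, c' x),
    (measurable_of_countable (finProdFinEquiv (m := m) (n := m'))).comp (hc.prodMk hc'),
    fun k => h (fun a => (finProdFinEquiv.symm (k a)).1) +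
      h' (fun a => (finProdFinEquiv.symm (k a)).2), ?_⟩
  simp only [Equiv.symm_apply_apply, Pi.add_apply]
  calc _ ≤ ∫⁻ z, (‖f z - h (fun a => c (z a))‖ₑ + ‖g z - h' (fun a => c' (z a))‖ₑ)
        ∂(Measure.pi fun _ => μ) := by
        refine lintegral_mono fun z => ?_
        have : f z + g z - (h (fun a => c (z a)) + h' (fun a => c' (z a))) =
          (f z - h (fun a => c (z a))) + (g z - h' (fun a => c' (z a))) := by ring
        rw [this]
        exact enorm_add_le _ _
    _ ≤ ε / 2 + ε / 2 := by
        rw [lintegral_add_right']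
        · exact add_le_add hh hh'
        · exact (hgm.sub (gp_cell_meas hc' h').aemeasurable).enorm
    _ = ε := ENNReal.add_halves ε

lemma gpApprox_close {v : ℕ} {X : Type*} [MeasurableSpace X] (μ : Measure X)
    [IsProbabilityMeasure μ] {f : (Fin v → X) → ℝ} (hfm : AEMeasurable f (Measure.pi fun _ => μ))
    (hf : ∀ ε : ℝ≥0∞, ε ≠ 0 → ∃ g : (Fin v → X) → ℝ, AEMeasurable g (Measure.pi fun _ => μ) ∧
      gpApprox μ g ∧ ∫⁻ z, ‖f z - g z‖ₑ ∂(Measure.pi fun _ => μ) ≤ ε) : gpApprox μ f := by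
  intro ε hε
  obtain ⟨g, hgm, hg, hfg⟩ := hf (ε / 2) (by simpa using hε)
  obtain ⟨m, c, hc, h, hh⟩ := hg (ε / 2) (by simpa using hε)
  refine ⟨m, c, hc, h, ?_⟩
  calc _ ≤ ∫⁻ z, (‖f z - g z‖ₑ + ‖g z - h (fun a => c (z a))‖ₑ)
        ∂(Measure.pi fun _ => μ) := by
        refine lintegral_mono fun z => ?_
        have : f z - h (fun a => c (z a)) = (f z - g z) + (g z - h (fun a => c (z a))) := by ring
        rw [this]
        exact enorm_add_le _ _
    _ ≤ ε / 2 + ε / 2 := by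
        rw [lintegral_add_left']
        · exact add_le_add hfg hh
        · exact (hfm.sub hgm).enorm
    _ = ε := ENNReal.add_halves ε

lemma gpApprox_const_mul {v : ℕ} {X : Type*} [MeasurableSpace X] (μ : Measure X)
    [IsProbabilityMeasure μ] {f : (Fin v → X) → ℝ} (b : ℝ) (hf : gpApprox μ f) :
    gpApprox μ (fun z => b * f z) := by
  intro ε hε
  by_cases hb : b = 0
  · refine ⟨1, fun _ => 0, measurable_const, fun _ => 0, ?_⟩
    simp [hb]
  have hb' : ‖b‖ₑ ≠ 0 := by simpa using hb
  obtain ⟨m, c, hc, h, hh⟩ := hf (ε / ‖b‖ₑ) (by simp [hε])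
  refine ⟨m, c, hc, fun k => b * h k, ?_⟩
  simp_rw [← mul_sub, enorm_mul]
  rw [lintegral_const_mul' _ _ (by simp)]
  rw [ENNReal.le_div_iff_mul_le (Or.inl hb') (Or.inl (by simp))] at hh
  rwa [mul_comm]

lemma gpApprox_set {v : ℕ} {X : Type*} [MeasurableSpace X] (μ : Measure X)
    [IsProbabilityMeasure μ] (A : Set (Fin v → X)) (hA : MeasurableSet A) :
    gpApprox μ (A.indicator (fun _ => (1 : ℝ))) := by
  classical
  induction A, hA using MeasurableSpace.induction_on_inter
    (generateFrom_pi (α := fun _ : Fin v => X)).symm isPiSystem_pi with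
  | empty =>
    intro ε hε
    refine ⟨1, fun _ => 0, measurable_const, fun _ => 0, ?_⟩
    simp
  | basic t ht =>
    obtain ⟨s, hs, rfl⟩ := ht
    intro ε hε
    have hs' : ∀ a, MeasurableSet (s a) := fun a => hs a (mem_univ a)
    set e := Fintype.equivFin (Fin v → Bool)
    refine ⟨Fintype.card (Fin v → Bool), fun x => e (fun a => decide (x ∈ s a)), ?_,
      fun k => if ∀ a, e.symm (k a) a = true then 1 else 0, ?_⟩
    · refine (measurable_of_countable e).comp (measurable_pi_lambda _ fun a => ?_)
      refine measurable_to_bool ?_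
      have : (fun x => decide (x ∈ s a)) ⁻¹' {true} = s a := by ext x; simp
      rw [this]; exact hs' a
    · simp only [Equiv.symm_apply_apply, decide_eq_true_eq]
      have : ∀ z : Fin v → X, (Set.pi univ s).indicator (fun _ => (1 : ℝ)) z -
          (if ∀ a, z a ∈ s a then (1 : ℝ) else 0) = 0 := by
        intro z
        by_cases hz : ∀ a, z a ∈ s a
        · rw [if_pos hz, indicator_of_mem (by simpa using hz)]; simp
        · rw [if_neg hz, indicator_of_notMem (by simpa using hz)]; simp
      simp [this]
  | compl t ht ih =>
    intro ε hε
    obtain ⟨m, c, hc, h, hh⟩ := ih ε hε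
    refine ⟨m, c, hc, fun k => 1 - h k, le_trans (le_of_eq ?_) hh⟩
    refine lintegral_congr fun z => ?_
    by_cases hz : z ∈ t
    · rw [indicator_of_mem hz, indicator_of_notMem (by simpa using hz)]
      rw [← enorm_neg]; congr 1; ring
    · rw [indicator_of_notMem hz, indicator_of_mem (by simpa using hz)]
      rw [← enorm_neg]; congr 1; ring
  | iUnion f hd hfm ih =>
    have hU : MeasurableSet (⋃ i, f i) := MeasurableSet.iUnion hfm
    refine gpApprox_close μ (measurable_const.indicator hU).aemeasurable ?_
    intro ε hε
    have hpart : ∀ N : ℕ, gpApprox μ (fun z => ∑ i ∈ Finset.range N, (f i).indicator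
        (fun _ => (1 : ℝ)) z) ∧ Measurable (fun z => ∑ i ∈ Finset.range N, (f i).indicator
        (fun _ => (1 : ℝ)) z) := by
      intro N
      refine ⟨?_, Finset.measurable_sum _ fun i _ => measurable_const.indicator (hfm i)⟩
      induction N with
      | zero => 
        intro ε hε
        exact ⟨1, fun _ => 0, measurable_const, fun _ => 0, by simp⟩
      | succ N ihN =>
        simp_rw [Finset.sum_range_succ]
        exact gpApprox_add μ (measurable_const.indicator (hfm N)).aemeasurable ihN (ih N)
    have htail : Tendsto (fun N => (Measure.pi fun _ : Fin v => μ) (⋃ i ≥ N, f i)) atTop (nhds 0) := by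
      exact tendsto_measure_biUnion_Ici_zero_of_pairwise_disjoint
        (fun i => (hfm i).nullMeasurableSet) hd
    obtain ⟨N, hN⟩ := (htail.eventually_lt_const (pos_iff_ne_zero.2 hε)).exists
    refine ⟨_, (hpart N).2.aemeasurable, (hpart N).1, le_trans ?_ hN.le⟩
    have hTm : MeasurableSet (⋃ i ≥ N, f i) :=
      MeasurableSet.iUnion fun i => MeasurableSet.iUnion fun _ => hfm i
    rw [← lintegral_indicator_one hTm]
    refine lintegral_mono fun z => ?_
    by_cases hz : z ∈ ⋃ i, f i
    · obtain ⟨j, hj⟩ := mem_iUnion.1 hz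
      have huniq : ∀ i, i ≠ j → (f i).indicator (fun _ => (1 : ℝ)) z = 0 := by
        intro i hij
        rw [indicator_of_notMem]
        intro hi
        exact (Set.disjoint_left.1 (hd hij)) hi hj
      by_cases hjN : j < N
      · rw [Finset.sum_eq_single j (fun i _ hij => huniq i hij)
          (fun h => absurd (Finset.mem_range.2 hjN) h), indicator_of_mem hj, indicator_of_mem hz]
        simp
      · have : z ∈ ⋃ i ≥ N, f i := by
          simp only [mem_iUnion]
          exact ⟨j, not_lt.1 hjN, hj⟩
        rw [Finset.sum_eq_zero, indicator_of_mem hz, indicator_of_mem this]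
        · simp
        · intro i hi
          refine huniq i ?_
          rintro rfl
          exact hjN (Finset.mem_range.1 hi)
    · rw [indicator_of_notMem hz, Finset.sum_eq_zero]
      · simp
      · intro i _
        rw [indicator_of_notMem]
        intro hi
        exact hz (mem_iUnion.2 ⟨i, hi⟩)

lemma gpApprox_all {v : ℕ} {X : Type*} [MeasurableSpace X] (μ : Measure X)
    [IsProbabilityMeasure μ] (f : (Fin v → X) → ℝ)
    (hf : Integrable f (Measure.pi fun _ => μ)) : gpApprox μ f := by
  refine Integrable.induction (fun f => gpApprox μ f) ?_ ?_ ?_ ?_ hf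
  · intro b s hs _
    have := gpApprox_const_mul μ b (gpApprox_set μ s hs)
    refine (congrArg (gpApprox μ) ?_).mp this
    ext z
    by_cases hz : z ∈ s
    · simp [hz]
    · simp [hz]
  · intro f g _ hf hg h1 h2
    exact gpApprox_add μ hg.1.aemeasurable h1 h2
  · rw [← closure_eq_iff_isClosed]
    refine subset_antisymm ?_ subset_closure
    intro f hf
    refine gpApprox_close μ (Lp.aestronglyMeasurable f).aemeasurable ?_
    intro ε hε
    obtain ⟨g, hg, hfg⟩ := EMetric.mem_closure_iff.1 hf ε (pos_iff_ne_zero.2 hε)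
    refine ⟨g, (Lp.aestronglyMeasurable g).aemeasurable, hg, ?_⟩
    rw [Lp.edist_def, eLpNorm_one_eq_lintegral_enorm] at hfg
    exact hfg.le
  · intro f g hfg hf h ε hε
    obtain ⟨m, c, hc, k, hk⟩ := h ε hε
    refine ⟨m, c, hc, k, le_trans (le_of_eq ?_) hk⟩
    refine lintegral_congr_ae ?_
    filter_upwards [hfg] with z hz
    rw [hz]

lemma gp_approx_bdd {v : ℕ} {X : Type*} [MeasurableSpace X] (μ : Measure X)
    [IsProbabilityMeasure μ] (f : (Fin v → X) → ℝ) (hf : Measurable f) (B : ℝ)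
    (hB : ∀ z, |f z| ≤ B) (ε : ℝ≥0∞) (hε : ε ≠ 0) :
    ∃ m : ℕ, ∃ c : X → Fin m, Measurable c ∧
    ∃ h : (Fin v → Fin m) → ℝ, (∀ k, |h k| ≤ B) ∧
      ∫⁻ z, ‖f z - h (fun a => c (z a))‖ₑ ∂(Measure.pi fun _ => μ) ≤ ε := by
  have hIntegr : Integrable f (Measure.pi fun _ => μ) :=
    Integrable.of_bound hf.aestronglyMeasurable B (ae_of_all _ hB)
  obtain ⟨m, c, hc, h, hh⟩ := gpApprox_all μ f hIntegr ε hε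
  have hB0 : Nonempty (Fin v → X) → 0 ≤ B := fun ⟨z⟩ => (abs_nonneg _).trans (hB z)
  have hne : Nonempty (Fin v → X) := by
    by_contra hcon
    rw [not_nonempty_iff] at hcon
    have h1 := measure_univ (μ := Measure.pi fun _ : Fin v => μ)
    simp [Set.univ_eq_empty_iff.2 hcon] at h1
  have hB0' := hB0 hne
  refine ⟨m, c, hc, fun k => max (-B) (min (h k) B), fun k => ?_, le_trans ?_ hh⟩
  · rw [abs_le]
    exact ⟨le_max_left _ _, max_le (by linarith) (min_le_right _ _)⟩
  · refine lintegral_mono fun z => ?_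
    rw [← ofReal_norm, ← ofReal_norm, Real.norm_eq_abs, Real.norm_eq_abs]
    refine ENNReal.ofReal_le_ofReal ?_
    have hz := abs_le.1 (hB z)
    change |f z - max (-B) (min (h (fun a => c (z a))) B)| ≤ _
    set y := h (fun a => c (z a))
    rcases le_total y B with h1 | h1
    · rw [min_eq_left h1]
      rcases le_total (-B) y with h2 | h2
      · rw [max_eq_right h2]
      · rw [max_eq_left h2, abs_of_nonneg (by linarith), abs_of_nonneg (by linarith)]
        linarith
    · rw [min_eq_right h1, max_eq_right (by linarith), abs_of_nonpos (by linarith),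
        abs_of_nonpos (by linarith)]
      linarith

/-- Cut-off of `φ`. -/
noncomputable def gpCut {v : ℕ} {α : Type*} (ψ : α → ℝ) (K : ℝ) (φ : (Fin v → α) → ℝ)
    (z : Fin v → α) : ℝ :=
  open Classical in if ∀ a, ψ (z a) ≤ K then φ z else 0

/-- The exponentially integrable majorant. -/
noncomputable def gpPsi {α : Type*} (ψ : α → ℝ) (p δ K : ℝ) (x : α) : ℝ :=
  open Classical in δ ^ (-p) * (if K < ψ x then ψ x ^ p else 0) + ψ x ^ p + 1

lemma gpPsi_meas {α : Type*} [MeasurableSpace α] {ψ : α → ℝ} (hψ : Measurable ψ) (p δ K : ℝ) :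
    Measurable (gpPsi ψ p δ K) := by
  unfold gpPsi
  refine Measurable.add_const (Measurable.add (Measurable.const_mul ?_ _) (hψ.pow_const p)) 1
  exact Measurable.ite (measurableSet_lt measurable_const hψ) (hψ.pow_const p) measurable_const

lemma gpCut_meas {v : ℕ} {α : Type*} [MeasurableSpace α] {ψ : α → ℝ} (hψ : Measurable ψ) (K : ℝ)
    {φ : (Fin v → α) → ℝ} (hφ : Measurable φ) : Measurable (gpCut ψ K φ) := by
  unfold gpCut
  refine Measurable.ite ?_ hφ measurable_const
  have : {z : Fin v → α | ∀ a, ψ (z a) ≤ K} = ⋂ a, {z | ψ (z a) ≤ K} := by ext z; simp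
  rw [this]
  exact MeasurableSet.iInter fun a =>
    measurableSet_le (hψ.comp (measurable_pi_apply a)) measurable_const

lemma gpCut_abs {v : ℕ} {α : Type*} {ψ : α → ℝ} (hψ0 : ∀ x, 0 ≤ ψ x) {K : ℝ} (hK : 0 ≤ K)
    {φ : (Fin v → α) → ℝ} (hdom : ∀ z, |φ z| ≤ ∏ a, ψ (z a)) (z : Fin v → α) :
    |gpCut ψ K φ z| ≤ K ^ v := by
  unfold gpCut
  split_ifs with h
  · refine (hdom z).trans ?_
    calc ∏ a, ψ (z a) ≤ ∏ _a : Fin v, K :=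
          Finset.prod_le_prod (fun a _ => hψ0 _) fun a _ => h a
      _ = K ^ v := by simp
  · simp; positivity

lemma gp_lp_tail {v : ℕ} (hv : 1 ≤ v) {α : Type*} [MeasurableSpace α] (μ : Measure α)
    [IsProbabilityMeasure μ] (ψ : α → ℝ) (hψ : Measurable ψ) (hψ0 : ∀ x, 0 ≤ ψ x)
    (p : ℝ) (hp : (v : ℝ) ≤ p) (δ K : ℝ) (hδ : 0 < δ)
    (φ : (Fin v → α) → ℝ) (hdom : ∀ z, |φ z| ≤ ∏ a, ψ (z a)) :
    eLpNorm' (fun z => φ z - gpCut ψ K φ z) p (Measure.pi fun _ => μ) ≤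
      ENNReal.ofReal (v * δ) * ∫⁻ x, ENNReal.ofReal (gpPsi ψ p δ K x) ∂μ := by
  classical
  have hv1 : (1 : ℝ) ≤ v := by exact_mod_cast hv
  have hp0 : 0 < p := by linarith
  set T := ∫⁻ x, ENNReal.ofReal (gpPsi ψ p δ K x) ∂μ with hT
  have hψp : ∀ x, 0 ≤ ψ x ^ p := fun x => Real.rpow_nonneg (hψ0 x) p
  have hδp : 0 < δ ^ (-p) := Real.rpow_pos_of_pos hδ _
  have hif : ∀ x, 0 ≤ (if K < ψ x then ψ x ^ p else 0) := fun x => by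
    split_ifs
    · exact hψp x
    · exact le_rfl
  have hT1 : 1 ≤ T := by
    rw [hT]
    calc (1 : ℝ≥0∞) = ∫⁻ _x, 1 ∂μ := by simp
      _ ≤ _ := lintegral_mono fun x => by
        rw [← ENNReal.ofReal_one]
        refine ENNReal.ofReal_le_ofReal ?_
        unfold gpPsi
        have := mul_nonneg hδp.le (hif x)
        have := hψp x
        linarith
  set m := ∫⁻ x, ENNReal.ofReal (ψ x ^ p) ∂μ with hm
  set mK := ∫⁻ x, ENNReal.ofReal (if K < ψ x then ψ x ^ p else 0) ∂μ with hmK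
  have hmT : m ≤ T := by
    refine lintegral_mono fun x => ENNReal.ofReal_le_ofReal ?_
    unfold gpPsi
    have := mul_nonneg hδp.le (hif x)
    linarith
  have hmKT : mK ≤ ENNReal.ofReal (δ ^ p) * T := by
    rw [hT, ← lintegral_const_mul _ (gpPsi_meas hψ p δ K).ennreal_ofReal]
    refine lintegral_mono fun x => ?_
    rw [← ENNReal.ofReal_mul (Real.rpow_nonneg hδ.le _)]
    refine ENNReal.ofReal_le_ofReal ?_
    unfold gpPsi
    have h1 : δ ^ p * δ ^ (-p) = 1 := by rw [← Real.rpow_add hδ]; simp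
    have h2 := hψp x
    have h3 : 0 < δ ^ p := Real.rpow_pos_of_pos hδ p
    rw [mul_add, mul_add, ← mul_assoc, h1]
    nlinarith [mul_nonneg h3.le h2]
  have hpt : ∀ z : Fin v → α, ‖φ z - gpCut ψ K φ z‖ₑ ^ p ≤
      ∑ a, ∏ b, ENNReal.ofReal (if b = a then (if K < ψ (z b) then ψ (z b) ^ p else 0)
        else ψ (z b) ^ p) := by
    intro z
    unfold gpCut
    split_ifs with h
    · simp [hp0]
    · push Not at h
      obtain ⟨a, ha⟩ := h
      refine le_trans ?_ (Finset.single_le_sum (fun _ _ => zero_le) (Finset.mem_univ a))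
      rw [sub_zero, ← ofReal_norm, Real.norm_eq_abs,
        ENNReal.ofReal_rpow_of_nonneg (abs_nonneg _) hp0.le, ← ENNReal.ofReal_prod_of_nonneg]
      · refine ENNReal.ofReal_le_ofReal ?_
        refine (Real.rpow_le_rpow (abs_nonneg _) (hdom z) hp0.le).trans (le_of_eq ?_)
        rw [← Real.finsetProd_rpow _ _ (fun b _ => hψ0 _)]
        refine Finset.prod_congr rfl fun b _ => ?_
        split_ifs with h1 h2
        · rfl
        · rw [h1] at h2; exact absurd ha h2
        · rfl
      · intro b _
        split_ifs
        · exact hψp _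
        · exact le_rfl
        · exact hψp _
  have hIntegr : ∫⁻ z, ‖φ z - gpCut ψ K φ z‖ₑ ^ p ∂(Measure.pi fun _ => μ) ≤
      v * (ENNReal.ofReal (δ ^ p) * T ^ v) := by
    refine (lintegral_mono hpt).trans ?_
    have hmeas : ∀ a b : Fin v, Measurable (fun x => ENNReal.ofReal
        (if b = a then (if K < ψ x then ψ x ^ p else 0) else ψ x ^ p)) := by
      intro a b
      refine Measurable.ennreal_ofReal ?_
      split_ifs
      · exact Measurable.ite (measurableSet_lt measurable_const hψ) (hψ.pow_const p) measurable_const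
      · exact hψ.pow_const p
    rw [lintegral_finsetSum']
    swap
    · intro a _
      exact (Finset.measurable_prod _ fun b _ =>
        (hmeas a b).comp (measurable_pi_apply b)).aemeasurable
    have hterm : ∀ a : Fin v, ∫⁻ z, ∏ b, ENNReal.ofReal
        (if b = a then (if K < ψ (z b) then ψ (z b) ^ p else 0) else ψ (z b) ^ p)
          ∂(Measure.pi fun _ : Fin v => μ) ≤ ENNReal.ofReal (δ ^ p) * T ^ v := by
      intro a
      rw [gp_lintegral_pi_prod (fun _ => μ) (fun b x => ENNReal.ofReal
        (if b = a then (if K < ψ x then ψ x ^ p else 0) else ψ x ^ p)) (hmeas a)]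
      rw [← Finset.mul_prod_erase _ _ (Finset.mem_univ a)]
      simp only [if_true]
      have h1 : ∏ b ∈ Finset.univ.erase a, ∫⁻ x, ENNReal.ofReal
        (if b = a then (if K < ψ x then ψ x ^ p else 0) else ψ x ^ p) ∂μ ≤ T ^ (v - 1) := by
        calc _ ≤ T ^ (Finset.univ.erase a).card := by
              refine Finset.prod_le_pow_card _ _ _ fun b hb => ?_
              simp only [Finset.ne_of_mem_erase hb, if_false]
              exact hmT
          _ = T ^ (v - 1) := by simp [Finset.card_erase_of_mem]
      calc _ ≤ (ENNReal.ofReal (δ ^ p) * T) * T ^ (v - 1) := mul_le_mul' hmKT h1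
        _ = _ := by
          rw [mul_assoc, ← pow_succ', Nat.sub_add_cancel hv]
    refine (Finset.sum_le_sum fun a _ => hterm a).trans ?_
    simp
  unfold eLpNorm'
  refine (ENNReal.rpow_le_rpow hIntegr (by positivity)).trans ?_
  rw [ENNReal.mul_rpow_of_nonneg _ _ (by positivity), ENNReal.mul_rpow_of_nonneg _ _ (by positivity),
    ENNReal.ofReal_mul (by positivity), mul_assoc]
  refine mul_le_mul' ?_ (mul_le_mul' ?_ ?_)
  · rw [ENNReal.ofReal_natCast]
    calc (v : ℝ≥0∞) ^ (1 / p) ≤ (v : ℝ≥0∞) ^ (1 : ℝ) := by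
          refine ENNReal.rpow_le_rpow_of_exponent_le (by exact_mod_cast hv) ?_
          rw [div_le_one hp0]; linarith
      _ = v := ENNReal.rpow_one _
  · rw [← ENNReal.ofReal_rpow_of_pos hδ, ← ENNReal.rpow_mul, mul_one_div_cancel hp0.ne',
      ENNReal.rpow_one]
  · rw [← ENNReal.rpow_natCast, ← ENNReal.rpow_mul]
    calc T ^ ((v : ℝ) * (1 / p)) ≤ T ^ (1 : ℝ) := by
          refine ENNReal.rpow_le_rpow_of_exponent_le hT1 ?_
          rw [mul_one_div, div_le_one hp0]; exact hp
      _ = T := ENNReal.rpow_one _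

lemma gp_rpow_young {p δ : ℝ} (hp : 1 ≤ p) (hδ : 0 < δ) (y : ℝ≥0∞) :
    y ^ (1 / p) ≤ ENNReal.ofReal δ + ENNReal.ofReal (δ ^ (1 - p)) * y := by
  have hp0 : 0 < p := by linarith
  rcases le_total y (ENNReal.ofReal (δ ^ p)) with h | h
  · refine le_trans ?_ le_self_add
    refine (ENNReal.rpow_le_rpow h (by positivity)).trans (le_of_eq ?_)
    rw [← ENNReal.ofReal_rpow_of_pos hδ, ← ENNReal.rpow_mul, mul_one_div_cancel hp0.ne',
      ENNReal.rpow_one]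
  · refine le_trans ?_ le_add_self
    by_cases hy : y = ⊤
    · rw [hy, ENNReal.mul_top]
      · exact le_top
      · simp; exact Real.rpow_pos_of_pos hδ _
    lift y to ℝ≥0 using hy
    have hy' : δ ^ p ≤ (y : ℝ) := by
      rw [← ENNReal.ofReal_coe_nnreal] at h
      exact (ENNReal.ofReal_le_ofReal_iff y.2).1 h
    have hy0 : (0 : ℝ) < y := (Real.rpow_pos_of_pos hδ p).trans_le hy'
    rw [← ENNReal.ofReal_coe_nnreal, ENNReal.ofReal_rpow_of_pos hy0,
      ← ENNReal.ofReal_mul (Real.rpow_nonneg hδ.le _)]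
    refine ENNReal.ofReal_le_ofReal ?_
    have h1 : δ ≤ (y : ℝ) ^ (1 / p) := by
      have := Real.rpow_le_rpow (Real.rpow_nonneg hδ.le p) hy' (show 0 ≤ 1 / p by positivity)
      rwa [← Real.rpow_mul hδ.le, mul_one_div_cancel hp0.ne', Real.rpow_one] at this
    set u := (y : ℝ) ^ (1 / p) with hu
    have hu0 : 0 < u := Real.rpow_pos_of_pos hy0 _
    have hyu : (y : ℝ) = u ^ p := by
      rw [hu, ← Real.rpow_mul hy0.le, one_div_mul_cancel hp0.ne', Real.rpow_one]
    rw [hyu]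
    have h2 : u ^ (1 - p) ≤ δ ^ (1 - p) := Real.rpow_le_rpow_of_nonpos hδ h1 (by linarith)
    calc u = u ^ (1 - p) * u ^ p := by rw [← Real.rpow_add hu0]; simp
      _ ≤ δ ^ (1 - p) * u ^ p := by gcongr

lemma gp_lp_bdd {α : Type*} [MeasurableSpace α] (μ : Measure α) 
    {p δ B : ℝ} (hp : 1 ≤ p) (hδ : 0 < δ) (hB : 0 ≤ B) (g : α → ℝ) (hg : Measurable g)
    (hgB : ∀ z, |g z| ≤ B) :
    eLpNorm' g p μ ≤ ENNReal.ofReal δ +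
      ENNReal.ofReal (δ ^ (1 - p) * B ^ (p - 1)) * ∫⁻ z, ‖g z‖ₑ ∂μ := by
  have hp0 : 0 < p := by linarith
  unfold eLpNorm'
  have h1 : ∫⁻ z, ‖g z‖ₑ ^ p ∂μ ≤ ENNReal.ofReal (B ^ (p - 1)) * ∫⁻ z, ‖g z‖ₑ ∂μ := by
    rw [← lintegral_const_mul _ hg.enorm]
    refine lintegral_mono fun z => ?_
    rw [← ofReal_norm, Real.norm_eq_abs, ENNReal.ofReal_rpow_of_nonneg (abs_nonneg _) hp0.le,
      ← ENNReal.ofReal_mul (Real.rpow_nonneg hB _)]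
    refine ENNReal.ofReal_le_ofReal ?_
    rcases (abs_nonneg (g z)).eq_or_lt with h0 | h0
    · rw [← h0]; simp [hp0.ne']
    · calc |g z| ^ p = |g z| ^ (p - 1) * |g z| := by
            nth_rewrite 3 [← Real.rpow_one |g z|]
            rw [← Real.rpow_add h0]; simp
        _ ≤ B ^ (p - 1) * |g z| := by
            gcongr
            exact hgB z
  refine (gp_rpow_young hp hδ _).trans ?_
  rw [ENNReal.ofReal_mul (Real.rpow_nonneg hδ.le _), mul_assoc]
  gcongr

lemma gp_lp_split {v : ℕ} (hv : 1 ≤ v) {α : Type*} [MeasurableSpace α] (μ : Measure α)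
    [IsProbabilityMeasure μ] (ψ : α → ℝ) (hψ : Measurable ψ) (hψ0 : ∀ x, 0 ≤ ψ x)
    (p : ℝ) (hp : (v : ℝ) ≤ p) (δ K B : ℝ) (hδ : 0 < δ) (hB : 0 ≤ B)
    (φ φ' : (Fin v → α) → ℝ) (hφ : Measurable φ) (hφ' : Measurable φ')
    (hdom : ∀ z, |φ z| ≤ ∏ a, ψ (z a)) (hφ'B : ∀ z, |gpCut ψ K φ z - φ' z| ≤ B)
    (J : Set (Fin v → α)) (hJ : MeasurableSet J) :
    eLpNorm' (J.indicator (fun z => φ z - φ' z)) p (Measure.pi fun _ => μ) ≤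
      ENNReal.ofReal (v * δ) * ∫⁻ x, ENNReal.ofReal (gpPsi ψ p δ K x) ∂μ +
      (ENNReal.ofReal δ + ENNReal.ofReal (δ ^ (1 - p) * B ^ (p - 1)) *
        ∫⁻ z, ‖J.indicator (fun z => gpCut ψ K φ z - φ' z) z‖ₑ ∂(Measure.pi fun _ => μ)) := by
  have hv1 : (1 : ℝ) ≤ v := by exact_mod_cast hv
  have hp1 : 1 ≤ p := by linarith
  have hcm := gpCut_meas hψ K hφ
  have hsum : J.indicator (fun z => φ z - φ' z) =
      J.indicator (fun z => φ z - gpCut ψ K φ z) + J.indicator (fun z => gpCut ψ K φ z - φ' z) := by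
    ext z; by_cases hz : z ∈ J <;> simp [hz]
  rw [hsum]
  have hm2 : Measurable (J.indicator (fun z => gpCut ψ K φ z - φ' z)) := (hcm.sub hφ').indicator hJ
  refine (eLpNorm'_add_le ((hφ.sub hcm).indicator hJ).aestronglyMeasurable
    hm2.aestronglyMeasurable hp1).trans ?_
  refine add_le_add ?_ ?_
  · refine le_trans ?_ (gp_lp_tail hv μ ψ hψ hψ0 p hp δ K hδ φ hdom)
    refine ENNReal.rpow_le_rpow (lintegral_mono fun z => ?_) (by positivity)
    refine ENNReal.rpow_le_rpow ?_ (by linarith)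
    exact enorm_indicator_le_enorm_self _ _
  · refine gp_lp_bdd _ hp1 hδ hB _ hm2 fun z => ?_
    by_cases hz : z ∈ J
    · rw [indicator_of_mem hz]; exact hφ'B z
    · rw [indicator_of_notMem hz]; simpa using hB

/-- Norm bound of the full test function. -/
lemma gp_lp_full {v : ℕ} {α : Type*} [MeasurableSpace α] (μ : Measure α)
    [IsProbabilityMeasure μ] (ψ : α → ℝ) (hψ : Measurable ψ) (hψ0 : ∀ x, 0 ≤ ψ x)
    (p : ℝ) (hp : (v : ℝ) ≤ p) (hp0 : 0 < p)
    (φ : (Fin v → α) → ℝ) (hdom : ∀ z, |φ z| ≤ ∏ a, ψ (z a)) :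
    eLpNorm' φ p (Measure.pi fun _ => μ) ≤ ∫⁻ x, ENNReal.ofReal (ψ x ^ p + 1) ∂μ := by
  set T := ∫⁻ x, ENNReal.ofReal (ψ x ^ p + 1) ∂μ with hT
  have hψp : ∀ x, 0 ≤ ψ x ^ p := fun x => Real.rpow_nonneg (hψ0 x) p
  have hT1 : 1 ≤ T := by
    rw [hT]
    calc (1 : ℝ≥0∞) = ∫⁻ _x, 1 ∂μ := by simp
      _ ≤ _ := lintegral_mono fun x => by
        rw [← ENNReal.ofReal_one]
        refine ENNReal.ofReal_le_ofReal ?_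
        linarith [hψp x]
  have hpt : ∀ z : Fin v → α, ‖φ z‖ₑ ^ p ≤ ∏ b, ENNReal.ofReal (ψ (z b) ^ p + 1) := by
    intro z
    rw [← ofReal_norm, Real.norm_eq_abs,
        ENNReal.ofReal_rpow_of_nonneg (abs_nonneg _) hp0.le, ← ENNReal.ofReal_prod_of_nonneg]
    · refine ENNReal.ofReal_le_ofReal ?_
      refine (Real.rpow_le_rpow (abs_nonneg _) (hdom z) hp0.le).trans ?_
      rw [← Real.finsetProd_rpow _ _ (fun b _ => hψ0 _)]
      exact Finset.prod_le_prod (fun b _ => hψp _) fun b _ => by linarith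
    · intro b _; linarith [hψp (z b)]
  unfold eLpNorm'
  have : ∫⁻ z, ‖φ z‖ₑ ^ p ∂(Measure.pi fun _ => μ) ≤ T ^ v := by
    refine (lintegral_mono hpt).trans ?_
    rw [gp_lintegral_pi_prod (fun _ => μ) (fun _ x => ENNReal.ofReal (ψ x ^ p + 1))
      (fun _ => ((hψ.pow_const p).add_const 1).ennreal_ofReal)]
    simp [hT]
  refine (ENNReal.rpow_le_rpow this (by positivity)).trans ?_
  rw [← ENNReal.rpow_natCast, ← ENNReal.rpow_mul]
  calc T ^ ((v : ℝ) * (1 / p)) ≤ T ^ (1 : ℝ) := by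
        refine ENNReal.rpow_le_rpow_of_exponent_le hT1 ?_
        rw [mul_one_div, div_le_one hp0]; exact hp
    _ = T := ENNReal.rpow_one _

lemma gp_kl_level {α : Type*} [MeasurableSpace α] (ν ρ : Measure α)
    [IsProbabilityMeasure ν] [IsProbabilityMeasure ρ] (hac : ν ≪ ρ) (R : ℝ) (hR : 1 < R) :
    ENNReal.ofReal (Real.log R) * ν {x | ENNReal.ofReal R < ν.rnDeriv ρ x} ≤
      InformationTheory.klDiv ν ρ + 1 := by
  set A := {x | ENNReal.ofReal R < ν.rnDeriv ρ x} with hA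
  have hAm : MeasurableSet A := measurableSet_lt measurable_const (Measure.measurable_rnDeriv ν ρ)
  have h1 := gp_young ν ρ (A.indicator fun _ => Real.log R) (measurable_const.indicator hAm)
  have e1 : ∫⁻ x, ENNReal.ofReal (A.indicator (fun _ => Real.log R) x) ∂ν =
      ENNReal.ofReal (Real.log R) * ν A := by
    rw [← lintegral_indicator_const hAm]
    refine lintegral_congr fun x => ?_
    by_cases hx : x ∈ A <;> simp [hx]
  have e2 : ∫⁻ x, ENNReal.ofReal (Real.exp (A.indicator (fun _ => Real.log R) x) - 1) ∂ρ =
      ENNReal.ofReal (R - 1) * ρ A := by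
    rw [← lintegral_indicator_const hAm]
    refine lintegral_congr fun x => ?_
    by_cases hx : x ∈ A <;> simp [hx, Real.exp_log (show 0 < R by linarith)]
  rw [e1, e2] at h1
  refine h1.trans (add_le_add le_rfl ?_)
  calc ENNReal.ofReal (R - 1) * ρ A ≤ ENNReal.ofReal R * ρ A := by
        gcongr; linarith
    _ = ∫⁻ x in A, ENNReal.ofReal R ∂ρ := by simp
    _ ≤ ∫⁻ x in A, ν.rnDeriv ρ x ∂ρ := setLIntegral_mono' hAm fun x hx => le_of_lt hx
    _ = ν A := Measure.setLIntegral_rnDeriv hac A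
    _ ≤ 1 := prob_le_one

lemma gp_kl_pi {v : ℕ} {α : Type*} [MeasurableSpace α] (ν ρ : Measure α)
    [IsProbabilityMeasure ν] [IsProbabilityMeasure ρ] (R : ℝ) (hR : 1 < R)
    (G : (Fin v → α) → ℝ≥0∞) (hG : Measurable G) (B : ℝ≥0∞) (hB : ∀ z, G z ≤ B) :
    ∫⁻ z, G z ∂(Measure.pi fun _ => ν) ≤
      ENNReal.ofReal R ^ v * ∫⁻ z, G z ∂(Measure.pi fun _ => ρ) +
      B * (v * (ENNReal.ofReal (Real.log R)⁻¹ * (InformationTheory.klDiv ν ρ + 1))) := by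
  by_cases hac : ν ≪ ρ
  swap
  · rw [InformationTheory.klDiv_of_not_ac hac]
    have hl : ENNReal.ofReal (Real.log R)⁻¹ ≠ 0 := by
      simp; exact Real.log_pos hR
    rcases Nat.eq_zero_or_pos v with h0 | h0
    · subst h0
      simp
      rw [Measure.pi_of_empty, Measure.pi_of_empty]
    · by_cases hB0 : B = 0
      · refine le_trans (le_of_eq ?_) zero_le
        rw [lintegral_eq_zero_iff hG]
        exact ae_of_all _ fun z => le_antisymm ((hB z).trans hB0.le) zero_le
      · rw [top_add, ENNReal.mul_top hl, ENNReal.mul_top (by exact_mod_cast h0.ne'),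
          ENNReal.mul_top hB0]
        simp
  set f := ν.rnDeriv ρ with hf
  have hfm : Measurable f := Measure.measurable_rnDeriv ν ρ
  have hdens : ρ.withDensity f = ν := Measure.withDensity_rnDeriv_eq _ _ hac
  set A := {x | ENNReal.ofReal R < f x} with hA
  have hAm : MeasurableSet A := measurableSet_lt measurable_const hfm
  have hlev : ν A ≤ ENNReal.ofReal (Real.log R)⁻¹ * (InformationTheory.klDiv ν ρ + 1) := by
    have := gp_kl_level ν ρ hac R hR
    have hl := Real.log_pos hR
    calc ν A = ENNReal.ofReal (Real.log R)⁻¹ * (ENNReal.ofReal (Real.log R) * ν A) := by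
          rw [← mul_assoc, ← ENNReal.ofReal_mul (by positivity), inv_mul_cancel₀ hl.ne']; simp
      _ ≤ _ := by gcongr
  set C := {z : Fin v → α | ∀ a, f (z a) ≤ ENNReal.ofReal R} with hC
  have hCm : MeasurableSet C := by
    have : C = ⋂ a, {z | f (z a) ≤ ENNReal.ofReal R} := by ext z; simp [hC]
    rw [this]
    exact MeasurableSet.iInter fun a =>
      measurableSet_le (hfm.comp (measurable_pi_apply a)) measurable_const
  have hCc : (Measure.pi fun _ : Fin v => ν) Cᶜ ≤ v * ν A := by
    have : Cᶜ ⊆ ⋃ a, (Function.eval a) ⁻¹' A := by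
      intro z hz
      simp only [hC, mem_compl_iff, mem_ofPred_eq, not_forall, not_le] at hz
      obtain ⟨a, ha⟩ := hz
      exact mem_iUnion.2 ⟨a, ha⟩
    refine (measure_mono this).trans ((measure_iUnion_le _).trans ?_)
    rw [tsum_fintype]
    refine (Finset.sum_le_sum (g := fun _ => ν A) fun a _ => ?_).trans (by simp)
    rw [(measurePreserving_eval (fun _ : Fin v => ν) a).measure_preimage hAm.nullMeasurableSet]
  rw [← lintegral_add_compl G hCm]
  refine add_le_add ?_ ?_
  · haveI : SigmaFinite (ρ.withDensity f) := by rw [hdens]; infer_instance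
    have hpi : Measure.pi (fun _ : Fin v => ν) =
        (Measure.pi fun _ : Fin v => ρ).withDensity (fun z => ∏ i, f (z i)) := by
      rw [← gp_pi_withDensity (fun _ => ρ) (fun _ => f) (fun _ => hfm)]
      simp only [hdens]
    have hpm : Measurable (fun z : Fin v → α => ∏ i, f (z i)) :=
      Finset.measurable_prod _ fun b _ => hfm.comp (measurable_pi_apply b)
    rw [hpi, restrict_withDensity hCm, lintegral_withDensity_eq_lintegral_mul _ hpm hG]
    calc _ ≤ ∫⁻ z in C, ENNReal.ofReal R ^ v * G z ∂(Measure.pi fun _ => ρ) := by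
          refine setLIntegral_mono' hCm fun z hz => ?_
          simp only [Pi.mul_apply]
          gcongr
          calc ∏ i, f (z i) ≤ ENNReal.ofReal R ^ (Finset.univ : Finset (Fin v)).card :=
                Finset.prod_le_pow_card _ _ _ fun b _ => hz b
            _ = _ := by simp
      _ ≤ ∫⁻ z, ENNReal.ofReal R ^ v * G z ∂(Measure.pi fun _ => ρ) := setLIntegral_le_lintegral _ _
      _ = _ := lintegral_const_mul _ hG
  · calc ∫⁻ z in Cᶜ, G z ∂(Measure.pi fun _ => ν) ≤ ∫⁻ z in Cᶜ, B ∂(Measure.pi fun _ => ν) :=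
          lintegral_mono fun z => hB z
      _ = B * (Measure.pi fun _ => ν) Cᶜ := by simp
      _ ≤ _ := by
        gcongr
        exact hCc.trans (by gcongr)

/-- Data of the core problem. -/
structure GpData {X : Type*} [MeasurableSpace X] (μ : Measure X) {v : ℕ}
    (E : Finset (Fin v × Fin v)) (D : ℕ) (p q : ℝ) (φ : (Fin v → X) → ℝ) (ψ : X → ℝ) : Prop where
  S : GpSetup v E D p q
  hv : 1 ≤ v
  hvp : (v : ℝ) ≤ p
  hφ : Measurable φ
  hψ : Measurable ψ
  hψ0 : ∀ x, 0 ≤ ψ x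
  hdom : ∀ z, |φ z| ≤ ∏ a, ψ (z a)
  tail : ∀ lam : ℝ, ∫⁻ x, ENNReal.ofReal (Real.exp (lam * ψ x ^ p)) ∂μ < ⊤

/-- Exponential moment of the majorant. -/
noncomputable def gpA {X : Type*} [MeasurableSpace X] (μ : Measure X) (ψ : X → ℝ) (p L : ℝ) : ℝ :=
  (∫⁻ x, ENNReal.ofReal (Real.exp (L * (ψ x ^ p + 1))) ∂μ).toReal

lemma gpA_eq {X : Type*} [MeasurableSpace X] {μ : Measure X} {v : ℕ}
    {E : Finset (Fin v × Fin v)} {D : ℕ} {p q : ℝ} {φ : (Fin v → X) → ℝ} {ψ : X → ℝ}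
    (d : GpData μ E D p q φ ψ) (L : ℝ) :
    ∫⁻ x, ENNReal.ofReal (Real.exp (L * (ψ x ^ p + 1))) ∂μ = ENNReal.ofReal (gpA μ ψ p L) := by
  unfold gpA
  rw [ENNReal.ofReal_toReal]
  have : ∀ x, ENNReal.ofReal (Real.exp (L * (ψ x ^ p + 1))) =
      ENNReal.ofReal (Real.exp L) * ENNReal.ofReal (Real.exp (L * ψ x ^ p)) := by
    intro x
    rw [← ENNReal.ofReal_mul (Real.exp_pos _).le, ← Real.exp_add]
    ring_nf
  simp_rw [this]
  rw [lintegral_const_mul _ (by have := d.hψ; fun_prop)]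
  exact (ENNReal.mul_lt_top ENNReal.ofReal_lt_top (d.tail L)).ne

lemma gpA_one_le {X : Type*} [MeasurableSpace X] {μ : Measure X} [IsProbabilityMeasure μ] {v : ℕ}
    {E : Finset (Fin v × Fin v)} {D : ℕ} {p q : ℝ} {φ : (Fin v → X) → ℝ} {ψ : X → ℝ}
    (d : GpData μ E D p q φ ψ) {L : ℝ} (hL : 0 ≤ L) : 1 ≤ gpA μ ψ p L := by
  have h := gpA_eq d L
  have : ENNReal.ofReal 1 ≤ ENNReal.ofReal (gpA μ ψ p L) := by
    rw [← h]
    calc ENNReal.ofReal 1 = ∫⁻ _x, ENNReal.ofReal 1 ∂μ := by simp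
      _ ≤ _ := lintegral_mono fun x => by
        refine ENNReal.ofReal_le_ofReal (Real.one_le_exp ?_)
        have := Real.rpow_nonneg (d.hψ0 x) p
        positivity
  exact (ENNReal.ofReal_le_ofReal_iff ENNReal.toReal_nonneg).1 this

lemma gp_tail_K {X : Type*} [MeasurableSpace X] {μ : Measure X} [IsProbabilityMeasure μ] {v : ℕ}
    {E : Finset (Fin v × Fin v)} {D : ℕ} {p q : ℝ} {φ : (Fin v → X) → ℝ} {ψ : X → ℝ}
    (d : GpData μ E D p q φ ψ) (δ : ℝ) :
    ∃ K : ℝ, 0 ≤ K ∧ ∫⁻ x, ENNReal.ofReal (Real.exp (gpPsi ψ p δ K x)) ∂μ ≤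
      ENNReal.ofReal (gpA μ ψ p 1 + 1) := by
  classical
  have hlim : Tendsto (fun k : ℕ => ∫⁻ x, ENNReal.ofReal (Real.exp (gpPsi ψ p δ (k : ℝ) x)) ∂μ)
      atTop (nhds (∫⁻ x, ENNReal.ofReal (Real.exp (1 * (ψ x ^ p + 1))) ∂μ)) := by
    refine tendsto_lintegral_of_dominated_convergence
      (fun x => ENNReal.ofReal (Real.exp 1) *
        ENNReal.ofReal (Real.exp ((|δ ^ (-p)| + 1) * ψ x ^ p))) ?_ ?_ ?_ ?_
    · intro k
      exact (gpPsi_meas d.hψ p δ k).exp.ennreal_ofReal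
    · intro k
      refine ae_of_all _ fun x => ?_
      dsimp only
      rw [← ENNReal.ofReal_mul (Real.exp_pos _).le, ← Real.exp_add]
      refine ENNReal.ofReal_le_ofReal (Real.exp_le_exp.2 ?_)
      unfold gpPsi
      have h0 := Real.rpow_nonneg (d.hψ0 x) p
      have : δ ^ (-p) * (if (k : ℝ) < ψ x then ψ x ^ p else 0) ≤ |δ ^ (-p)| * ψ x ^ p := by
        split_ifs
        · gcongr; exact le_abs_self _
        · rw [mul_zero]; positivity
      linarith
    · rw [lintegral_const_mul _ (by have := d.hψ; fun_prop)]
      exact (ENNReal.mul_lt_top ENNReal.ofReal_lt_top (d.tail _)).ne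
    · refine ae_of_all _ fun x => ?_
      refine tendsto_const_nhds.congr' ?_
      obtain ⟨N, hN⟩ := exists_nat_ge (ψ x)
      filter_upwards [eventually_ge_atTop N] with k hk
      have : ¬ ((k : ℝ) < ψ x) := by
        push Not
        exact hN.trans (by exact_mod_cast hk)
      simp [gpPsi, this]
  rw [gpA_eq d] at hlim
  have hlt : ENNReal.ofReal (gpA μ ψ p 1) < ENNReal.ofReal (gpA μ ψ p 1 + 1) := by
    rw [ENNReal.ofReal_lt_ofReal_iff]
    · linarith
    · linarith [gpA_one_le d zero_le_one]
  obtain ⟨k, hk⟩ := (hlim.eventually (gt_mem_nhds hlt)).exists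
  exact ⟨k, by positivity, hk.le⟩

lemma gpT_bound' {v : ℕ} {E : Finset (Fin v × Fin v)} {D : ℕ} {p q : ℝ}
    (S : GpSetup v E D p q) {X : Type*} [MeasurableSpace X] {ν : Measure (ℝ × X)}
    (hν : inTM ν) {M : ℝ} (hM : 1 ≤ M) {w : ℝ → ℝ → ℝ} (hw : GpKer unif01 (q * D) M w)
    (g : (Fin v → ℝ × X) → ℝ) (hg : Measurable g) :
    ENNReal.ofReal |gpT E w g ν| ≤ ENNReal.ofReal (M ^ E.card) *
      eLpNorm' g p (Measure.pi fun _ => ν) := by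
  by_cases h : eLpNorm' g p (Measure.pi fun _ => ν) = ⊤
  · rw [h, ENNReal.mul_top]
    · exact le_top
    · have : 0 < M ^ E.card := by positivity
      simpa using this
  · have := gpT_bound S hν (by linarith) hw g hg
      (eLpNorm' g p (Measure.pi fun _ => ν)).toReal ENNReal.toReal_nonneg
      (by rw [ENNReal.ofReal_toReal h]; rfl)
    calc _ ≤ ENNReal.ofReal (M ^ E.card * (eLpNorm' g p (Measure.pi fun _ => ν)).toReal) :=
          ENNReal.ofReal_le_ofReal (by rw [mul_comm]; exact this)
      _ = _ := by rw [ENNReal.ofReal_mul (by positivity), ENNReal.ofReal_toReal h]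

/-- Lift a test function to `ℝ × X`. -/
def gpS {v : ℕ} {X : Type*} (φ : (Fin v → X) → ℝ) (z : Fin v → ℝ × X) : ℝ :=
  φ (fun a => (z a).2)

lemma gpS_meas {v : ℕ} {X : Type*} [MeasurableSpace X] {φ : (Fin v → X) → ℝ}
    (hφ : Measurable φ) : Measurable (gpS φ) :=
  hφ.comp (by fun_prop)

lemma gp_pi_snd {v : ℕ} {X : Type*} [MeasurableSpace X] (μ : Measure X) [IsProbabilityMeasure μ]
    (F : (Fin v → X) → ℝ≥0∞) (hF : Measurable F) :
    ∫⁻ z, F (fun a => (z a).2) ∂(Measure.pi fun _ : Fin v => unif01.prod μ) =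
      ∫⁻ y, F y ∂(Measure.pi fun _ => μ) := by
  have h : (Measure.pi fun _ : Fin v => unif01.prod μ).map (fun z a => (z a).2) =
      Measure.pi fun _ => μ := by
    rw [Measure.pi_map_pi (fun _ => measurable_snd.aemeasurable)]
    congr 1
    ext1 a
    rw [Measure.map_snd_prod]; simp
  rw [← h, lintegral_map hF (by fun_prop)]

lemma gp_static_bound {X : Type*} [MeasurableSpace X] {μ : Measure X} [IsProbabilityMeasure μ]
    {v : ℕ} {E : Finset (Fin v × Fin v)} {D : ℕ} {p q : ℝ} {φ : (Fin v → X) → ℝ} {ψ : X → ℝ}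
    (d : GpData μ E D p q φ ψ) {M : ℝ} (hM : 1 ≤ M) {w : ℝ → ℝ → ℝ}
    (hw : GpKer unif01 (q * D) M w) {ν : Measure (ℝ × X)} (hν : inTM ν)
    (hKL : InformationTheory.klDiv ν (unif01.prod μ) ≠ ⊤) {L : ℝ} (hL : 0 < L) :
    |gpT E w (gpS φ) ν| ≤ M ^ E.card / L *
      ((InformationTheory.klDiv ν (unif01.prod μ)).toReal + gpA μ ψ p L) ∧
    Integrable (fun z => gpS φ z * ∏ e ∈ E, w (z e.1).1 (z e.2).1) (Measure.pi fun _ => ν) := by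
  have := hν.1
  have hp := d.S.hpq.pos
  have hψ := d.hψ
  have h1 := gp_lp_full ν (fun z => ψ z.2) (d.hψ.comp measurable_snd) (fun z => d.hψ0 _) p d.hvp hp
    (gpS φ) (fun z => d.hdom _)
  have h2 := gp_young ν (unif01.prod μ) (fun z => L * (ψ z.2 ^ p + 1)) (by fun_prop)
  have h3 : ∫⁻ z, ENNReal.ofReal (Real.exp (L * (ψ z.2 ^ p + 1)) - 1) ∂(unif01.prod μ) ≤
      ENNReal.ofReal (gpA μ ψ p L) := by
    rw [← gpA_eq d]
    calc _ ≤ ∫⁻ z : ℝ × X, ENNReal.ofReal (Real.exp (L * (ψ z.2 ^ p + 1))) ∂(unif01.prod μ) :=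
          lintegral_mono fun z => ENNReal.ofReal_le_ofReal (by linarith)
      _ = ∫⁻ x, ENNReal.ofReal (Real.exp (L * (ψ x ^ p + 1))) ∂((unif01.prod μ).map Prod.snd) := by
          rw [lintegral_map (by fun_prop) measurable_snd]
      _ = _ := by rw [Measure.map_snd_prod]; simp
  have hA := gpA_one_le d hL.le
  have h4 : ∫⁻ z, ENNReal.ofReal (ψ z.2 ^ p + 1) ∂ν ≤ ENNReal.ofReal (L⁻¹ *
      ((InformationTheory.klDiv ν (unif01.prod μ)).toReal + gpA μ ψ p L)) := by
    have e : ∀ z : ℝ × X, ENNReal.ofReal (ψ z.2 ^ p + 1) =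
        ENNReal.ofReal L⁻¹ * ENNReal.ofReal (L * (ψ z.2 ^ p + 1)) := by
      intro z
      rw [← ENNReal.ofReal_mul (by positivity), ← mul_assoc, inv_mul_cancel₀ hL.ne', one_mul]
    simp_rw [e]
    rw [lintegral_const_mul _ (by fun_prop), ENNReal.ofReal_mul (by positivity),
      ENNReal.ofReal_add ENNReal.toReal_nonneg (by linarith), ENNReal.ofReal_toReal hKL]
    gcongr
    exact h2.trans (by gcongr)
  have h5 := h1.trans h4
  refine ⟨?_, ?_⟩
  · have := gpT_bound d.S hν (by linarith) hw (gpS φ) (gpS_meas d.hφ) _ (by positivity) h5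
    refine this.trans (le_of_eq ?_)
    ring
  · refine gpT_intg d.S hν (by linarith) hw (gpS φ) (gpS_meas d.hφ) ?_
    have h6 := h5.trans_lt ENNReal.ofReal_lt_top
    unfold eLpNorm' at h6
    by_contra hc
    rw [not_lt, top_le_iff] at hc
    rw [hc, ENNReal.top_rpow_of_pos (by positivity)] at h6
    exact absurd h6 (lt_irrefl _)

/-- Linearity in the test function. -/
lemma gpT_sub {v : ℕ} {E : Finset (Fin v × Fin v)} {X : Type*} [MeasurableSpace X]
    {ν : Measure (ℝ × X)} {w : ℝ → ℝ → ℝ} {f g : (Fin v → ℝ × X) → ℝ}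
    (hf : Integrable (fun z => f z * ∏ e ∈ E, w (z e.1).1 (z e.2).1) (Measure.pi fun _ => ν))
    (hg : Integrable (fun z => g z * ∏ e ∈ E, w (z e.1).1 (z e.2).1) (Measure.pi fun _ => ν)) :
    gpT E w f ν - gpT E w g ν = gpT E w (fun z => f z - g z) ν := by
  unfold gpT
  rw [← integral_sub hf hg]
  congr 1
  ext z; ring

lemma gp_static_approx {X : Type*} [MeasurableSpace X] {μ : Measure X} [IsProbabilityMeasure μ]
    {v : ℕ} {E : Finset (Fin v × Fin v)} {D : ℕ} {p q : ℝ} {φ : (Fin v → X) → ℝ} {ψ : X → ℝ}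
    (d : GpData μ E D p q φ ψ) {δ K : ℝ} (hδ : 0 < δ) (hK0 : 0 ≤ K)
    (hK : ∫⁻ x, ENNReal.ofReal (Real.exp (gpPsi ψ p δ K x)) ∂μ ≤ ENNReal.ofReal (gpA μ ψ p 1 + 1)) :
    ∃ η : ℝ, 0 < η ∧ ∀ φ' : (Fin v → X) → ℝ, Measurable φ' → (∀ y, |φ' y| ≤ K ^ v) →
      ∫⁻ y, ‖gpCut ψ K φ y - φ' y‖ₑ ∂(Measure.pi fun _ => μ) ≤ ENNReal.ofReal η →
    ∀ (M : ℝ) (w : ℝ → ℝ → ℝ) (ν : Measure (ℝ × X)), 1 ≤ M → GpKer unif01 (q * D) M w → inTM ν →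
      InformationTheory.klDiv ν (unif01.prod μ) ≠ ⊤ →
      |gpT E w (gpS φ) ν - gpT E w (gpS φ') ν| ≤ M ^ E.card * (δ * (v + 3) * (gpA μ ψ p 1 + 1) *
        ((InformationTheory.klDiv ν (unif01.prod μ)).toReal + 1)) := by
  have hp := d.S.hpq.pos
  set B := 2 * K ^ v with hB
  have hB0 : 0 ≤ B := by positivity
  set cc := δ ^ (1 - p) * B ^ (p - 1) with hcc
  have hcc0 : 0 ≤ cc := by positivity
  set R := Real.exp (cc * B * v / δ + 1) with hR
  have hR1 : 1 < R := Real.one_lt_exp_iff.2 (by positivity)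
  have hlogR : Real.log R = cc * B * v / δ + 1 := Real.log_exp _
  refine ⟨δ / ((cc + 1) * R ^ v), by positivity, ?_⟩
  intro φ' hφ' hφ'B hclose M w ν hM hw hν hKL
  have := hν.1
  set Dr := (InformationTheory.klDiv ν (unif01.prod μ)).toReal with hDr
  have hDr0 : 0 ≤ Dr := ENNReal.toReal_nonneg
  have hDe : InformationTheory.klDiv ν (unif01.prod μ) = ENNReal.ofReal Dr :=
    (ENNReal.ofReal_toReal hKL).symm
  have hA := gpA_one_le d zero_le_one
  have hcutB : ∀ y, |gpCut ψ K φ y - φ' y| ≤ B := by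
    intro y
    refine (abs_sub _ _).trans ?_
    have := gpCut_abs d.hψ0 hK0 d.hdom y
    have := hφ'B y
    rw [hB]; linarith
  have hcm := gpCut_meas d.hψ K d.hφ
  have hint1 := (gp_static_bound d hM hw hν hKL zero_lt_one).2
  have hint2 := gpT_intg d.S hν (by linarith) hw (gpS φ') (gpS_meas hφ')
    (gp_bdd_pow _ hp _ _ fun z => hφ'B _)
  rw [gpT_sub hint1 hint2]
  have hb := gpT_bound' d.S hν hM hw (fun z => gpS φ z - gpS φ' z)
    ((gpS_meas d.hφ).sub (gpS_meas hφ'))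
  have hs := gp_lp_split d.hv ν (fun z => ψ z.2) (d.hψ.comp measurable_snd) (fun z => d.hψ0 _) p
    d.hvp δ K B hδ hB0 (gpS φ) (gpS φ') (gpS_meas d.hφ) (gpS_meas hφ') (fun z => d.hdom _)
    (fun z => hcutB _) univ MeasurableSet.univ
  simp only [indicator_univ] at hs
  -- first part
  have h1 : ∫⁻ z, ENNReal.ofReal (gpPsi (fun z : ℝ × X => ψ z.2) p δ K z) ∂ν ≤
      ENNReal.ofReal (Dr + (gpA μ ψ p 1 + 1)) := by
    have h2 := gp_young ν (unif01.prod μ) (gpPsi (fun z : ℝ × X => ψ z.2) p δ K)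
      (gpPsi_meas (d.hψ.comp measurable_snd) p δ K)
    refine h2.trans ?_
    rw [hDe, ENNReal.ofReal_add hDr0 (by linarith)]
    gcongr
    refine le_trans ?_ hK
    calc _ ≤ ∫⁻ z : ℝ × X, ENNReal.ofReal (Real.exp (gpPsi ψ p δ K z.2)) ∂(unif01.prod μ) :=
          lintegral_mono fun z => ENNReal.ofReal_le_ofReal (by
            change Real.exp (gpPsi ψ p δ K z.2) - 1 ≤ _
            linarith)
      _ = ∫⁻ x, ENNReal.ofReal (Real.exp (gpPsi ψ p δ K x)) ∂((unif01.prod μ).map Prod.snd) := by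
          rw [lintegral_map (gpPsi_meas d.hψ p δ K).exp.ennreal_ofReal measurable_snd]
      _ = _ := by rw [Measure.map_snd_prod]; simp
  have h2 : ∫⁻ z, ‖gpCut (fun z : ℝ × X => ψ z.2) K (gpS φ) z - gpS φ' z‖ₑ ∂(Measure.pi fun _ => ν) ≤
      ENNReal.ofReal (R ^ v * (δ / ((cc + 1) * R ^ v)) +
        B * (v * ((Real.log R)⁻¹ * (Dr + 1)))) := by
    have h3 := gp_kl_pi ν (unif01.prod μ) R hR1
      (fun z : Fin v → ℝ × X => ‖gpCut ψ K φ (fun a => (z a).2) - φ' (fun a => (z a).2)‖ₑ)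
      ((hcm.sub hφ').enorm.comp (by fun_prop)) (ENNReal.ofReal B) (fun z => by
        rw [← ofReal_norm, Real.norm_eq_abs]
        exact ENNReal.ofReal_le_ofReal (hcutB _))
    refine le_trans h3 ?_
    rw [gp_pi_snd μ (fun y => ‖gpCut ψ K φ y - φ' y‖ₑ) (hcm.sub hφ').enorm, hDe]
    have hlp := (Real.log_pos hR1).le
    rw [ENNReal.ofReal_add (by positivity) (by positivity), ENNReal.ofReal_mul (p := R ^ v) (by positivity),
      ENNReal.ofReal_mul (p := B) hB0, ENNReal.ofReal_mul (p := (v : ℝ)) (by positivity),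
      ENNReal.ofReal_mul (p := (Real.log R)⁻¹) (by positivity), ENNReal.ofReal_add hDr0 zero_le_one,
      ENNReal.ofReal_natCast, ENNReal.ofReal_one, ENNReal.ofReal_pow (by positivity)]
    gcongr
  have h4 : ENNReal.ofReal |gpT E w (fun z => gpS φ z - gpS φ' z) ν| ≤
      ENNReal.ofReal (M ^ E.card * (v * δ * (Dr + (gpA μ ψ p 1 + 1)) + (δ + cc *
        (R ^ v * (δ / ((cc + 1) * R ^ v)) + B * (v * ((Real.log R)⁻¹ * (Dr + 1))))))) := by
    have hlp := (Real.log_pos hR1).le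
    refine hb.trans ?_
    rw [ENNReal.ofReal_mul (by positivity)]
    gcongr
    refine hs.trans ?_
    rw [ENNReal.ofReal_add (by positivity) (by positivity),
      ENNReal.ofReal_mul (p := v * δ) (by positivity),
      ENNReal.ofReal_add hδ.le (by positivity), ENNReal.ofReal_mul hcc0]
    gcongr
  have h5 := (ENNReal.ofReal_le_ofReal_iff (by
    have hlp := (Real.log_pos hR1).le
    positivity)).1 h4
  refine h5.trans ?_
  gcongr
  have e1 : cc * (R ^ v * (δ / ((cc + 1) * R ^ v))) ≤ δ := by
    have : cc * (R ^ v * (δ / ((cc + 1) * R ^ v))) = δ * (cc / (cc + 1)) := by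
      field_simp
    rw [this]
    have : cc / (cc + 1) ≤ 1 := by rw [div_le_one (by positivity)]; linarith
    nlinarith
  have e2 : cc * (B * (v * ((Real.log R)⁻¹ * (Dr + 1)))) ≤ δ * (Dr + 1) := by
    have : cc * (B * (v * ((Real.log R)⁻¹ * (Dr + 1)))) =
      (cc * B * v * (Real.log R)⁻¹) * (Dr + 1) := by ring
    rw [this]
    gcongr
    rw [hlogR, ← div_eq_mul_inv, div_le_iff₀ (by positivity)]
    have : δ * (cc * B * v / δ + 1) = cc * B * v + δ := by field_simp
    linarith
  rw [mul_add]
  have hv0 : (0 : ℝ) ≤ v := by positivity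
  have e3 : v * δ * (Dr + (gpA μ ψ p 1 + 1)) ≤ v * δ * ((gpA μ ψ p 1 + 1) * (Dr + 1)) := by
    gcongr
    nlinarith
  have e4 : δ * (Dr + 1) * 3 ≤ δ * ((gpA μ ψ p 1 + 1) * (Dr + 1)) * 3 := by
    have : Dr + 1 ≤ (gpA μ ψ p 1 + 1) * (Dr + 1) := by nlinarith
    gcongr
  have e5 : δ ≤ δ * (Dr + 1) := by nlinarith
  nlinarith

/-- An index map with uniform fibres. -/
structure GpTau {n : ℕ} (τ : ℝ → Fin n) : Prop where
  meas : Measurable τ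
  unif : ∀ i, unif01 (τ ⁻¹' {i}) = (n : ℝ≥0∞)⁻¹

lemma GpTau.pos {n : ℕ} {τ : ℝ → Fin n} (_h : GpTau τ) : 0 < n := (τ 0).pos

/-- Pulled back matrix. -/
def gpQ {n : ℕ} (τ : ℝ → Fin n) (Q : Fin n → Fin n → ℝ) (s t : ℝ) : ℝ := Q (τ s) (τ t)

/-- Empirical measure. -/
noncomputable def gpEmp {X : Type*} [MeasurableSpace X] {n : ℕ} (τ : ℝ → Fin n) (x : Fin n → X) :
    Measure (ℝ × X) := unif01.map (fun a => (a, x (τ a)))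

/-- Injectivity set. -/
def gpJ {X : Type*} {n : ℕ} (v : ℕ) (τ : ℝ → Fin n) : Set (Fin v → ℝ × X) :=
  {z | Function.Injective (fun a => τ (z a).1)}

/-- The U-statistic. -/
noncomputable def gpU {X : Type*} {v : ℕ} (E : Finset (Fin v × Fin v)) (φ : (Fin v → X) → ℝ)
    {n : ℕ} (Q : Fin n → Fin n → ℝ) (x : Fin n → X) : ℝ :=
  (∑ i ∈ Finset.univ.filter (fun i : Fin v → Fin n => Function.Injective i),
      φ (x ∘ i) * ∏ e ∈ E, Q (i e.1) (i e.2)) / (n : ℝ) ^ v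

lemma gpEmp_meas_aux {X : Type*} [MeasurableSpace X] {n : ℕ} {τ : ℝ → Fin n} (h : GpTau τ)
    (x : Fin n → X) : Measurable (fun a => (a, x (τ a))) :=
  measurable_id.prodMk ((measurable_of_countable x).comp h.meas)

lemma gpEmp_inTM {X : Type*} [MeasurableSpace X] {n : ℕ} {τ : ℝ → Fin n} (h : GpTau τ)
    (x : Fin n → X) : inTM (gpEmp τ x) := by
  have hm := gpEmp_meas_aux h x
  refine ⟨Measure.isProbabilityMeasure_map hm.aemeasurable, ?_⟩
  unfold gpEmp
  rw [Measure.map_map measurable_fst hm]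
  exact Measure.map_id

lemma gpJ_meas {X : Type*} [MeasurableSpace X] {n v : ℕ} {τ : ℝ → Fin n} (h : GpTau τ) :
    MeasurableSet (gpJ (X := X) v τ) := by
  have : gpJ (X := X) v τ = (fun z : Fin v → ℝ × X => fun a => τ (z a).1) ⁻¹'
      {i | Function.Injective i} := rfl
  rw [this]
  refine MeasurableSet.preimage (Set.toFinite _).measurableSet ?_
  exact measurable_pi_lambda _ fun a => h.meas.comp (by fun_prop)

lemma gp_unif_map {n : ℕ} {τ : ℝ → Fin n} (h : GpTau τ) (i : Fin n) :
    (unif01.map τ) {i} = (n : ℝ≥0∞)⁻¹ := by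
  rw [Measure.map_apply h.meas (measurableSet_singleton i), h.unif]

lemma gp_pi_unif {v n : ℕ} {τ : ℝ → Fin n} (h : GpTau τ) (i : Fin v → Fin n) :
    ((Measure.pi fun _ : Fin v => unif01).map (fun z a => τ (z a))) {i} = (n : ℝ≥0∞)⁻¹ ^ v := by
  have := Measure.isProbabilityMeasure_map (μ := unif01) h.meas.aemeasurable
  rw [Measure.pi_map_pi (fun _ => h.meas.aemeasurable)]
  rw [← univ_pi_singleton, Measure.pi_pi]
  simp [gp_unif_map h]

lemma gp_emp_pi {X : Type*} [MeasurableSpace X] {v n : ℕ} {τ : ℝ → Fin n} (h : GpTau τ)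
    (x : Fin n → X) : (Measure.pi fun _ : Fin v => gpEmp τ x) =
      (Measure.pi fun _ : Fin v => unif01).map (fun z a => (z a, x (τ (z a)))) := by
  have hm := gpEmp_meas_aux h x
  have : IsProbabilityMeasure (unif01.map (fun a => (a, x (τ a)))) :=
    Measure.isProbabilityMeasure_map hm.aemeasurable
  rw [Measure.pi_map_pi (fun _ => hm.aemeasurable)]
  rfl

lemma gp_emp_lintegral {X : Type*} [MeasurableSpace X] {v n : ℕ} {τ : ℝ → Fin n} (h : GpTau τ)
    (x : Fin n → X) (H : (Fin v → ℝ × X) → ℝ≥0∞) (hH : Measurable H)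
    (H' : (Fin v → Fin n) → ℝ≥0∞)
    (hHH : ∀ z : Fin v → ℝ, H (fun a => (z a, x (τ (z a)))) = H' (fun a => τ (z a))) :
    ∫⁻ z, H z ∂(Measure.pi fun _ => gpEmp τ x) = (n : ℝ≥0∞)⁻¹ ^ v * ∑ i, H' i := by
  have hm := gpEmp_meas_aux h x
  have hm3 : Measurable (fun (z : Fin v → ℝ) (a : Fin v) => (z a, x (τ (z a)))) :=
    measurable_pi_lambda _ fun a => hm.comp (measurable_pi_apply a)
  rw [gp_emp_pi h, lintegral_map hH hm3]
  simp_rw [hHH]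
  have hm2 : Measurable (fun (z : Fin v → ℝ) a => τ (z a)) :=
    measurable_pi_lambda _ fun a => h.meas.comp (measurable_pi_apply a)
  rw [← lintegral_map (f := H') (measurable_of_countable _) hm2, lintegral_fintype]
  simp_rw [gp_pi_unif h]
  rw [← Finset.sum_mul, mul_comm]

lemma gp_emp_lintegral_one {X : Type*} [MeasurableSpace X] {n : ℕ} {τ : ℝ → Fin n} (h : GpTau τ)
    (x : Fin n → X) (F : X → ℝ≥0∞) (hF : Measurable F) :
    ∫⁻ z, F z.2 ∂(gpEmp τ x) = (n : ℝ≥0∞)⁻¹ * ∑ i, F (x i) := by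
  have hm := gpEmp_meas_aux h x
  unfold gpEmp
  rw [lintegral_map (f := fun z : ℝ × X => F z.2) (hF.comp measurable_snd) hm]
  rw [← lintegral_map (f := fun i => F (x i)) (measurable_of_countable _) h.meas, lintegral_fintype]
  simp_rw [gp_unif_map h]
  rw [← Finset.sum_mul, mul_comm]

lemma gpU_eq {X : Type*} [MeasurableSpace X] {v n : ℕ} {τ : ℝ → Fin n} (h : GpTau τ)
    (E : Finset (Fin v × Fin v)) {φ : (Fin v → X) → ℝ} (hφ : Measurable φ)
    (Q : Fin n → Fin n → ℝ) (x : Fin n → X) :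
    gpU E φ Q x = gpT E (gpQ τ Q) ((gpJ v τ).indicator (gpS φ)) (gpEmp τ x) := by
  classical
  have hm := gpEmp_meas_aux h x
  unfold gpT
  rw [gp_emp_pi h, integral_map]
  rotate_left
  · exact (measurable_pi_lambda _ fun a => hm.comp (measurable_pi_apply a)).aemeasurable
  · refine Measurable.aestronglyMeasurable ?_
    refine ((gpS_meas hφ).indicator (gpJ_meas h)).mul (Finset.measurable_prod _ fun e _ => ?_)
    have : Measurable (fun p : Fin n × Fin n => Q p.1 p.2) := measurable_of_countable _
    exact this.comp (Measurable.prodMk (h.meas.comp (by fun_prop)) (h.meas.comp (by fun_prop)))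
  have hm2 : Measurable (fun (z : Fin v → ℝ) a => τ (z a)) :=
    measurable_pi_lambda _ fun a => h.meas.comp (measurable_pi_apply a)
  have : ∀ z : Fin v → ℝ, (gpJ v τ).indicator (gpS φ) (fun a => (z a, x (τ (z a)))) *
      ∏ e ∈ E, gpQ τ Q (z e.1) (z e.2) =
      (fun i : Fin v → Fin n => (if Function.Injective i then φ (x ∘ i) else 0) *
        ∏ e ∈ E, Q (i e.1) (i e.2)) (fun a => τ (z a)) := by
    intro z
    simp only [indicator_apply, gpJ, mem_ofPred_eq]
    rfl
  simp_rw [this]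
  have hf : IsProbabilityMeasure ((Measure.pi fun _ : Fin v => unif01).map (fun z a => τ (z a))) :=
    Measure.isProbabilityMeasure_map hm2.aemeasurable
  rw [← integral_map (φ := fun (z : Fin v → ℝ) a => τ (z a)) (f := fun i : Fin v → Fin n =>
    (if Function.Injective i then φ (x ∘ i) else 0) *
        ∏ e ∈ E, Q (i e.1) (i e.2)) hm2.aemeasurable
        (measurable_of_countable _).aestronglyMeasurable,
    integral_fintype (Integrable.of_finite)]
  unfold gpU
  rw [Finset.sum_filter, Finset.sum_div]
  refine Finset.sum_congr rfl fun i _ => ?_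
  rw [measureReal_def, gp_pi_unif h]
  simp only [ENNReal.toReal_pow, ENNReal.toReal_inv, ENNReal.toReal_natCast, smul_eq_mul]
  split_ifs
  · rw [div_eq_mul_inv, inv_pow]; ring
  · simp

lemma gp_marginal {X : Type*} [MeasurableSpace X] {v n : ℕ} (ν : Fin n → Measure X)
    [∀ i, IsProbabilityMeasure (ν i)] (i : Fin v → Fin n) (hi : Function.Injective i) :
    (Measure.pi ν).map (fun x => x ∘ i) = Measure.pi (fun a => ν (i a)) := by
  have h1 : ProbabilityTheory.iIndepFun (fun (j : Fin n) (x : Fin n → X) => x j) (Measure.pi ν) :=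
    ProbabilityTheory.iIndepFun_pi (X := fun _ => id) (fun _ => aemeasurable_id)
  have h2 := h1.precomp hi
  rw [ProbabilityTheory.iIndepFun_iff_map_fun_eq_pi_map
    (fun a => (measurable_pi_apply (i a)).aemeasurable)] at h2
  have h3 : (fun x : Fin n → X => x ∘ i) = fun x a => x (i a) := rfl
  rw [h3, h2]
  congr 1
  ext1 a
  exact (measurePreserving_eval ν (i a)).map_eq

lemma gp_count_inj {v n : ℕ} (j : Fin n) :
    ((Finset.univ.filter (fun i : Fin v → Fin n => Function.Injective i)).filter
      (fun i => j ∈ Finset.univ.image i)).card ≤ v * n ^ (v - 1) := by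
  classical
  have hsub : (Finset.univ.filter (fun i : Fin v → Fin n => Function.Injective i)).filter
      (fun i => j ∈ Finset.univ.image i) ⊆
      Finset.univ.biUnion (fun a : Fin v => Finset.univ.filter (fun i : Fin v → Fin n => i a = j)) := by
    intro i hi
    simp only [Finset.mem_filter, Finset.mem_image, Finset.mem_univ, true_and] at hi
    obtain ⟨_, a, ha⟩ := hi
    simp only [Finset.mem_biUnion, Finset.mem_univ, true_and, Finset.mem_filter]
    exact ⟨a, ha⟩
  refine (Finset.card_le_card hsub).trans (Finset.card_biUnion_le.trans ?_)
  have : ∀ a : Fin v, (Finset.univ.filter (fun i : Fin v → Fin n => i a = j)).card = n ^ (v - 1) := by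
    intro a
    have e : Finset.univ.filter (fun i : Fin v → Fin n => i a = j) =
        Fintype.piFinset (fun b => if b = a then {j} else Finset.univ) := by
      ext i
      simp only [Finset.mem_filter, Finset.mem_univ, true_and, Fintype.mem_piFinset]
      constructor
      · intro h b
        by_cases hb : b = a
        · rw [hb, h]; simp
        · simp [hb]
      · intro h
        have := h a
        simpa using this
    rw [e, Fintype.card_piFinset]
    rw [← Finset.mul_prod_erase _ _ (Finset.mem_univ a)]
    simp only [if_true, Finset.card_singleton, one_mul]
    rw [Finset.prod_congr rfl (g := fun _ => n)]
    · simp [Finset.card_erase_of_mem]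
    · intro b hb
      simp [Finset.ne_of_mem_erase hb]
  simp [this]

lemma gp_exp_sum_pi {X : Type*} [MeasurableSpace X] (μ : Measure X) [IsProbabilityMeasure μ]
    {n : ℕ} (F : X → ℝ) (hF : Measurable F) :
    ∫⁻ x, ENNReal.ofReal (Real.exp (∑ i, F (x i))) ∂(Measure.pi fun _ : Fin n => μ) =
      (∫⁻ x, ENNReal.ofReal (Real.exp (F x)) ∂μ) ^ n := by
  have : ∀ x : Fin n → X, ENNReal.ofReal (Real.exp (∑ i, F (x i))) =
      ∏ i, ENNReal.ofReal (Real.exp (F (x i))) := by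
    intro x
    rw [Real.exp_sum, ENNReal.ofReal_prod_of_nonneg (fun _ _ => (Real.exp_pos _).le)]
  simp_rw [this]
  rw [gp_lintegral_pi_prod (fun _ => μ) (fun _ x => ENNReal.ofReal (Real.exp (F x)))
    (fun _ => hF.exp.ennreal_ofReal)]
  simp

lemma gp_ofReal_avg {n : ℕ} (F : Fin n → ℝ) (hF : ∀ i, 0 ≤ F i) (hn : 0 < n) :
    (n : ℝ≥0∞)⁻¹ * ∑ i, ENNReal.ofReal (F i) = ENNReal.ofReal ((n : ℝ)⁻¹ * ∑ i, F i) := by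
  rw [ENNReal.ofReal_mul (by positivity), ENNReal.ofReal_sum_of_nonneg (fun i _ => hF i),
    ENNReal.ofReal_inv_of_pos (by exact_mod_cast hn), ENNReal.ofReal_natCast]

lemma gp_dyn_full {X : Type*} [MeasurableSpace X] {μ : Measure X} [IsProbabilityMeasure μ]
    {v : ℕ} {E : Finset (Fin v × Fin v)} {D : ℕ} {p q : ℝ} {φ : (Fin v → X) → ℝ} {ψ : X → ℝ}
    (d : GpData μ E D p q φ ψ) {M : ℝ} (hM : 1 ≤ M) {n : ℕ} {τ : ℝ → Fin n} (h : GpTau τ)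
    {Q : Fin n → Fin n → ℝ} (hQ : GpKer unif01 (q * D) M (gpQ τ Q)) {L : ℝ} (hL : 0 ≤ L) :
    ∫⁻ x, ENNReal.ofReal (Real.exp (n * (L * |gpU E φ Q x|))) ∂(Measure.pi fun _ : Fin n => μ) ≤
      ENNReal.ofReal (gpA μ ψ p (L * M ^ E.card)) ^ n := by
  have hp := d.S.hpq.pos
  have hn := h.pos
  have hψ := d.hψ
  rw [← gpA_eq d, ← gp_exp_sum_pi μ (fun x => L * M ^ E.card * (ψ x ^ p + 1)) (by fun_prop)]
  refine lintegral_mono fun x => ENNReal.ofReal_le_ofReal (Real.exp_le_exp.2 ?_)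
  have hT := gpEmp_inTM h x
  have := hT.1
  have hψp : ∀ i, 0 ≤ ψ (x i) ^ p := fun i => Real.rpow_nonneg (d.hψ0 _) p
  have h1 := gp_lp_full (gpEmp τ x) (fun z => ψ z.2) (d.hψ.comp measurable_snd)
    (fun z => d.hψ0 _) p d.hvp hp
    (gpS φ) (fun z => d.hdom _)
  have h2 := gpT_bound' d.S hT hM hQ ((gpJ v τ).indicator (gpS φ))
    ((gpS_meas d.hφ).indicator (gpJ_meas h))
  rw [← gpU_eq h E d.hφ] at h2
  have h3 : eLpNorm' ((gpJ v τ).indicator (gpS φ)) p (Measure.pi fun _ => gpEmp τ x) ≤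
      ENNReal.ofReal ((n : ℝ)⁻¹ * ∑ i, (ψ (x i) ^ p + 1)) := by
    refine le_trans ?_ (h1.trans (le_of_eq ?_))
    · refine ENNReal.rpow_le_rpow (lintegral_mono fun z => ?_) (by positivity)
      exact ENNReal.rpow_le_rpow (enorm_indicator_le_enorm_self _ _) hp.le
    · rw [gp_emp_lintegral_one h x (fun y => ENNReal.ofReal (ψ y ^ p + 1)) (by fun_prop),
        gp_ofReal_avg _ (fun i => by linarith [hψp i]) hn]
  have h4 : |gpU E φ Q x| ≤ M ^ E.card * ((n : ℝ)⁻¹ * ∑ i, (ψ (x i) ^ p + 1)) := by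
    rw [← ENNReal.ofReal_le_ofReal_iff, ENNReal.ofReal_mul (by positivity)]
    · exact h2.trans (by gcongr)
    · have : 0 ≤ ∑ i, (ψ (x i) ^ p + 1) := Finset.sum_nonneg fun i _ => by linarith [hψp i]
      positivity
  rw [← Finset.mul_sum]
  have hn' : (0 : ℝ) < n := by exact_mod_cast hn
  calc n * (L * |gpU E φ Q x|) ≤ n * (L * (M ^ E.card * ((n : ℝ)⁻¹ * ∑ i, (ψ (x i) ^ p + 1)))) := by
        gcongr
    _ = _ := by field_simp

lemma gp_dyn_inj {X : Type*} [MeasurableSpace X] (μ : Measure X) [IsProbabilityMeasure μ]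
    {v n : ℕ} (hv : 1 ≤ v) (hn : 0 < n) (G : (Fin v → X) → ℝ) (hG : Measurable G) (lam : ℝ)
    (hI : ∫⁻ y, ENNReal.ofReal (Real.exp (lam * G y)) ∂(Measure.pi fun _ => μ) ≤ 2) :
    ∫⁻ x, ENNReal.ofReal (Real.exp (∑ i ∈ Finset.univ.filter
      (fun i : Fin v → Fin n => Function.Injective i), lam * G (x ∘ i) / (v * n ^ (v - 1) : ℕ)))
      ∂(Measure.pi fun _ : Fin n => μ) ≤ 2 ^ n := by
  classical
  have : Nonempty X := by
    by_contra hc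
    rw [not_nonempty_iff] at hc
    have h1 : μ univ = 1 := measure_univ
    rw [Set.univ_eq_empty_iff.2 hc] at h1
    simp at h1
  set s := Finset.univ.filter (fun i : Fin v → Fin n => Function.Injective i) with hs
  set DD := v * n ^ (v - 1) with hDD
  have hDD1 : 1 ≤ DD := Nat.mul_pos hv (pow_pos hn _)
  have hDr : (0 : ℝ) < DD := by exact_mod_cast hDD1
  have hFm : Measurable (fun y => ENNReal.ofReal (Real.exp (lam * G y))) := by fun_prop
  have hcm : ∀ i : Fin v → Fin n, Measurable (fun x : Fin n → X => x ∘ i) := fun i =>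
    measurable_pi_lambda _ fun a => measurable_pi_apply _
  have hfin := gp_finner (fun _ : Fin n => μ) s
    (fun (i : Fin v → Fin n) (x : Fin n → X) => ENNReal.ofReal (Real.exp (lam * G (x ∘ i))))
    (fun i => hFm.comp (hcm i))
    (fun i => Finset.univ.image i) (by
      intro i j hj x y
      have : Function.update x j y ∘ i = x ∘ i := by
        ext a
        have : i a ≠ j := fun hc => hj (Finset.mem_image.2 ⟨a, Finset.mem_univ _, hc⟩)
        simp [Function.update_of_ne this]
      simp only [this]) DD hDD1 (fun j => gp_count_inj j)
  calc _ = ∫⁻ x, ∏ i ∈ s, ENNReal.ofReal (Real.exp (lam * G (x ∘ i))) ^ (1 / (DD : ℝ))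
        ∂(Measure.pi fun _ : Fin n => μ) := by
        refine lintegral_congr fun x => ?_
        rw [Real.exp_sum, ENNReal.ofReal_prod_of_nonneg (fun _ _ => (Real.exp_pos _).le)]
        refine Finset.prod_congr rfl fun i _ => ?_
        rw [ENNReal.ofReal_rpow_of_pos (Real.exp_pos _), ← Real.exp_mul, mul_one_div]
    _ ≤ _ := hfin
    _ ≤ ∏ _i ∈ s, (2 : ℝ≥0∞) ^ (1 / (DD : ℝ)) := by
        refine Finset.prod_le_prod' fun i hi => ?_
        refine ENNReal.rpow_le_rpow ?_ (by positivity)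
        have hinj : Function.Injective i := (Finset.mem_filter.1 hi).2
        rw [← lintegral_map (f := fun y => ENNReal.ofReal (Real.exp (lam * G y))) hFm (hcm i),
          gp_marginal (fun _ => μ) i hinj]
        exact hI
    _ = (2 : ℝ≥0∞) ^ ((s.card : ℝ) / DD) := by
        rw [Finset.prod_const, ← ENNReal.rpow_natCast, ← ENNReal.rpow_mul]
        congr 1; ring
    _ ≤ (2 : ℝ≥0∞) ^ (n : ℝ) := by
        refine ENNReal.rpow_le_rpow_of_exponent_le (by norm_num) ?_
        rw [div_le_iff₀ hDr]
        have h1 : s.card ≤ n ^ v := by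
          calc s.card ≤ (Finset.univ : Finset (Fin v → Fin n)).card := Finset.card_le_univ _
            _ = n ^ v := by simp
        have h2 : n ^ v ≤ n * DD := by
          rw [hDD]
          calc n ^ v = n * n ^ (v - 1) := by rw [← pow_succ', Nat.sub_add_cancel hv]
            _ ≤ n * (v * n ^ (v - 1)) := by
              gcongr
              exact Nat.le_mul_of_pos_left _ hv
        exact_mod_cast h1.trans h2
    _ = 2 ^ n := ENNReal.rpow_natCast _ _

lemma gp_exp_lin {α : Type*} [MeasurableSpace α] (P : Measure α) [IsProbabilityMeasure P]
    (G : α → ℝ) (hG : Measurable G) (hG0 : ∀ z, 0 ≤ G z) (B lam η : ℝ) (hGB : ∀ z, G z ≤ B)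
    (hlam : 0 ≤ lam) (hη : lam * Real.exp (lam * B) * η ≤ 1)
    (hI : ∫⁻ z, ENNReal.ofReal (G z) ∂P ≤ ENNReal.ofReal η) :
    ∫⁻ z, ENNReal.ofReal (Real.exp (lam * G z)) ∂P ≤ 2 := by
  have : ∀ z, ENNReal.ofReal (Real.exp (lam * G z)) ≤
      1 + ENNReal.ofReal (lam * Real.exp (lam * B)) * ENNReal.ofReal (G z) := by
    intro z
    rw [← ENNReal.ofReal_mul (by positivity), ← ENNReal.ofReal_one,
      ← ENNReal.ofReal_add zero_le_one (by have := hG0 z; positivity)]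
    refine ENNReal.ofReal_le_ofReal ?_
    set y := lam * G z with hy
    have hy0 : 0 ≤ y := mul_nonneg hlam (hG0 z)
    have h1 : Real.exp y ≤ 1 + y * Real.exp y := by
      have := Real.add_one_le_exp (-y)
      have h2 : Real.exp (-y) * Real.exp y = 1 := by rw [← Real.exp_add]; simp
      nlinarith [Real.exp_pos y]
    have h2 : Real.exp y ≤ Real.exp (lam * B) := by
      rw [Real.exp_le_exp, hy]
      gcongr; exact hGB z
    calc Real.exp y ≤ 1 + y * Real.exp y := h1
      _ ≤ 1 + y * Real.exp (lam * B) := by gcongr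
      _ = _ := by rw [hy]; ring
  refine (lintegral_mono this).trans ?_
  rw [lintegral_add_left measurable_const, lintegral_const_mul _ hG.ennreal_ofReal]
  simp only [lintegral_const, measure_univ, mul_one]
  have h2 : ENNReal.ofReal (lam * Real.exp (lam * B)) * ∫⁻ z, ENNReal.ofReal (G z) ∂P ≤ 1 := by
    calc _ ≤ ENNReal.ofReal (lam * Real.exp (lam * B)) * ENNReal.ofReal η := by gcongr
      _ = ENNReal.ofReal (lam * Real.exp (lam * B) * η) := by rw [← ENNReal.ofReal_mul (by positivity)]
      _ ≤ ENNReal.ofReal 1 := ENNReal.ofReal_le_ofReal hη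
      _ = 1 := ENNReal.ofReal_one
  calc _ ≤ (1 : ℝ≥0∞) + 1 := by gcongr
    _ = 2 := by norm_num

lemma gpPsi_nonneg {α : Type*} {ψ : α → ℝ} (hψ0 : ∀ x, 0 ≤ ψ x) (p K : ℝ) {δ : ℝ} (hδ : 0 < δ)
    (x : α) : 0 ≤ gpPsi ψ p δ K x := by
  unfold gpPsi
  have h1 := Real.rpow_nonneg (hψ0 x) p
  have h2 := Real.rpow_nonneg hδ.le (-p)
  split_ifs <;> positivity

lemma gpU_sub {X : Type*} {v n : ℕ} (E : Finset (Fin v × Fin v)) (φ φ' : (Fin v → X) → ℝ)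
    (Q : Fin n → Fin n → ℝ) (x : Fin n → X) :
    gpU E φ Q x - gpU E φ' Q x = gpU E (fun y => φ y - φ' y) Q x := by
  simp only [gpU, sub_mul, Finset.sum_sub_distrib, sub_div]

lemma gpU_meas {X : Type*} [MeasurableSpace X] {v n : ℕ} (E : Finset (Fin v × Fin v))
    {φ : (Fin v → X) → ℝ} (hφ : Measurable φ) (Q : Fin n → Fin n → ℝ) :
    Measurable (gpU E φ Q) := by
  unfold gpU
  refine Measurable.div_const (Finset.measurable_sum _ fun i _ => ?_) _
  refine Measurable.mul_const (hφ.comp ?_) _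
  exact measurable_pi_lambda _ fun a => measurable_pi_apply _

lemma gp_dyn_pt {X : Type*} [MeasurableSpace X] {μ : Measure X}
    {v : ℕ} {E : Finset (Fin v × Fin v)} {D : ℕ} {p q : ℝ} {φ : (Fin v → X) → ℝ} {ψ : X → ℝ}
    (d : GpData μ E D p q φ ψ) {M : ℝ} (hM : 1 ≤ M) {n : ℕ} {τ : ℝ → Fin n} (h : GpTau τ)
    {Q : Fin n → Fin n → ℝ} (hQ : GpKer unif01 (q * D) M (gpQ τ Q)) {δ K B : ℝ}
    (hδ : 0 < δ) (hB : 0 ≤ B) (φ' : (Fin v → X) → ℝ) (hφ' : Measurable φ')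
    (hφB : ∀ y, |gpCut ψ K φ y - φ' y| ≤ B) (x : Fin n → X) :
    |gpU E φ Q x - gpU E φ' Q x| ≤ M ^ E.card * (v * δ * ((n : ℝ)⁻¹ * ∑ i, gpPsi ψ p δ K (x i)) +
      (δ + δ ^ (1 - p) * B ^ (p - 1) * (((n : ℝ)⁻¹) ^ v *
        ∑ i ∈ Finset.univ.filter (fun i : Fin v → Fin n => Function.Injective i),
          |gpCut ψ K φ (x ∘ i) - φ' (x ∘ i)|))) := by
  have hp := d.S.hpq.pos
  have hn := h.pos
  have hψ := d.hψ
  have hT := gpEmp_inTM h x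
  have := hT.1
  have hΨ := gpPsi_nonneg d.hψ0 p K hδ
  have h1 := gp_lp_split d.hv (gpEmp τ x) (fun z => ψ z.2) (d.hψ.comp measurable_snd)
    (fun z => d.hψ0 _) p d.hvp δ K B hδ hB (gpS φ) (gpS φ') (gpS_meas d.hφ) (gpS_meas hφ')
    (fun z => d.hdom _) (fun z => hφB _) (gpJ v τ) (gpJ_meas h)
  have h2 := gpT_bound' d.S hT hM hQ ((gpJ v τ).indicator (gpS (fun y => φ y - φ' y)))
    ((gpS_meas (d.hφ.sub hφ')).indicator (gpJ_meas h))
  have hsm : Measurable (fun y => φ y - φ' y) := d.hφ.sub hφ'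
  rw [← gpU_eq h E hsm] at h2
  rw [gpU_sub]
  have e1 : ∫⁻ z, ENNReal.ofReal (gpPsi (fun z : ℝ × X => ψ z.2) p δ K z) ∂(gpEmp τ x) =
      ENNReal.ofReal ((n : ℝ)⁻¹ * ∑ i, gpPsi ψ p δ K (x i)) := by
    rw [← gp_ofReal_avg _ (fun i => hΨ _) hn,
      ← gp_emp_lintegral_one h x (fun y => ENNReal.ofReal (gpPsi ψ p δ K y))
        (gpPsi_meas hψ p δ K).ennreal_ofReal]
    rfl
  have e2 : ∫⁻ z, ‖(gpJ v τ).indicator (fun z => gpCut (fun z : ℝ × X => ψ z.2) K (gpS φ) z -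
        gpS φ' z) z‖ₑ ∂(Measure.pi fun _ => gpEmp τ x) =
      ENNReal.ofReal (((n : ℝ)⁻¹) ^ v *
        ∑ i ∈ Finset.univ.filter (fun i : Fin v → Fin n => Function.Injective i),
          |gpCut ψ K φ (x ∘ i) - φ' (x ∘ i)|) := by
    have hmm : Measurable (fun z => ‖(gpJ v τ).indicator (fun z =>
        gpCut (fun z : ℝ × X => ψ z.2) K (gpS φ) z - gpS φ' z) z‖ₑ) :=
      Measurable.enorm (Measurable.indicator
      ((gpCut_meas (d.hψ.comp measurable_snd) K (gpS_meas d.hφ)).sub (gpS_meas hφ')) (gpJ_meas h))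
    rw [gp_emp_lintegral h x _ hmm
      (fun i => if Function.Injective i then
        ENNReal.ofReal |gpCut ψ K φ (x ∘ i) - φ' (x ∘ i)| else 0),
      ENNReal.ofReal_mul (by positivity), ENNReal.ofReal_pow (by positivity),
      ENNReal.ofReal_inv_of_pos (by exact_mod_cast hn), ENNReal.ofReal_natCast,
      ENNReal.ofReal_sum_of_nonneg (fun i _ => abs_nonneg _), Finset.sum_filter]
    intro z
    by_cases hz : Function.Injective (fun a => τ (z a))
    · rw [indicator_of_mem (by exact hz), if_pos hz, ← ofReal_norm]
      rfl
    · rw [indicator_of_notMem (by exact hz), if_neg hz, enorm_zero]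
  rw [e1, e2] at h1
  have hs1 : 0 ≤ ∑ i, gpPsi ψ p δ K (x i) := Finset.sum_nonneg fun i _ => hΨ _
  have hs2 : 0 ≤ ∑ i ∈ Finset.univ.filter (fun i : Fin v → Fin n => Function.Injective i),
          |gpCut ψ K φ (x ∘ i) - φ' (x ∘ i)| := Finset.sum_nonneg fun i _ => abs_nonneg _
  have hc : 0 ≤ δ ^ (1 - p) * B ^ (p - 1) :=
    mul_nonneg (Real.rpow_nonneg hδ.le _) (Real.rpow_nonneg hB _)
  rw [← ENNReal.ofReal_mul (by positivity), ← ENNReal.ofReal_mul hc,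
    ← ENNReal.ofReal_add hδ.le (by positivity),
    ← ENNReal.ofReal_add (by positivity) (by positivity)] at h1
  rw [← ENNReal.ofReal_le_ofReal_iff (by positivity), ENNReal.ofReal_mul (by positivity)]
  refine h2.trans ?_
  gcongr
  exact h1

lemma gp_dyn_approx {X : Type*} [MeasurableSpace X] {μ : Measure X} [IsProbabilityMeasure μ]
    {v : ℕ} {E : Finset (Fin v × Fin v)} {D : ℕ} {p q : ℝ} {φ : (Fin v → X) → ℝ} {ψ : X → ℝ}
    (d : GpData μ E D p q φ ψ) {M L : ℝ} (hM : 1 ≤ M) (hL : 0 < L) {δ K : ℝ} (hδ : 0 < δ)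
    (hδL : 2 * L * M ^ E.card * v * δ ≤ 1) (hK0 : 0 ≤ K)
    (hK : ∫⁻ x, ENNReal.ofReal (Real.exp (gpPsi ψ p δ K x)) ∂μ ≤ ENNReal.ofReal (gpA μ ψ p 1 + 1)) :
    ∃ η : ℝ, 0 < η ∧ ∀ φ' : (Fin v → X) → ℝ, Measurable φ' → (∀ y, |φ' y| ≤ K ^ v) →
      ∫⁻ y, ‖gpCut ψ K φ y - φ' y‖ₑ ∂(Measure.pi fun _ => μ) ≤ ENNReal.ofReal η →
    ∀ (n : ℕ) (τ : ℝ → Fin n) (Q : Fin n → Fin n → ℝ), GpTau τ → GpKer unif01 (q * D) M (gpQ τ Q) →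
    ∫⁻ x, ENNReal.ofReal (Real.exp (n * (L * |gpU E φ Q x - gpU E φ' Q x|)))
      ∂(Measure.pi fun _ : Fin n => μ) ≤ ENNReal.ofReal (Real.exp 1 * (gpA μ ψ p 1 + 3)) ^ n := by
  have hv0 : (1:ℝ) ≤ v := by exact_mod_cast d.hv
  set B : ℝ := 2 * K ^ v with hBdef
  have hB : 0 ≤ B := by positivity
  set cc : ℝ := δ ^ (1 - p) * B ^ (p - 1) with hcc
  have hc : 0 ≤ cc := mul_nonneg (Real.rpow_nonneg hδ.le _) (Real.rpow_nonneg hB _)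
  set lam : ℝ := 2 * (L * M ^ E.card * cc * v) with hlam
  have hlam0 : 0 ≤ lam := by positivity
  have hA := gpA_one_le d (L := 1) zero_le_one
  refine ⟨(lam * Real.exp (lam * B) + 1)⁻¹, by positivity, ?_⟩
  intro φ' hφ' hφ'K hI n τ Q h hQ
  have hφB : ∀ y, |gpCut ψ K φ y - φ' y| ≤ B := fun y => by
    have h1 := gpCut_abs d.hψ0 hK0 d.hdom y
    have h2 := abs_sub (gpCut ψ K φ y) (φ' y)
    linarith [hφ'K y]
  have hn := h.pos
  have hn' : (0 : ℝ) < n := by exact_mod_cast hn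
  have hΨ := gpPsi_nonneg d.hψ0 p K hδ
  have hGm : Measurable (fun y => |gpCut ψ K φ y - φ' y|) :=
    ((gpCut_meas d.hψ K d.hφ).sub hφ').abs
  have hexp := gp_exp_lin (Measure.pi fun _ : Fin v => μ) (fun y => |gpCut ψ K φ y - φ' y|) hGm
    (fun _ => abs_nonneg _) B lam (lam * Real.exp (lam * B) + 1)⁻¹ hφB hlam0 (by
      rw [← div_eq_mul_inv, div_le_one (by positivity)]; linarith) (by
      simpa only [← ofReal_norm, Real.norm_eq_abs] using hI)
  have hinj := gp_dyn_inj μ d.hv hn _ hGm lam hexp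
  have hsum := gp_exp_sum_pi μ (n := n) (gpPsi ψ p δ K) (gpPsi_meas d.hψ p δ K)
  have hpt : ∀ x : Fin n → X,
      ENNReal.ofReal (Real.exp (n * (L * |gpU E φ Q x - gpU E φ' Q x|))) ≤
      ENNReal.ofReal (Real.exp n) * (ENNReal.ofReal (Real.exp (∑ i, gpPsi ψ p δ K (x i))) +
        ENNReal.ofReal (Real.exp (∑ i ∈ Finset.univ.filter
      (fun i : Fin v → Fin n => Function.Injective i),
        lam * |gpCut ψ K φ (x ∘ i) - φ' (x ∘ i)| / (v * n ^ (v - 1) : ℕ)))) := by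
    intro x
    have h0 := gp_dyn_pt d hM h hQ hδ hB φ' hφ' hφB x
    set s1 := ∑ i, gpPsi ψ p δ K (x i) with hs1d
    have hs1 : 0 ≤ s1 := Finset.sum_nonneg fun i _ => hΨ _
    rw [← Finset.sum_div, ← Finset.mul_sum]
    set s2 := ∑ i ∈ Finset.univ.filter (fun i : Fin v → Fin n => Function.Injective i),
          |gpCut ψ K φ (x ∘ i) - φ' (x ∘ i)| with hs2d
    have hs2 : 0 ≤ s2 := Finset.sum_nonneg fun i _ => abs_nonneg _
    rw [← ENNReal.ofReal_add (by positivity) (by positivity), ← ENNReal.ofReal_mul (by positivity)]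
    apply ENNReal.ofReal_le_ofReal
    have key : n * (L * |gpU E φ Q x - gpU E φ' Q x|) ≤
        n + (s1 / 2 + (lam * s2 / (v * n ^ (v - 1) : ℕ)) / 2) := by
      have hpow : (n : ℝ) ^ v = n * n ^ (v - 1) := by
        rw [← pow_succ']; congr 1; have := d.hv; omega
      calc n * (L * |gpU E φ Q x - gpU E φ' Q x|)
          ≤ n * (L * (M ^ E.card * (v * δ * ((n : ℝ)⁻¹ * s1) + (δ + cc * (((n : ℝ)⁻¹) ^ v * s2))))) := by
            gcongr
        _ = n * (L * M ^ E.card * δ) + ((2 * L * M ^ E.card * v * δ) * s1 / 2 +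
              (lam * s2 / (v * n ^ (v - 1) : ℕ)) / 2) := by
            rw [inv_pow, hpow, hlam]; push_cast; field_simp; ring
        _ ≤ n * 1 + (1 * s1 / 2 + (lam * s2 / (v * n ^ (v - 1) : ℕ)) / 2) := by
            gcongr
            have : 0 ≤ L * M ^ E.card * δ := by positivity
            nlinarith
        _ = _ := by ring
    refine (Real.exp_le_exp.2 key).trans ?_
    rw [Real.exp_add]
    gcongr
    rw [Real.exp_add]
    set a := Real.exp (s1 / 2) with ha
    set b := Real.exp ((lam * s2 / (v * n ^ (v - 1) : ℕ)) / 2) with hb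
    have h1 : Real.exp s1 = a * a := by rw [ha, ← Real.exp_add]; ring_nf
    have h2 : Real.exp (lam * s2 / (v * n ^ (v - 1) : ℕ)) = b * b := by
      rw [hb, ← Real.exp_add]; ring_nf
    rw [h1, h2]
    nlinarith [sq_nonneg (a - b), mul_self_nonneg a, mul_self_nonneg b]
  have hm1 : Measurable fun x : Fin n → X => ENNReal.ofReal (Real.exp (∑ i, gpPsi ψ p δ K (x i))) :=
    (Real.measurable_exp.comp (Finset.measurable_sum _ fun i _ =>
      (gpPsi_meas d.hψ p δ K).comp (measurable_pi_apply i))).ennreal_ofReal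
  refine (lintegral_mono hpt).trans ?_
  rw [lintegral_const_mul' _ _ ENNReal.ofReal_ne_top, lintegral_add_left hm1, hsum]
  calc _ ≤ ENNReal.ofReal (Real.exp n) * (ENNReal.ofReal (gpA μ ψ p 1 + 1) ^ n + 2 ^ n) := by
        gcongr
    _ = ENNReal.ofReal (Real.exp 1) ^ n * (ENNReal.ofReal (gpA μ ψ p 1 + 1) ^ n + 2 ^ n) := by
        rw [← ENNReal.ofReal_pow (p := Real.exp 1) (by positivity), ← Real.exp_nat_mul, mul_one]
    _ ≤ ENNReal.ofReal (Real.exp 1) ^ n * (ENNReal.ofReal (gpA μ ψ p 1 + 1) + 2) ^ n := by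
        gcongr
        exact pow_add_pow_le (by positivity) (by positivity) hn.ne'
    _ = _ := by
        rw [← mul_pow, show (2:ℝ≥0∞) = ENNReal.ofReal 2 by simp, ← ENNReal.ofReal_add (by positivity) (by positivity),
          ← ENNReal.ofReal_mul (by positivity)]
        ring_nf

lemma gp_exp_intg {α : Type*} [MeasurableSpace α] {P : Measure α} {F H : α → ℝ}
    (hF : Measurable F) {c : ℝ≥0∞} (hc : c ≠ ⊤)
    (hH : ∫⁻ x, ENNReal.ofReal (Real.exp (H x)) ∂P ≤ c) (hFH : ∀ x, F x ≤ H x) :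
    Integrable (fun x => Real.exp (F x)) P := by
  refine ⟨(Real.measurable_exp.comp hF).aestronglyMeasurable, ?_⟩
  rw [hasFiniteIntegral_iff_ofReal (Eventually.of_forall fun x => (Real.exp_pos _).le)]
  exact lt_of_le_of_lt ((lintegral_mono fun x => ENNReal.ofReal_le_ofReal
    (Real.exp_le_exp.2 (hFH x))).trans hH) hc.lt_top

lemma gp_exp_int_le {α : Type*} [MeasurableSpace α] {P : Measure α} {F H : α → ℝ}
    (hF : Measurable F) {c : ℝ} (hc : 0 ≤ c)
    (hH : ∫⁻ x, ENNReal.ofReal (Real.exp (H x)) ∂P ≤ ENNReal.ofReal c) (hFH : ∀ x, F x ≤ H x) :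
    ∫ x, Real.exp (F x) ∂P ≤ c := by
  rw [integral_eq_lintegral_of_nonneg_ae (Eventually.of_forall fun x => (Real.exp_pos _).le)
    (Real.measurable_exp.comp hF).aestronglyMeasurable]
  refine ENNReal.toReal_le_of_le_ofReal hc (le_trans ?_ hH)
  exact lintegral_mono fun x => ENNReal.ofReal_le_ofReal (Real.exp_le_exp.2 (hFH x))

lemma gp_log_pert {α : Type*} [MeasurableSpace α] {P : Measure α} [IsProbabilityMeasure P]
    {F G : α → ℝ} (hF : Measurable F) (hG : Measurable G) {t C : ℝ} {n : ℕ} (ht : 0 < t)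
    (ht1 : t ≤ 1) (hC : 2 ≤ C) (hn : 0 < n)
    (hFi : ∫⁻ x, ENNReal.ofReal (Real.exp (2 * |F x|)) ∂P ≤ ENNReal.ofReal (C ^ n))
    (hGi : ∫⁻ x, ENNReal.ofReal (Real.exp (2 * (|G x| / t))) ∂P ≤ ENNReal.ofReal (C ^ n)) :
    Integrable (fun x => Real.exp (F x + G x)) P ∧
    Real.log (∫ x, Real.exp (F x + G x) ∂P) ≤
      Real.log (∫ x, Real.exp (F x) ∂P) + 3 * t * n * Real.log C := by
  have hC0 : 0 < C := by linarith
  have hm : Measurable fun x => F x + G x := hF.add hG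
  have hmt : Measurable fun x => F x + G x / t := hF.add (hG.div_const t)
  have i1 : Integrable (fun x => Real.exp (F x)) P :=
    gp_exp_intg hF ENNReal.ofReal_ne_top hFi fun x => by
      linarith [le_abs_self (F x), abs_nonneg (F x)]
  have i1' : Integrable (fun x => Real.exp (- F x)) P :=
    gp_exp_intg hF.neg ENNReal.ofReal_ne_top hFi fun x => by
      linarith [neg_le_abs (F x), abs_nonneg (F x)]
  have i2 : Integrable (fun x => Real.exp (2 * |F x|)) P :=
    gp_exp_intg (hF.abs.const_mul 2) ENNReal.ofReal_ne_top hFi fun x => le_rfl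
  have i3 : Integrable (fun x => Real.exp (2 * (|G x| / t))) P :=
    gp_exp_intg ((hG.abs.div_const t).const_mul 2) ENNReal.ofReal_ne_top hGi fun x => le_rfl
  have b1 : ∫ x, Real.exp (- F x) ∂P ≤ C ^ n :=
    gp_exp_int_le hF.neg (by positivity) hFi fun x => by
      simp only [Pi.neg_apply]
      linarith [neg_le_abs (F x), abs_nonneg (F x)]
  have b2 : ∫ x, Real.exp (2 * |F x|) ∂P ≤ C ^ n :=
    gp_exp_int_le (hF.abs.const_mul 2) (by positivity) hFi fun x => le_rfl
  have b3 : ∫ x, Real.exp (2 * (|G x| / t)) ∂P ≤ C ^ n :=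
    gp_exp_int_le ((hG.abs.div_const t).const_mul 2) (by positivity) hGi fun x => le_rfl
  have hcs : ∀ a b : ℝ, Real.exp (a + b) ≤ Real.exp (2 * |a|) + Real.exp (2 * |b|) := by
    intro a b
    rcases le_total |a| |b| with hab | hab
    · have : a + b ≤ 2 * |b| := by linarith [le_abs_self a, le_abs_self b]
      linarith [Real.exp_le_exp.2 this, Real.exp_pos (2 * |a|)]
    · have : a + b ≤ 2 * |a| := by linarith [le_abs_self a, le_abs_self b]
      linarith [Real.exp_le_exp.2 this, Real.exp_pos (2 * |b|)]
  have hpt : ∀ x, Real.exp (F x + G x / t) ≤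
      Real.exp (2 * |F x|) + Real.exp (2 * (|G x| / t)) := fun x => by
    have := hcs (F x) (G x / t)
    rwa [abs_div, abs_of_pos ht] at this
  have i4 : Integrable (fun x => Real.exp (F x + G x / t)) P := by
    refine (i2.add i3).mono' (Real.measurable_exp.comp hmt).aestronglyMeasurable
      (Eventually.of_forall fun x => ?_)
    rw [Real.norm_eq_abs, abs_of_pos (Real.exp_pos _)]
    exact hpt x
  set A := ∫ x, Real.exp (F x) ∂P with hA
  set B := ∫ x, Real.exp (F x + G x / t) ∂P with hB
  have hA0 : 0 < A := integral_exp_pos i1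
  have hB0 : 0 < B := integral_exp_pos i4
  have hBle : B ≤ 2 * C ^ n := by
    have := integral_mono i4 (i2.add i3) hpt
    simp only [Pi.add_apply] at this
    rw [integral_add i2 i3] at this
    linarith
  have hJ0 : 0 < ∫ x, Real.exp (- F x) ∂P := integral_exp_pos i1'
  have hAge : 1 ≤ (∫ x, Real.exp (- F x) ∂P) * A := by
    set J := ∫ x, Real.exp (- F x) ∂P with hJ
    have h1 : ∫ x, (2 : ℝ) ∂P ≤ ∫ x, (J * Real.exp (F x) + J⁻¹ * Real.exp (- F x)) ∂P := by
      refine integral_mono (integrable_const _) ((i1.const_mul J).add (i1'.const_mul _)) fun x => ?_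
      simp only
      have e : Real.exp (- F x) = (Real.exp (F x))⁻¹ := Real.exp_neg _
      rw [e]
      have hy : 0 < J * Real.exp (F x) := by positivity
      rw [← mul_inv]
      set y := J * Real.exp (F x)
      have : y + y⁻¹ - 2 = (y - 1) ^ 2 * y⁻¹ := by field_simp; ring
      have h2 : 0 ≤ (y - 1) ^ 2 * y⁻¹ := by positivity
      linarith
    rw [integral_add (i1.const_mul J) (i1'.const_mul _), integral_const_mul, integral_const_mul,
      ← hJ, inv_mul_cancel₀ hJ0.ne'] at h1
    simp at h1
    linarith
  have hlogA : -(n * Real.log C) ≤ Real.log A := by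
    have h1 : 1 ≤ C ^ n * A := hAge.trans (by gcongr)
    have h2 := Real.log_le_log one_pos h1
    rw [Real.log_one, Real.log_mul (by positivity) hA0.ne', Real.log_pow] at h2
    linarith
  have hlogB : Real.log B ≤ 2 * (n * Real.log C) := by
    have h1 : B ≤ C ^ n * C ^ n := hBle.trans (by
      gcongr
      calc (2:ℝ) ≤ C := hC
        _ ≤ C ^ n := le_self_pow₀ (by linarith) hn.ne')
    have h2 := Real.log_le_log hB0 h1
    rw [Real.log_mul (by positivity) (by positivity), Real.log_pow] at h2
    linarith
  have hconv : ∀ x, Real.exp (F x + G x) ≤ Real.exp ((1 - t) * Real.log A + t * Real.log B) *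
      ((1 - t) * (A⁻¹ * Real.exp (F x)) + t * (B⁻¹ * Real.exp (F x + G x / t))) := by
    intro x
    have h1 := convexOn_exp.2 (mem_univ (F x - Real.log A)) (mem_univ (F x + G x / t - Real.log B))
      (by linarith : 0 ≤ 1 - t) ht.le (by ring)
    simp only [smul_eq_mul] at h1
    have e1 : F x + G x = ((1 - t) * Real.log A + t * Real.log B) +
        ((1 - t) * (F x - Real.log A) + t * (F x + G x / t - Real.log B)) := by
      field_simp; ring
    rw [e1, Real.exp_add]
    gcongr
    refine h1.trans (le_of_eq ?_)
    rw [Real.exp_sub, Real.exp_sub, Real.exp_log hA0, Real.exp_log hB0]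
    field_simp
  have i5 : Integrable (fun x => Real.exp ((1 - t) * Real.log A + t * Real.log B) *
      ((1 - t) * (A⁻¹ * Real.exp (F x)) + t * (B⁻¹ * Real.exp (F x + G x / t)))) P :=
    (((i1.const_mul _).const_mul _).add ((i4.const_mul _).const_mul _)).const_mul _
  have i6 : Integrable (fun x => Real.exp (F x + G x)) P := by
    refine i5.mono' (Real.measurable_exp.comp hm).aestronglyMeasurable
      (Eventually.of_forall fun x => ?_)
    rw [Real.norm_eq_abs, abs_of_pos (Real.exp_pos _)]
    exact hconv x
  refine ⟨i6, ?_⟩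
  have hfin := integral_mono i6 i5 hconv
  rw [integral_const_mul, integral_add ((i1.const_mul _).const_mul _) ((i4.const_mul _).const_mul _),
    integral_const_mul, integral_const_mul, integral_const_mul, integral_const_mul,
    inv_mul_cancel₀ hA0.ne', inv_mul_cancel₀ hB0.ne'] at hfin
  have h7 := Real.log_le_log (integral_exp_pos i6) hfin
  rw [show (1 - t) * 1 + t * 1 = (1:ℝ) by ring, mul_one, Real.log_exp] at h7
  nlinarith

lemma gp_log_pert2 {α : Type*} [MeasurableSpace α] {P : Measure α} [IsProbabilityMeasure P]
    {F G : α → ℝ} (hF : Measurable F) (hG : Measurable G) {t C : ℝ} {n : ℕ} (ht : 0 < t)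
    (ht1 : t ≤ 1) (hC : 2 ≤ C) (hn : 0 < n)
    (hFi : ∫⁻ x, ENNReal.ofReal (Real.exp (4 * |F x|)) ∂P ≤ ENNReal.ofReal (C ^ n))
    (hGi : ∫⁻ x, ENNReal.ofReal (Real.exp (4 * (|G x - F x| / t))) ∂P ≤ ENNReal.ofReal (C ^ n)) :
    |Real.log (∫ x, Real.exp (G x) ∂P) - Real.log (∫ x, Real.exp (F x) ∂P)| ≤
      6 * t * n * Real.log C := by
  have hC0 : 0 < C := by linarith
  have hlog : 0 ≤ Real.log C := Real.log_nonneg (by linarith)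
  have hFi2 : ∫⁻ x, ENNReal.ofReal (Real.exp (2 * |F x|)) ∂P ≤ ENNReal.ofReal (C ^ n) :=
    (lintegral_mono fun x => ENNReal.ofReal_le_ofReal (Real.exp_le_exp.2
      (by linarith [abs_nonneg (F x)]))).trans hFi
  have hGi2 : ∫⁻ x, ENNReal.ofReal (Real.exp (2 * (|G x - F x| / t))) ∂P ≤ ENNReal.ofReal (C ^ n) :=
    (lintegral_mono fun x => ENNReal.ofReal_le_ofReal (Real.exp_le_exp.2 (by
      have : 0 ≤ |G x - F x| / t := by positivity
      linarith))).trans hGi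
  have hCC : C ^ n ≤ (C ^ 2) ^ n := by
    gcongr; nlinarith
  have h1 := (gp_log_pert hF (hG.sub hF) ht ht1 hC hn hFi2 hGi2).2
  have hGG : ∫⁻ x, ENNReal.ofReal (Real.exp (2 * |G x|)) ∂P ≤ ENNReal.ofReal ((C ^ 2) ^ n) := by
    have hb : ∀ x, ENNReal.ofReal (Real.exp (2 * |G x|)) ≤ ENNReal.ofReal (Real.exp (4 * |F x|)) +
        ENNReal.ofReal (Real.exp (4 * (|G x - F x| / t))) := by
      intro x
      rw [← ENNReal.ofReal_add (by positivity) (by positivity)]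
      apply ENNReal.ofReal_le_ofReal
      have h2 : |G x| ≤ |F x| + |G x - F x| := by
        have := abs_add_le (F x) (G x - F x); simpa using this
      have h3 : |G x - F x| ≤ |G x - F x| / t := by
        rw [le_div_iff₀ ht]; nlinarith [abs_nonneg (G x - F x)]
      rcases le_total |F x| (|G x - F x| / t) with hab | hab
      · have : 2 * |G x| ≤ 4 * (|G x - F x| / t) := by linarith
        linarith [Real.exp_le_exp.2 this, Real.exp_pos (4 * |F x|)]
      · have : 2 * |G x| ≤ 4 * |F x| := by linarith
        linarith [Real.exp_le_exp.2 this, Real.exp_pos (4 * (|G x - F x| / t))]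
    refine (lintegral_mono hb).trans ?_
    have hm4 : Measurable fun x => ENNReal.ofReal (Real.exp (4 * |F x|)) :=
      (Real.measurable_exp.comp (hF.abs.const_mul 4)).ennreal_ofReal
    rw [lintegral_add_left hm4]
    refine (add_le_add hFi hGi).trans ?_
    rw [← ENNReal.ofReal_add (by positivity) (by positivity)]
    apply ENNReal.ofReal_le_ofReal
    have h2 : (2:ℝ) ≤ C ^ n := by
      calc (2:ℝ) ≤ C := hC
        _ ≤ C ^ n := le_self_pow₀ (by linarith) hn.ne'
    rw [← pow_mul, mul_comm 2 n, pow_mul]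
    nlinarith
  have hGi3 : ∫⁻ x, ENNReal.ofReal (Real.exp (2 * (|F x - G x| / t))) ∂P ≤
      ENNReal.ofReal ((C ^ 2) ^ n) := by
    simp only [abs_sub_comm (F _)]
    exact hGi2.trans (ENNReal.ofReal_le_ofReal hCC)
  have h2 := (gp_log_pert hG (hF.sub hG) ht ht1 (by nlinarith : 2 ≤ C ^ 2) hn hGG hGi3).2
  simp only [Pi.sub_apply, add_sub_cancel, Real.log_pow] at h1 h2
  push_cast at h2
  have : 0 ≤ t * n * Real.log C := by positivity
  rw [abs_le]
  constructor <;> nlinarith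

lemma gp_density {α : Type*} [MeasurableSpace α] (Q μ : Measure α) [IsFiniteMeasure Q]
    [IsProbabilityMeasure μ] {c : ℝ} (hc : 0 ≤ c) (hQ : ∀ s, MeasurableSet s → Q s ≤ ENNReal.ofReal c * μ s) :
    ∃ g : α → ℝ, Measurable g ∧ (∀ x, 0 ≤ g x) ∧ (∀ x, g x ≤ c) ∧
      Q = μ.withDensity (fun x => ENNReal.ofReal (g x)) := by
  have hac : Q ≪ μ := by
    refine Measure.AbsolutelyContinuous.mk fun s hs h0 => ?_
    have := hQ s hs
    rw [h0, mul_zero] at this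
    exact le_antisymm this bot_le
  have hm := Measure.measurable_rnDeriv Q μ
  have heq := Measure.withDensity_rnDeriv_eq Q μ hac
  have hle : Q.rnDeriv μ ≤ᵐ[μ] fun _ => ENNReal.ofReal c := by
    refine ae_le_of_forall_setLIntegral_le_of_sigmaFinite hm fun s hs _ => ?_
    rw [setLIntegral_const, ← withDensity_apply _ hs, heq]
    exact hQ s hs
  refine ⟨fun x => min (Q.rnDeriv μ x).toReal c, hm.ennreal_toReal.min measurable_const,
    fun x => le_min ENNReal.toReal_nonneg hc, fun x => min_le_right _ _, ?_⟩
  conv_lhs => rw [← heq]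
  refine withDensity_congr_ae ?_
  filter_upwards [hle] with x hx
  rw [min_eq_left (ENNReal.toReal_le_of_le_ofReal hc hx),
    ENNReal.ofReal_toReal (ne_top_of_le_ne_top ENNReal.ofReal_ne_top hx)]

lemma gp_mul_log_bdd {c : ℝ} (hc : 1 ≤ c) {x : ℝ} (hx : 0 ≤ x) (hxc : x ≤ c) :
    |x * Real.log x| ≤ c * c := by
  rcases eq_or_lt_of_le hx with h0 | h0
  · rw [← h0]; simp; nlinarith
  · rw [abs_le]
    constructor
    · have := Real.one_sub_inv_le_log_of_pos h0
      have h2 : x * (1 - x⁻¹) ≤ x * Real.log x := by gcongr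
      have : x * (1 - x⁻¹) = x - 1 := by field_simp
      nlinarith
    · have := Real.log_le_sub_one_of_pos h0
      nlinarith

lemma gp_mul_log_intg {α : Type*} [MeasurableSpace α] (μ : Measure α) [IsProbabilityMeasure μ]
    {c : ℝ} (hc : 1 ≤ c) {g : α → ℝ} (hg : Measurable g) (h0 : ∀ x, 0 ≤ g x) (h1 : ∀ x, g x ≤ c) :
    Integrable (fun x => g x * Real.log (g x)) μ :=
  Integrable.of_bound (hg.mul (Real.measurable_log.comp hg)).aestronglyMeasurable (c * c)
    (Eventually.of_forall fun x => gp_mul_log_bdd hc (h0 x) (h1 x))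

lemma gp_kl_density {α : Type*} [MeasurableSpace α] (ρ : Measure α) [IsProbabilityMeasure ρ]
    {c : ℝ} (hc : 1 ≤ c) {g : α → ℝ} (hg : Measurable g) (h0 : ∀ x, 0 ≤ g x) (h1 : ∀ x, g x ≤ c)
    (hp : IsProbabilityMeasure (ρ.withDensity fun x => ENNReal.ofReal (g x))) :
    InformationTheory.klDiv (ρ.withDensity fun x => ENNReal.ofReal (g x)) ρ ≠ ⊤ ∧
    (InformationTheory.klDiv (ρ.withDensity fun x => ENNReal.ofReal (g x)) ρ).toReal =
      ∫ x, g x * Real.log (g x) ∂ρ := by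
  set ν := ρ.withDensity fun x => ENNReal.ofReal (g x) with hν
  have hac : ν ≪ ρ := withDensity_absolutelyContinuous _ _
  have hrn : ν.rnDeriv ρ =ᵐ[ρ] fun x => ENNReal.ofReal (g x) :=
    Measure.rnDeriv_withDensity ρ hg.ennreal_ofReal
  have hrn' : (fun x => InformationTheory.klFun (ν.rnDeriv ρ x).toReal) =ᵐ[ρ]
      fun x => g x * Real.log (g x) + 1 - g x := by
    filter_upwards [hrn] with x hx
    rw [hx, ENNReal.toReal_ofReal (h0 x), InformationTheory.klFun_apply]
  have ig : Integrable g ρ := Integrable.of_bound hg.aestronglyMeasurable c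
    (Eventually.of_forall fun x => by rw [Real.norm_eq_abs, abs_of_nonneg (h0 x)]; exact h1 x)
  have il := gp_mul_log_intg ρ hc hg h0 h1
  have i2 : Integrable (fun x => g x * Real.log (g x) + 1) ρ := il.add (integrable_const 1)
  have hIntegr : ∫ x, g x ∂ρ = 1 := by
    rw [integral_eq_lintegral_of_nonneg_ae (Eventually.of_forall h0) hg.aestronglyMeasurable]
    have := hp.measure_univ
    rw [hν, withDensity_apply _ MeasurableSet.univ, setLIntegral_univ] at this
    rw [this]; simp
  constructor
  · rw [InformationTheory.klDiv_ne_top_iff]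
    refine ⟨hac, ?_⟩
    rw [← InformationTheory.integrable_klFun_rnDeriv_iff hac]
    exact (i2.sub ig).congr hrn'.symm
  · rw [InformationTheory.toReal_klDiv_eq_integral_klFun hac, integral_congr_ae hrn',
      integral_sub i2 ig, integral_add il (integrable_const 1), hIntegr]
    simp

lemma gp_subadd {X : Type*} [MeasurableSpace X] (μ : Measure X) [IsProbabilityMeasure μ] {n : ℕ}
    (P : Measure (Fin n → X)) [IsProbabilityMeasure P] {c : ℝ} (hc : 1 ≤ c)
    (hP : P ≤ ENNReal.ofReal c • Measure.pi fun _ => μ)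
    (g : Fin n → X → ℝ) (hg : ∀ i, Measurable (g i)) (h0 : ∀ i x, 0 ≤ g i x)
    (h1 : ∀ i x, g i x ≤ c)
    (hgP : ∀ i, P.map (fun x => x i) = μ.withDensity (fun x => ENNReal.ofReal (g i x))) :
    ∑ i, ∫ x, g i x * Real.log (g i x) ∂μ ≤ Real.log c := by
  have hc0 : 0 < c := by linarith
  have hpm : ∀ i, IsProbabilityMeasure (μ.withDensity (fun x => ENNReal.ofReal (g i x))) := by
    intro i
    rw [← hgP i]
    exact Measure.isProbabilityMeasure_map (measurable_pi_apply i).aemeasurable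
  have hll : ∀ i, Measurable fun x => Real.log (g i x) := fun i => Real.measurable_log.comp (hg i)
  have hI : ∀ i, ∫ x, g i x * Real.log (g i x) ∂μ = ∫ x, Real.log (g i (x i)) ∂P := by
    intro i
    have h2 : ∫ x, Real.log (g i (x i)) ∂P = ∫ y, Real.log (g i y) ∂(P.map fun x => x i) := by
      rw [integral_map (measurable_pi_apply i).aemeasurable (hll i).aestronglyMeasurable]
    rw [h2, hgP i, integral_withDensity_eq_integral_toReal_smul (hg i).ennreal_ofReal
      (Eventually.of_forall fun x => ENNReal.ofReal_lt_top)]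
    simp only [ENNReal.toReal_ofReal (h0 i _), smul_eq_mul]
  have hIi : ∀ i, Integrable (fun x : Fin n → X => Real.log (g i (x i))) P := by
    intro i
    have h2 : Integrable (fun y => Real.log (g i y)) (P.map fun x => x i) := by
      rw [hgP i, integrable_withDensity_iff_integrable_smul' (hg i).ennreal_ofReal
        (Eventually.of_forall fun x => ENNReal.ofReal_lt_top)]
      simp only [ENNReal.toReal_ofReal (h0 i _), smul_eq_mul]
      exact gp_mul_log_intg μ hc (hg i) (h0 i) (h1 i)
    exact (integrable_map_measure (hll i).aestronglyMeasurable
      (measurable_pi_apply i).aemeasurable).1 h2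
  have hpos : ∀ᵐ x ∂P, ∀ i, 0 < g i (x i) := by
    rw [ae_all_iff]
    intro i
    have h2 : ∀ᵐ y ∂(P.map fun x => x i), 0 < g i y := by
      rw [hgP i, ae_withDensity_iff (hg i).ennreal_ofReal]
      exact Eventually.of_forall fun x hx => by simpa using hx
    exact ae_of_ae_map (measurable_pi_apply i).aemeasurable h2
  have hprodm : Measurable fun x : Fin n → X => ∏ i, g i (x i) :=
    Finset.measurable_prod _ fun i _ => (hg i).comp (measurable_pi_apply i)
  have hprod0 : ∀ x : Fin n → X, 0 ≤ ∏ i, g i (x i) := fun x =>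
    Finset.prod_nonneg fun i _ => h0 _ _
  have hprodi : Integrable (fun x : Fin n → X => ∏ i, g i (x i)) P :=
    Integrable.of_bound hprodm.aestronglyMeasurable (∏ i : Fin n, c)
      (Eventually.of_forall fun x => by
        rw [Real.norm_eq_abs, abs_of_nonneg (hprod0 x)]
        exact Finset.prod_le_prod (fun i _ => h0 _ _) fun i _ => h1 _ _)
  have hprodle : ∫ x, ∏ i, g i (x i) ∂P ≤ c := by
    rw [integral_eq_lintegral_of_nonneg_ae (Eventually.of_forall hprod0)
      hprodm.aestronglyMeasurable]
    refine ENNReal.toReal_le_of_le_ofReal hc0.le ?_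
    refine (lintegral_mono' hP le_rfl).trans ?_
    rw [lintegral_smul_measure]
    simp only [ENNReal.ofReal_prod_of_nonneg fun i _ => h0 i _]
    rw [gp_lintegral_pi_prod (fun _ : Fin n => μ) (fun i y => ENNReal.ofReal (g i y))
      (fun i => (hg i).ennreal_ofReal)]
    rw [Finset.prod_eq_one, smul_eq_mul, mul_one]
    intro i _
    have := (hpm i).measure_univ
    rwa [withDensity_apply _ MeasurableSet.univ, setLIntegral_univ] at this
  simp only [hI]
  rw [← integral_finsetSum _ fun i _ => hIi i]
  calc ∫ x, ∑ i, Real.log (g i (x i)) ∂P ≤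
        ∫ x, (c⁻¹ * ∏ i, g i (x i) + (Real.log c - 1)) ∂P := by
        refine integral_mono_ae (integrable_finsetSum _ fun i _ => hIi i)
          ((hprodi.const_mul _).add (integrable_const _)) ?_
        filter_upwards [hpos] with x hx
        have h3 : 0 < ∏ i, g i (x i) := Finset.prod_pos fun i _ => hx i
        rw [← Real.log_prod fun i _ => (hx i).ne']
        have h4 := Real.log_le_sub_one_of_pos (mul_pos (inv_pos.2 hc0) h3)
        rw [Real.log_mul (inv_pos.2 hc0).ne' h3.ne', Real.log_inv] at h4
        linarith
    _ = c⁻¹ * ∫ x, ∏ i, g i (x i) ∂P + (Real.log c - 1) := by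
        rw [integral_add (hprodi.const_mul _) (integrable_const _), integral_const_mul]
        simp
    _ ≤ c⁻¹ * c + (Real.log c - 1) := by gcongr
    _ = Real.log c := by rw [inv_mul_cancel₀ hc0.ne']; ring

lemma gp_unif_lint {n : ℕ} {τ : ℝ → Fin n} (h : GpTau τ) (Φ : Fin n → ℝ≥0∞) :
    ∫⁻ a, Φ (τ a) ∂unif01 = (n : ℝ≥0∞)⁻¹ * ∑ i, Φ i := by
  have : ∫⁻ a, Φ (τ a) ∂unif01 = ∫⁻ i, Φ i ∂(unif01.map τ) := by
    rw [lintegral_map (measurable_of_countable _) h.meas]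
  rw [this, lintegral_fintype]
  simp only [gp_unif_map h, Finset.mul_sum]
  exact Finset.sum_congr rfl fun i _ => mul_comm _ _

lemma gp_unif_int {n : ℕ} {τ : ℝ → Fin n} (h : GpTau τ) (Φ : Fin n → ℝ) :
    ∫ a, Φ (τ a) ∂unif01 = (n : ℝ)⁻¹ * ∑ i, Φ i := by
  have hprob : IsProbabilityMeasure (unif01.map τ) :=
    Measure.isProbabilityMeasure_map h.meas.aemeasurable
  have : ∫ a, Φ (τ a) ∂unif01 = ∫ i, Φ i ∂(unif01.map τ) := by
    rw [integral_map h.meas.aemeasurable (measurable_of_countable _).aestronglyMeasurable]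
  rw [this, integral_fintype (Integrable.of_finite)]
  simp only [Measure.real, gp_unif_map h, Finset.mul_sum]
  simp

lemma gp_emp_meas {X : Type*} [MeasurableSpace X] {n : ℕ} {τ : ℝ → Fin n} (h : GpTau τ)
    {s : Set (ℝ × X)} (hs : MeasurableSet s) :
    Measurable (fun y : Fin n → X => (gpEmp τ y) s) := by
  have hev : Measurable (fun z : (Fin n → X) × ℝ => z.1 (τ z.2)) := by
    have h1 : Measurable (fun z : (Fin n → X) × Fin n => z.1 z.2) :=
      measurable_from_prod_countable_left fun i => measurable_pi_apply i
    exact h1.comp (measurable_fst.prodMk (h.meas.comp measurable_snd))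
  have hS : MeasurableSet {z : (Fin n → X) × ℝ | (z.2, z.1 (τ z.2)) ∈ s} :=
    (measurable_snd.prodMk hev) hs
  have h2 := measurable_measure_prodMk_left (ν := unif01) hS
  convert h2 using 2 with y
  rw [gpEmp, Measure.map_apply (gpEmp_meas_aux h y) hs]
  rfl

lemma gp_cell {X J : Type*} [MeasurableSpace X] [MeasurableSpace J] [MeasurableSingletonClass J]
    (μ : Measure X) [IsProbabilityMeasure μ]
    {e : ℝ × X → J} (he : Measurable e) {n : ℕ} {τ : ℝ → Fin n} (h : GpTau τ)
    (B : Set (Fin n → X)) (hB : MeasurableSet B) (hB0 : (Measure.pi fun _ : Fin n => μ) B ≠ 0)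
    {δ : ℝ} (hδ : ∀ x ∈ B, ∀ y ∈ B, ∀ j,
      |(gpEmp τ x).real (e ⁻¹' {j}) - (gpEmp τ y).real (e ⁻¹' {j})| ≤ δ) :
    ∃ ν : Measure (ℝ × X), inTM ν ∧ InformationTheory.klDiv ν (unif01.prod μ) ≠ ⊤ ∧
      n * (InformationTheory.klDiv ν (unif01.prod μ)).toReal ≤
        - Real.log ((Measure.pi fun _ : Fin n => μ).real B) ∧
      ∀ x ∈ B, ∀ j, |(gpEmp τ x).real (e ⁻¹' {j}) - ν.real (e ⁻¹' {j})| ≤ δ := by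
  classical
  set Pn := Measure.pi fun _ : Fin n => μ with hPn
  have hn := h.pos
  have hn' : (0:ℝ) < n := by exact_mod_cast hn
  set m := Pn.real B with hm
  have hm0 : 0 < m := ENNReal.toReal_pos hB0 (measure_ne_top _ _)
  have hm1 : m ≤ 1 := measureReal_le_one
  have hmE : Pn B = ENNReal.ofReal m := (ENNReal.ofReal_toReal (measure_ne_top _ _)).symm
  set c := m⁻¹ with hc
  have hc1 : 1 ≤ c := (one_le_inv₀ hm0).2 hm1
  have hc0 : 0 ≤ c := by linarith
  set P : Measure (Fin n → X) := ENNReal.ofReal c • Pn.restrict B with hP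
  have hPprob : IsProbabilityMeasure P := ⟨by
    rw [hP, Measure.smul_apply, Measure.restrict_apply_univ, hmE, smul_eq_mul,
      ← ENNReal.ofReal_mul hc0, hc, inv_mul_cancel₀ hm0.ne', ENNReal.ofReal_one]⟩
  have hPle : P ≤ ENNReal.ofReal c • Pn := by
    rw [hP]
    refine Measure.le_iff.2 fun s hs => ?_
    rw [Measure.smul_apply, Measure.smul_apply]
    gcongr
    exact Measure.restrict_le_self
  have hPB : ∀ᵐ x ∂P, x ∈ B := by
    rw [hP]
    exact Measure.ae_smul_measure (ae_restrict_mem hB) _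
  have hd : ∀ i, ∃ g : X → ℝ, Measurable g ∧ (∀ x, 0 ≤ g x) ∧ (∀ x, g x ≤ c) ∧
      P.map (fun x => x i) = μ.withDensity (fun x => ENNReal.ofReal (g x)) := by
    intro i
    have : IsProbabilityMeasure (P.map (fun x => x i)) :=
      Measure.isProbabilityMeasure_map (measurable_pi_apply i).aemeasurable
    refine gp_density _ μ hc0 fun s hs => ?_
    rw [Measure.map_apply (measurable_pi_apply i) hs]
    refine (hPle _).trans (le_of_eq ?_)
    rw [Measure.smul_apply, smul_eq_mul, (measurePreserving_eval (fun _ : Fin n => μ) i).measure_preimage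
      hs.nullMeasurableSet]
  choose g hgm hg0 hgc hgP using hd
  have hgm2 : Measurable fun z : ℝ × X => g (τ z.1) z.2 := by
    have h1 : Measurable (fun z : Fin n × X => g z.1 z.2) := measurable_from_prod_countable_right hgm
    exact h1.comp ((h.meas.comp measurable_fst).prodMk measurable_snd)
  set ν := (unif01.prod μ).withDensity (fun z => ENNReal.ofReal (g (τ z.1) z.2)) with hν
  -- formula for the mass of a measurable set
  have hmass : ∀ s : Set (ℝ × X), MeasurableSet s →
      ν s = ∫⁻ x, (gpEmp τ x) s ∂P := by
    intro s hs
    have hev : Measurable (fun z : ℝ × (Fin n → X) => z.2 (τ z.1)) := by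
      have h1 : Measurable (fun z : Fin n × (Fin n → X) => z.2 z.1) :=
        measurable_from_prod_countable_right fun i => measurable_pi_apply i
      exact h1.comp ((h.meas.comp measurable_fst).prodMk measurable_snd)
    have hS : MeasurableSet {z : ℝ × (Fin n → X) | (z.1, z.2 (τ z.1)) ∈ s} :=
      (measurable_fst.prodMk hev) hs
    have e1 : ν s = ∫⁻ a, P {x | (a, x (τ a)) ∈ s} ∂unif01 := by
      rw [hν, withDensity_apply _ hs, ← lintegral_indicator hs,
        lintegral_prod _ (hgm2.ennreal_ofReal.indicator hs).aemeasurable]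
      refine lintegral_congr fun a => ?_
      have hsa : MeasurableSet (Prod.mk a ⁻¹' s) := measurable_prodMk_left hs
      have : P {x | (a, x (τ a)) ∈ s} = (P.map fun x => x (τ a)) (Prod.mk a ⁻¹' s) := by
        rw [Measure.map_apply (measurable_pi_apply _) hsa]; rfl
      rw [this, hgP, withDensity_apply _ hsa, ← lintegral_indicator hsa]
      refine lintegral_congr fun y => ?_
      by_cases hy : (a, y) ∈ s
      · rw [indicator_of_mem hy, indicator_of_mem (by exact hy)]
      · rw [indicator_of_notMem hy, indicator_of_notMem (by exact hy)]
    have e2 := Measure.prod_apply (μ := unif01) (ν := P) hS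
    have e3 := Measure.prod_apply_symm (μ := unif01) (ν := P) hS
    rw [e1]
    refine (e2.symm.trans e3).trans (lintegral_congr fun x => ?_)
    rw [gpEmp, Measure.map_apply (gpEmp_meas_aux h x) hs]
    rfl
  have hνprob : IsProbabilityMeasure ν := ⟨by
    rw [hmass _ MeasurableSet.univ]
    have : ∀ x : Fin n → X, (gpEmp τ x) univ = 1 := fun x => (gpEmp_inTM h x).1.measure_univ
    rw [lintegral_congr this]; simp⟩
  have hTM : inTM ν := by
    refine ⟨hνprob, ?_⟩
    ext s hs
    rw [Measure.map_apply measurable_fst hs, hmass _ (measurable_fst hs)]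
    have : ∀ x : Fin n → X, (gpEmp τ x) (Prod.fst ⁻¹' s) = unif01 s := fun x => by
      rw [← Measure.map_apply measurable_fst hs, (gpEmp_inTM h x).2]
    rw [lintegral_congr this]; simp
  obtain ⟨hk1, hk2⟩ := gp_kl_density (unif01.prod μ) hc1 hgm2 (fun z => hg0 _ _) (fun z => hgc _ _)
    hνprob
  refine ⟨ν, hTM, hk1, ?_, ?_⟩
  · rw [hk2, integral_prod _ (gp_mul_log_intg (unif01.prod μ) hc1 hgm2 (fun z => hg0 _ _)
      (fun z => hgc _ _))]
    rw [gp_unif_int h (fun i => ∫ y, g i y * Real.log (g i y) ∂μ), ← mul_assoc,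
      mul_inv_cancel₀ hn'.ne', one_mul, ← Real.log_inv]
    exact gp_subadd μ P hc1 hPle g hgm hg0 hgc hgP
  · intro x hx j
    have hsj : MeasurableSet (e ⁻¹' {j}) := he (measurableSet_singleton j)
    have hprobx : ∀ y : Fin n → X, IsProbabilityMeasure (gpEmp τ y) := fun y => (gpEmp_inTM h y).1
    have hfm : AEMeasurable (fun y => (gpEmp τ y) (e ⁻¹' {j})) P := (gp_emp_meas h hsj).aemeasurable
    have e1 : ν.real (e ⁻¹' {j}) = ∫ y, (gpEmp τ y).real (e ⁻¹' {j}) ∂P := by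
      simp only [Measure.real]
      rw [integral_toReal hfm (Eventually.of_forall fun y => measure_lt_top _ _), hmass _ hsj]
    have hi : Integrable (fun y => (gpEmp τ y).real (e ⁻¹' {j})) P := by
      refine Integrable.of_bound hfm.ennreal_toReal.aestronglyMeasurable 1
        (Eventually.of_forall fun y => ?_)
      rw [Real.norm_eq_abs, abs_of_nonneg measureReal_nonneg]
      exact measureReal_le_one
    have e2 : (gpEmp τ x).real (e ⁻¹' {j}) - ν.real (e ⁻¹' {j}) =
        ∫ y, ((gpEmp τ x).real (e ⁻¹' {j}) - (gpEmp τ y).real (e ⁻¹' {j})) ∂P := by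
      rw [integral_sub (integrable_const _) hi, e1]; simp
    rw [e2]
    have := norm_integral_le_of_norm_le_const (μ := P) (f := fun y =>
      ((gpEmp τ x).real (e ⁻¹' {j}) - (gpEmp τ y).real (e ⁻¹' {j}))) (C := δ)
      (by filter_upwards [hPB] with y hy using hδ x hx y hy j)
    simpa using this

lemma gp_meanfield {X J : Type*} [MeasurableSpace X] [Fintype J] [MeasurableSpace J]
    [MeasurableSingletonClass J]
    (μ : Measure X) [IsProbabilityMeasure μ] {e : ℝ × X → J} (he : Measurable e)
    (F : (J → ℝ) → ℝ) (hF : Continuous F) {ε : ℝ} (hε : 0 < ε) :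
    ∃ K : ℕ, 0 < K ∧ ∀ (n : ℕ) (τ : ℝ → Fin n), GpTau τ → ∀ S : ℝ,
      (∀ ν : Measure (ℝ × X), inTM ν → InformationTheory.klDiv ν (unif01.prod μ) ≠ ⊤ →
        F (fun j => ν.real (e ⁻¹' {j})) - (InformationTheory.klDiv ν (unif01.prod μ)).toReal ≤ S) →
      ∫⁻ x, ENNReal.ofReal (Real.exp (n * F (fun j => (gpEmp τ x).real (e ⁻¹' {j}))))
        ∂(Measure.pi fun _ : Fin n => μ) ≤ K * ENNReal.ofReal (Real.exp (n * (S + ε))) := by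
  classical
  have hcpt : IsCompact (Set.pi univ fun _ : J => Icc (0:ℝ) 1) := isCompact_univ_pi fun _ => isCompact_Icc
  have huc := hcpt.uniformContinuousOn_of_continuous hF.continuousOn
  rw [Metric.uniformContinuousOn_iff] at huc
  obtain ⟨δ', hδ', hu⟩ := huc ε hε
  set δ := δ' / 2 with hδd
  have hδ : 0 < δ := by positivity
  set R := ⌊1 / δ⌋₊ with hR
  refine ⟨Fintype.card (J → Fin (R + 1)), Fintype.card_pos, ?_⟩
  intro n τ h S hS
  have hn := h.pos
  have hn' : (0:ℝ) < n := by exact_mod_cast hn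
  have hprobx : ∀ y : Fin n → X, IsProbabilityMeasure (gpEmp τ y) := fun y => (gpEmp_inTM h y).1
  set Pn := Measure.pi fun _ : Fin n => μ with hPn
  set N : (Fin n → X) → J → ℝ := fun x j => (gpEmp τ x).real (e ⁻¹' {j}) with hN
  have hN0 : ∀ x j, 0 ≤ N x j := fun x j => measureReal_nonneg
  have hN1 : ∀ x j, N x j ≤ 1 := fun x j => measureReal_le_one
  have hNm : ∀ j, Measurable fun x => N x j := fun j =>
    (gp_emp_meas h (he (measurableSet_singleton j))).ennreal_toReal
  have hNR : ∀ x j, ⌊N x j / δ⌋₊ < R + 1 := fun x j => by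
    have : N x j / δ ≤ 1 / δ := by gcongr; exact hN1 x j
    have := Nat.floor_le_floor this
    omega
  set cell : (Fin n → X) → J → Fin (R + 1) := fun x j => ⟨⌊N x j / δ⌋₊, hNR x j⟩ with hcell
  have hcm : Measurable cell := by
    refine measurable_pi_lambda _ fun j => ?_
    have h1 : Measurable fun x => ⌊N x j / δ⌋₊ := Nat.measurable_floor.comp ((hNm j).div_const δ)
    refine measurable_to_countable' fun k => ?_
    have : (fun x => cell x j) ⁻¹' {k} = (fun x => ⌊N x j / δ⌋₊) ⁻¹' {(k : ℕ)} := by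
      ext x; simp [hcell, Fin.ext_iff]
    rw [this]
    exact h1 (measurableSet_singleton _)
  have hclose : ∀ k, ∀ x ∈ cell ⁻¹' {k}, ∀ y ∈ cell ⁻¹' {k}, ∀ j, |N x j - N y j| ≤ δ := by
    intro k x hx y hy j
    have hxy : ⌊N x j / δ⌋₊ = ⌊N y j / δ⌋₊ := by
      have h1 : cell x = cell y := by rw [mem_preimage, mem_singleton_iff] at hx hy; rw [hx, hy]
      have := congrFun h1 j
      simpa [hcell, Fin.ext_iff] using this
    have a1 := Nat.floor_le (div_nonneg (hN0 x j) hδ.le)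
    have a2 := Nat.lt_floor_add_one (N x j / δ)
    have b1 := Nat.floor_le (div_nonneg (hN0 y j) hδ.le)
    have b2 := Nat.lt_floor_add_one (N y j / δ)
    rw [hxy] at a1 a2
    have h3 : |N x j / δ - N y j / δ| ≤ 1 := by rw [abs_le]; constructor <;> linarith
    rw [← sub_div, abs_div, abs_of_pos hδ, div_le_one hδ] at h3
    exact h3
  have hmeasF : Measurable fun x => ENNReal.ofReal (Real.exp (n * F (N x))) := by
    have : Measurable N := measurable_pi_lambda _ hNm
    exact (Real.measurable_exp.comp ((hF.measurable.comp this).const_mul _)).ennreal_ofReal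
  have hcellbd : ∀ k, ∫⁻ x in cell ⁻¹' {k}, ENNReal.ofReal (Real.exp (n * F (N x))) ∂Pn ≤
      ENNReal.ofReal (Real.exp (n * (S + ε))) := by
    intro k
    have hBm : MeasurableSet (cell ⁻¹' {k}) := hcm (measurableSet_singleton k)
    by_cases hB0 : Pn (cell ⁻¹' {k}) = 0
    · rw [setLIntegral_measure_zero _ _ hB0]; exact bot_le
    obtain ⟨ν, hν, hk, hkl, hcl⟩ := gp_cell μ he h _ hBm hB0 (hclose k)
    have hν1 := hν.1
    have hSν := hS ν hν hk
    set m := Pn.real (cell ⁻¹' {k}) with hm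
    have hm0 : 0 < m := ENNReal.toReal_pos hB0 (measure_ne_top _ _)
    have hpt : ∀ x ∈ cell ⁻¹' {k}, ENNReal.ofReal (Real.exp (n * F (N x))) ≤
        ENNReal.ofReal (Real.exp (n * (S + ε)) * m⁻¹) := by
      intro x hx
      apply ENNReal.ofReal_le_ofReal
      have h1 := hu (N x) (fun j _ => ⟨hN0 x j, hN1 x j⟩) (fun j => ν.real (e ⁻¹' {j}))
        (fun j _ => ⟨measureReal_nonneg, measureReal_le_one⟩) (by
          refine lt_of_le_of_lt ((dist_pi_le_iff hδ.le).2 fun j => ?_) (by linarith : δ < δ')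
          exact hcl x hx j)
      rw [Real.dist_eq] at h1
      have h2 := (abs_lt.1 h1).2
      rw [← Real.exp_log (inv_pos.2 hm0), ← Real.exp_add, Real.exp_le_exp, Real.log_inv]
      have h3 : n * F (N x) ≤ n * (S + ε + (InformationTheory.klDiv ν (unif01.prod μ)).toReal) := by
        gcongr; linarith
      linarith
    refine (setLIntegral_mono measurable_const hpt).trans (le_of_eq ?_)
    rw [setLIntegral_const, show Pn (cell ⁻¹' {k}) = ENNReal.ofReal m from
      (ENNReal.ofReal_toReal (measure_ne_top _ _)).symm, ← ENNReal.ofReal_mul (by positivity),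
      mul_assoc, inv_mul_cancel₀ hm0.ne', mul_one]
  have hsplit : ∫⁻ x, ENNReal.ofReal (Real.exp (n * F (N x))) ∂Pn =
      ∑ k, ∫⁻ x in cell ⁻¹' {k}, ENNReal.ofReal (Real.exp (n * F (N x))) ∂Pn := by
    rw [← lintegral_biUnion_finset (s := Finset.univ) (t := fun k => cell ⁻¹' {k})]
    · have : (⋃ k ∈ (Finset.univ : Finset (J → Fin (R + 1))), cell ⁻¹' {k}) = univ := by
        ext x; simp
      rw [this, setLIntegral_univ]
    · intro a _ b _ hab
      exact Disjoint.preimage _ (by simpa using hab)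
    · exact fun k _ => hcm (measurableSet_singleton k)
  rw [hsplit]
  refine (Finset.sum_le_sum fun k _ => hcellbd k).trans (le_of_eq ?_)
  rw [Finset.sum_const, nsmul_eq_mul, Finset.card_univ]

/-- Cell averages. -/
noncomputable def gpAvg {Z κ : Type*} [MeasurableSpace Z] (P : Measure Z) (C : Z → κ) (f : Z → ℝ)
    (k : κ) : ℝ := (∫ z in C ⁻¹' {k}, f z ∂P) / P.real (C ⁻¹' {k})

lemma gp_part {Z κ : Type*} [MeasurableSpace Z] [Fintype κ] [MeasurableSpace κ]
    [MeasurableSingletonClass κ] (P : Measure Z) {C : Z → κ} (hC : Measurable C) (F : Z → ℝ≥0∞) :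
    ∫⁻ z, F z ∂P = ∑ k, ∫⁻ z in C ⁻¹' {k}, F z ∂P := by
  have : (univ : Set Z) = ⋃ k, C ⁻¹' {k} := by ext; simp
  rw [← setLIntegral_univ, this, lintegral_iUnion (fun k => hC (measurableSet_singleton k)), tsum_fintype]
  intro i j hij
  refine Set.disjoint_left.2 fun z hz hz' => hij ?_
  simp only [mem_preimage, mem_singleton_iff] at hz hz'
  exact hz.symm.trans hz'

lemma gp_cell_jensen {Z : Type*} [MeasurableSpace Z] (P : Measure Z) [IsProbabilityMeasure P]
    (S : Set Z) (f : Z → ℝ) (hf : Measurable f) {r : ℝ} (hr : 1 ≤ r) (a : ℝ)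
    (ha : a = (∫ z in S, f z ∂P) / P.real S) :
    ‖a‖ₑ ^ r * P S ≤ ∫⁻ z in S, ‖f z‖ₑ ^ r ∂P := by
  have hr0 : 0 < r := by linarith
  by_cases h0 : P S = 0
  · rw [h0, mul_zero]; exact bot_le
  have hT : P S ≠ ⊤ := measure_ne_top _ _
  have h1 : ‖a‖ₑ * P S ≤ ∫⁻ z in S, ‖f z‖ₑ ∂P := by
    refine le_trans (le_of_eq ?_) (enorm_integral_le_lintegral_enorm _)
    have hp : P.real S ≠ 0 := by
      rw [Measure.real, ENNReal.toReal_ne_zero]; exact ⟨h0, hT⟩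
    have e : P S = ‖P.real S‖ₑ := by
      rw [Real.enorm_eq_ofReal measureReal_nonneg, Measure.real, ENNReal.ofReal_toReal hT]
    rw [e, ← enorm_mul, ha, div_mul_cancel₀ _ hp]
  have h2 := eLpNorm'_le_eLpNorm'_mul_rpow_measure_univ (μ := P.restrict S) (f := f)
    zero_lt_one hr hf.aestronglyMeasurable
  simp only [eLpNorm', ENNReal.rpow_one, div_one, Measure.restrict_apply_univ] at h2
  have h3 : (‖a‖ₑ * P S) ^ r ≤ ((∫⁻ z in S, ‖f z‖ₑ ^ r ∂P) ^ (1 / r) * P S ^ (1 - 1 / r)) ^ r := by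
    exact ENNReal.rpow_le_rpow (h1.trans h2) hr0.le
  rw [ENNReal.mul_rpow_of_nonneg _ _ hr0.le, ENNReal.mul_rpow_of_nonneg _ _ hr0.le,
    ← ENNReal.rpow_mul, ← ENNReal.rpow_mul, one_div, inv_mul_cancel₀ hr0.ne', ENNReal.rpow_one,
    show (1 - r⁻¹) * r = r - 1 by field_simp] at h3
  have h4 : P S ^ r = P S * P S ^ (r - 1) := by
    conv_rhs => rw [← ENNReal.rpow_one (P S), ← ENNReal.rpow_mul, ← ENNReal.rpow_add _ _ h0 hT]
    congr 1; ring
  rw [h4, ← mul_assoc] at h3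
  have h5 : P S ^ (r - 1) ≠ 0 := by simp [ENNReal.rpow_eq_zero_iff, h0, hT]
  have h6 : P S ^ (r - 1) ≠ ⊤ := ENNReal.rpow_ne_top_of_nonneg (by linarith) hT
  exact (ENNReal.mul_le_mul_iff_left h5 h6).1 h3

lemma gp_avg_norm {Z κ : Type*} [MeasurableSpace Z] [Fintype κ] [MeasurableSpace κ]
    [MeasurableSingletonClass κ] (P : Measure Z) [IsProbabilityMeasure P] {C : Z → κ}
    (hC : Measurable C) (f : Z → ℝ) (hf : Measurable f) {r : ℝ} (hr : 1 ≤ r) :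
    ∫⁻ z, ‖gpAvg P C f (C z)‖ₑ ^ r ∂P ≤ ∫⁻ z, ‖f z‖ₑ ^ r ∂P := by
  rw [gp_part P hC, gp_part P hC (fun z => ‖f z‖ₑ ^ r)]
  refine Finset.sum_le_sum fun k _ => ?_
  have hm : MeasurableSet (C ⁻¹' {k}) := hC (measurableSet_singleton k)
  calc _ = ∫⁻ z in C ⁻¹' {k}, ‖gpAvg P C f k‖ₑ ^ r ∂P := by
        refine setLIntegral_congr_fun hm fun z hz => ?_
        simp only [mem_preimage, mem_singleton_iff] at hz
        simp only [hz]
    _ = ‖gpAvg P C f k‖ₑ ^ r * P (C ⁻¹' {k}) := by simp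
    _ ≤ _ := gp_cell_jensen P _ f hf hr _ rfl

lemma gp_fatou {Z : Type*} [MeasurableSpace Z] (P : Measure Z) (f : ℕ → Z → ℝ) (g : Z → ℝ)
    (hf : ∀ j, Measurable (f j)) (h : ∀ᵐ z ∂P, Tendsto (fun j => f j z) atTop (nhds (g z)))
    {r : ℝ} (hr : 0 < r) (B : ℝ≥0∞) (hB : ∀ j, ∫⁻ z, ‖f j z‖ₑ ^ r ∂P ≤ B) :
    ∫⁻ z, ‖g z‖ₑ ^ r ∂P ≤ B := by
  have h1 : ∀ᵐ z ∂P, ‖g z‖ₑ ^ r = liminf (fun j => ‖f j z‖ₑ ^ r) atTop := by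
    filter_upwards [h] with z hz
    have : Tendsto (fun j => ‖f j z‖ₑ ^ r) atTop (nhds (‖g z‖ₑ ^ r)) :=
      (ENNReal.continuous_rpow_const.tendsto _).comp ((continuous_enorm.tendsto _).comp hz)
    exact this.liminf_eq.symm
  rw [lintegral_congr_ae h1]
  refine (lintegral_liminf_le fun j => (hf j).enorm.pow_const r).trans ?_
  calc _ ≤ liminf (fun _ : ℕ => B) atTop := liminf_le_liminf (Eventually.of_forall hB)
    _ = B := by simp

lemma gp_norm_iff {Z : Type*} [MeasurableSpace Z] (P : Measure Z) (f : Z → ℝ) {r M : ℝ} (hr : 0 < r)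
    : eLpNorm' f r P ≤ ENNReal.ofReal M ↔ ∫⁻ z, ‖f z‖ₑ ^ r ∂P ≤ ENNReal.ofReal M ^ r := by
  unfold eLpNorm'
  rw [one_div, ENNReal.rpow_inv_le_iff hr]

lemma gp_avg_l1 {Z κ : Type*} [MeasurableSpace Z] [Fintype κ] [MeasurableSpace κ]
    [MeasurableSingletonClass κ] (P : Measure Z) [IsProbabilityMeasure P] {C : Z → κ}
    (hC : Measurable C) (f : Z → ℝ) (hf : Measurable f) (hfi : Integrable f P) (h : κ → ℝ) (ε : ℝ≥0∞)
    (hε : ∫⁻ z, ‖f z - h (C z)‖ₑ ∂P ≤ ε) :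
    ∫⁻ z, ‖f z - gpAvg P C f (C z)‖ₑ ∂P ≤ 2 * ε := by
  have hhm : Measurable (fun z => h (C z)) := (measurable_of_finite h).comp hC
  have ham : Measurable (fun z => gpAvg P C f (C z)) :=
    (measurable_of_finite (gpAvg P C f)).comp hC
  have hhi : Integrable (fun z => h (C z)) P :=
    Integrable.of_bound hhm.aestronglyMeasurable (∑ k, |h k|)
      (Eventually.of_forall fun z => Finset.single_le_sum (f := fun k => |h k|)
        (fun k _ => abs_nonneg _) (Finset.mem_univ (C z)))
  have hae : ∀ᵐ z ∂P, P (C ⁻¹' {C z}) ≠ 0 := by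
    have : ∀ᵐ z ∂P, ∀ k, C z = k → P (C ⁻¹' {k}) ≠ 0 := by
      rw [ae_all_iff]
      intro k
      by_cases hk : P (C ⁻¹' {k}) = 0
      · have := measure_eq_zero_iff_ae_notMem.1 hk
        filter_upwards [this] with z hz hz'
        exact absurd hz' hz
      · exact Eventually.of_forall fun z _ => hk
    filter_upwards [this] with z hz using hz _ rfl
  have hkey : ∀ᵐ z ∂P, ‖h (C z) - gpAvg P C f (C z)‖ₑ =
      ‖gpAvg P C (fun z => f z - h (C z)) (C z)‖ₑ := by
    filter_upwards [hae] with z hz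
    have hm : MeasurableSet (C ⁻¹' {C z}) := hC (measurableSet_singleton _)
    have hp : P.real (C ⁻¹' {C z}) ≠ 0 := by
      rw [Measure.real, ENNReal.toReal_ne_zero]; exact ⟨hz, measure_ne_top _ _⟩
    have e1 : ∫ y in C ⁻¹' {C z}, h (C y) ∂P = P.real (C ⁻¹' {C z}) * h (C z) := by
      rw [setIntegral_congr_fun (g := fun _ => h (C z)) hm]
      · simp
      · intro y hy
        simp only [mem_preimage, mem_singleton_iff] at hy
        simp only [hy]
    unfold gpAvg
    rw [integral_sub hfi.integrableOn hhi.integrableOn, e1, ← enorm_neg]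
    congr 1
    field_simp
    ring
  have h2 : ∫⁻ z, ‖h (C z) - gpAvg P C f (C z)‖ₑ ∂P ≤ ε := by
    rw [lintegral_congr_ae hkey]
    have := gp_avg_norm P hC (fun z => f z - h (C z)) (hf.sub hhm) le_rfl
    simp only [ENNReal.rpow_one] at this
    exact this.trans hε
  calc _ ≤ ∫⁻ z, (‖f z - h (C z)‖ₑ + ‖h (C z) - gpAvg P C f (C z)‖ₑ) ∂P := by
        refine lintegral_mono fun z => ?_
        have : f z - gpAvg P C f (C z) = (f z - h (C z)) + (h (C z) - gpAvg P C f (C z)) := by ring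
        rw [this]; exact enorm_add_le _ _
    _ = _ + _ := lintegral_add_left (hf.sub hhm).enorm _
    _ ≤ ε + ε := add_le_add hε h2
    _ = 2 * ε := (two_mul _).symm

/-- Cut closeness. -/
def GpCut (w w' : ℝ → ℝ → ℝ) (η : ℝ) : Prop :=
  ∀ S T, MeasurableSet S → MeasurableSet T →
        |∫ s in S, ∫ t in T, (w s t - w' s t) ∂unif01 ∂unif01| ≤ η

lemma gpCut_prod {w w' : ℝ → ℝ → ℝ}
    (hw : Integrable (Function.uncurry w) (unif01.prod unif01))
    (hw' : Integrable (Function.uncurry w') (unif01.prod unif01)) {S T : Set ℝ} :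
    ∫ s in S, ∫ t in T, (w s t - w' s t) ∂unif01 ∂unif01 =
      (∫ z in S ×ˢ T, Function.uncurry w z ∂(unif01.prod unif01)) -
       ∫ z in S ×ˢ T, Function.uncurry w' z ∂(unif01.prod unif01) := by
  rw [← integral_sub hw.integrableOn hw'.integrableOn, setIntegral_prod]
  · rfl
  · exact (hw.sub hw').integrableOn

lemma gpCut_of_l1 {w w' : ℝ → ℝ → ℝ}
    (hw : Integrable (Function.uncurry w) (unif01.prod unif01))
    (hw' : Integrable (Function.uncurry w') (unif01.prod unif01)) {η : ℝ} (hη : 0 ≤ η)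
    (h : ∫⁻ z, ‖Function.uncurry w z - Function.uncurry w' z‖ₑ ∂(unif01.prod unif01) ≤ ENNReal.ofReal η) :
    GpCut w w' η := by
  intro S T hS hT
  rw [gpCut_prod hw hw', ← integral_sub hw.integrableOn hw'.integrableOn]
  have h1 := enorm_integral_le_lintegral_enorm (μ := (unif01.prod unif01).restrict (S ×ˢ T))
    (fun z => Function.uncurry w z - Function.uncurry w' z)
  have h2 := h1.trans ((setLIntegral_le_lintegral _ _).trans h)
  rw [← Real.norm_eq_abs, ← toReal_enorm]
  exact ENNReal.toReal_le_of_le_ofReal hη h2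

lemma gpCut_symm {w w' : ℝ → ℝ → ℝ}
    (hw : Integrable (Function.uncurry w) (unif01.prod unif01))
    (hw' : Integrable (Function.uncurry w') (unif01.prod unif01)) {η : ℝ} (h : GpCut w w' η) :
    GpCut w' w η := by
  intro S T hS hT
  have := h S T hS hT
  rw [gpCut_prod hw hw'] at this
  rwa [gpCut_prod hw' hw, abs_sub_comm]

lemma gpCut_trans {w w' w'' : ℝ → ℝ → ℝ}
    (hw : Integrable (Function.uncurry w) (unif01.prod unif01))
    (hw' : Integrable (Function.uncurry w') (unif01.prod unif01))
    (hw'' : Integrable (Function.uncurry w'') (unif01.prod unif01)) {η η' : ℝ} (h : GpCut w w' η)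
    (h' : GpCut w' w'' η') : GpCut w w'' (η + η') := by
  intro S T hS hT
  have h1 := h S T hS hT
  have h2 := h' S T hS hT
  rw [gpCut_prod hw hw'] at h1
  rw [gpCut_prod hw' hw''] at h2
  rw [gpCut_prod hw hw'']
  refine le_trans ?_ (add_le_add h1 h2)
  refine le_trans (le_of_eq ?_) (abs_add_le _ _)
  congr 1; ring

lemma gp_step_exists {r M : ℝ} (hr : 1 ≤ r) {W : ℝ → ℝ → ℝ}
    (hW : Measurable (Function.uncurry W))
    (hWi : Integrable (Function.uncurry W) (unif01.prod unif01))
    (hcut : ∀ η > 0, ∃ w, GpKer unif01 r M w ∧ GpCut w W η) (ε : ℝ) (hε : 0 < ε) :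
    ∃ m : ℕ, ∃ c : ℝ → Fin m, Measurable c ∧ ∃ ω : Fin m → Fin m → ℝ,
      GpKer unif01 r M (fun s t => ω (c s) (c t)) ∧
      ∫⁻ z, ‖Function.uncurry W z - ω (c z.1) (c z.2)‖ₑ ∂(unif01.prod unif01) ≤ ENNReal.ofReal ε := by
  have hr0 : 0 < r := by linarith
  have hmp := gp_map_pair unif01 (0 : Fin 2) 1 (by decide)
  have hfi : Integrable (fun z : Fin 2 → ℝ => W (z 0) (z 1)) (Measure.pi fun _ => unif01) := by
    have : Integrable (Function.uncurry W)
      ((Measure.pi fun _ : Fin 2 => unif01).map (fun z => (z 0, z 1))) := by rwa [hmp]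
    exact this.comp_measurable (by fun_prop)
  obtain ⟨m, c, hc, h, hh⟩ := gpApprox_all unif01 _ hfi (ENNReal.ofReal (ε / 2)) (by simpa using hε)
  set C : ℝ × ℝ → Fin m × Fin m := fun z => (c z.1, c z.2) with hCdef
  have hC : Measurable C := by fun_prop
  have hh2 : ∫⁻ z, ‖Function.uncurry W z - (fun k : Fin m × Fin m => h ![k.1, k.2]) (C z)‖ₑ
      ∂(unif01.prod unif01) ≤ ENNReal.ofReal (ε / 2) := by
    have hm : Measurable (fun z : ℝ × ℝ => ‖Function.uncurry W z - (fun k : Fin m × Fin m => h ![k.1, k.2]) (C z)‖ₑ) :=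
      (hW.sub ((measurable_of_finite (fun k : Fin m × Fin m => h ![k.1, k.2])).comp hC)).enorm
    rw [← hmp, lintegral_map hm (by fun_prop)]
    refine le_trans (le_of_eq ?_) hh
    refine lintegral_congr fun z => ?_
    have : (fun a => c (z a)) = ![c (z 0), c (z 1)] := by
      ext a; fin_cases a <;> rfl
    rw [this]; rfl
  have hl1 := gp_avg_l1 (unif01.prod unif01) hC _ hW hWi (fun k : Fin m × Fin m => h ![k.1, k.2]) _ hh2
  choose w hwk hwc using fun j : ℕ => hcut (1 / ((j : ℝ) + 1)) (by positivity)
  refine ⟨m, c, hc, fun i j => gpAvg (unif01.prod unif01) C (Function.uncurry W) (i, j), ⟨?_, ?_⟩, ?_⟩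
  · exact (measurable_of_finite (gpAvg (unif01.prod unif01) C (Function.uncurry W))).comp hC
  · rw [gp_norm_iff _ _ hr0]
    refine gp_fatou _ (fun j z => gpAvg (unif01.prod unif01) C (Function.uncurry (w j)) (C z)) _
      (fun j => (measurable_of_finite (gpAvg (unif01.prod unif01) C (Function.uncurry (w j)))).comp hC)
      (Eventually.of_forall fun z => ?_) hr0 _ fun j => ?_
    · unfold gpAvg
      refine Tendsto.div_const ?_ _
      have hpre : ∀ k : Fin m × Fin m, C ⁻¹' {k} = (c ⁻¹' {k.1}) ×ˢ (c ⁻¹' {k.2}) := fun k => by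
        ext z; simp [hCdef, Prod.ext_iff]
      rw [tendsto_iff_dist_tendsto_zero]
      refine squeeze_zero (fun _ => dist_nonneg) (fun j => ?_)
        (tendsto_one_div_add_atTop_nhds_zero_nat (𝕜 := ℝ))
      have h1 := hwc j (c ⁻¹' {c z.1}) (c ⁻¹' {c z.2}) (hc (measurableSet_singleton _))
        (hc (measurableSet_singleton _))
      rw [gpCut_prod (gp_ker_int unif01 hr _ (hwk j)) hWi] at h1
      rw [Real.dist_eq]
      simp only [hpre]
      exact h1
    · refine (gp_avg_norm _ hC _ (hwk j).meas hr).trans ?_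
      exact (gp_norm_iff _ _ hr0).1 (hwk j).norm
  · refine hl1.trans (le_of_eq ?_)
    rw [show (2 : ℝ≥0∞) = ENNReal.ofReal 2 by simp, ← ENNReal.ofReal_mul (by norm_num)]
    congr 1; ring

lemma gp_W_ker {r M : ℝ} (hr : 1 ≤ r) {W : ℝ → ℝ → ℝ}
    (hW : Measurable (Function.uncurry W))
    (hWi : Integrable (Function.uncurry W) (unif01.prod unif01))
    (hcut : ∀ η > 0, ∃ w, GpKer unif01 r M w ∧ GpCut w W η) : GpKer unif01 r M W := by
  have hr0 : 0 < r := by linarith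
  choose m c hc ω hk hl using fun j : ℕ => gp_step_exists hr hW hWi hcut (1 / ((j : ℝ) + 1)) (by positivity)
  have hlim : TendstoInMeasure (unif01.prod unif01)
      (fun j (z : ℝ × ℝ) => ω j (c j z.1) (c j z.2)) atTop (Function.uncurry W) := by
    refine tendstoInMeasure_of_tendsto_eLpNorm (p := 1) one_ne_zero
      (fun j => (hk j).meas.aestronglyMeasurable) hW.aestronglyMeasurable ?_
    refine tendsto_of_tendsto_of_tendsto_of_le_of_le tendsto_const_nhds
      (h := fun j : ℕ => ENNReal.ofReal (1 / ((j : ℝ) + 1))) ?_ (fun _ => bot_le) fun j => ?_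
    · rw [← ENNReal.ofReal_zero]
      exact (ENNReal.continuous_ofReal.tendsto _).comp (tendsto_one_div_add_atTop_nhds_zero_nat (𝕜 := ℝ))
    · rw [eLpNorm_one_eq_lintegral_enorm]
      refine le_trans (le_of_eq (lintegral_congr fun z => ?_)) (hl j)
      rw [← enorm_neg]; congr 1; simp
  obtain ⟨ns, -, hns⟩ := hlim.exists_seq_tendsto_ae
  refine ⟨hW, (gp_norm_iff _ _ hr0).2 ?_⟩
  refine gp_fatou _ (fun j (z : ℝ × ℝ) => ω (ns j) (c (ns j) z.1) (c (ns j) z.2)) _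
    (fun j => (hk (ns j)).meas) hns hr0 _ fun j => ?_
  exact (gp_norm_iff _ _ hr0).1 (hk (ns j)).norm

lemma gp_finite_form {v : ℕ} (E : Finset (Fin v × Fin v)) {X : Type*} [MeasurableSpace X] {m k : ℕ}
    {dd : ℝ → Fin m} (hdd : Measurable dd) {c : X → Fin k} (hc : Measurable c)
    (ω : Fin m → Fin m → ℝ) (h : (Fin v → Fin k) → ℝ) :
    ∃ F : (Fin m × Fin k → ℝ) → ℝ, Continuous F ∧ ∀ ν : Measure (ℝ × X), IsProbabilityMeasure ν →
      gpT E (fun s t => ω (dd s) (dd t)) (gpS (fun y => h (fun a => c (y a)))) ν =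
        F (fun j => ν.real ((fun z : ℝ × X => (dd z.1, c z.2)) ⁻¹' {j})) := by
  refine ⟨fun N => ∑ κ : Fin v → Fin m × Fin k, (∏ a, N (κ a)) *
    (h (fun a => (κ a).2) * ∏ e ∈ E, ω (κ e.1).1 (κ e.2).1), by fun_prop, fun ν hν => ?_⟩
  set e : ℝ × X → Fin m × Fin k := fun z => (dd z.1, c z.2) with he
  have hem : Measurable e := by fun_prop
  set H : (Fin v → Fin m × Fin k) → ℝ := fun κ =>
    h (fun a => (κ a).2) * ∏ e ∈ E, ω (κ e.1).1 (κ e.2).1 with hH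
  have hpm := Measure.isProbabilityMeasure_map (μ := ν) hem.aemeasurable
  have hmap : (Measure.pi fun _ : Fin v => ν).map (fun z a => e (z a)) =
      Measure.pi fun _ => ν.map e := Measure.pi_map_pi (fun _ => hem.aemeasurable)
  have hmm : Measurable (fun (z : Fin v → ℝ × X) a => e (z a)) := by fun_prop
  have h1 : gpT E (fun s t => ω (dd s) (dd t)) (gpS (fun y => h (fun a => c (y a)))) ν =
      ∫ κ, H κ ∂(Measure.pi fun _ : Fin v => ν.map e) := by
    rw [← hmap, integral_map hmm.aemeasurable (measurable_of_finite H).aestronglyMeasurable]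
    rfl
  rw [h1, integral_fintype Integrable.of_finite]
  refine Finset.sum_congr rfl fun κ _ => ?_
  rw [smul_eq_mul]
  congr 1
  rw [Measure.real, ← univ_pi_singleton, Measure.pi_pi, ENNReal.toReal_prod]
  refine Finset.prod_congr rfl fun a _ => ?_
  rw [Measure.map_apply hem (measurableSet_singleton _)]
  rfl

lemma gp_fst_cell {X : Type*} [MeasurableSpace X] {n : ℕ} {τ : ℝ → Fin n} (h : GpTau τ)
    {ν : Measure (ℝ × X)} (hν : inTM ν) (i : Fin n) :
    ν ((fun z : ℝ × X => τ z.1) ⁻¹' {i}) = (n : ℝ≥0∞)⁻¹ := by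
  rw [← h.unif i, ← hν.2, Measure.map_apply measurable_fst (h.meas (measurableSet_singleton i))]
  rfl

lemma gp_noninj {X : Type*} [MeasurableSpace X] {v n : ℕ} {τ : ℝ → Fin n} (h : GpTau τ)
    {ν : Measure (ℝ × X)} (hν : inTM ν) :
    (Measure.pi fun _ : Fin v => ν) (gpJ v τ)ᶜ ≤ ENNReal.ofReal ((v : ℝ) ^ 2 / n) := by
  classical
  have := hν.1
  have hn := h.pos
  have hsub : ((gpJ v τ)ᶜ : Set (Fin v → ℝ × X)) ⊆
      ⋃ ab ∈ (Finset.univ.filter (fun ab : Fin v × Fin v => ab.1 ≠ ab.2)),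
        {z | τ (z ab.1).1 = τ (z ab.2).1} := by
    intro z hz
    simp only [gpJ, mem_compl_iff, mem_ofPred_eq, Function.Injective, not_forall] at hz
    obtain ⟨a, b, hab, hne⟩ := hz
    simp only [mem_iUnion]
    exact ⟨(a, b), by simp [hne], hab⟩
  have hpair : ∀ ab : Fin v × Fin v, ab.1 ≠ ab.2 →
      (Measure.pi fun _ : Fin v => ν) {z | τ (z ab.1).1 = τ (z ab.2).1} ≤ (n : ℝ≥0∞)⁻¹ := by
    intro ab hab
    set A : Set ((ℝ × X) × (ℝ × X)) := {y | τ y.1.1 = τ y.2.1} with hA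
    have hτm := h.meas
    have hAm : MeasurableSet A := measurableSet_eq_fun (by fun_prop) (by fun_prop)
    have e1 : (Measure.pi fun _ : Fin v => ν) {z | τ (z ab.1).1 = τ (z ab.2).1} = (ν.prod ν) A := by
      rw [← gp_map_pair ν ab.1 ab.2 hab, Measure.map_apply (by fun_prop) hAm]
      rfl
    rw [e1]
    have hA2 : A ⊆ ⋃ i, ((fun z : ℝ × X => τ z.1) ⁻¹' {i}) ×ˢ ((fun z : ℝ × X => τ z.1) ⁻¹' {i}) := by
      intro y hy
      simp only [mem_iUnion]
      exact ⟨τ y.2.1, hy, rfl⟩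
    refine (measure_mono hA2).trans ((measure_iUnion_le _).trans ?_)
    rw [tsum_fintype]
    simp only [Measure.prod_prod, gp_fst_cell h hν]
    simp only [Finset.sum_const, Finset.card_univ, Fintype.card_fin, nsmul_eq_mul]
    rw [← mul_assoc, ENNReal.mul_inv_cancel (by exact_mod_cast hn.ne') (by simp), one_mul]
  refine (measure_mono hsub).trans ((measure_biUnion_finset_le _ _).trans ?_)
  calc _ ≤ ∑ ab ∈ (Finset.univ.filter (fun ab : Fin v × Fin v => ab.1 ≠ ab.2)), (n : ℝ≥0∞)⁻¹ :=
        Finset.sum_le_sum fun ab hab => hpair ab (by simpa using hab)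
    _ ≤ ∑ ab : Fin v × Fin v, (n : ℝ≥0∞)⁻¹ :=
        Finset.sum_le_sum_of_subset (Finset.filter_subset _ _)
    _ = _ := by
        have hn0 : (0:ℝ) < n := by exact_mod_cast hn
        rw [ENNReal.ofReal_div_of_pos hn0]
        simp [ENNReal.div_eq_inv_mul, sq, mul_comm, ENNReal.ofReal_mul]

lemma gp_diag {X : Type*} [MeasurableSpace X] {v : ℕ} {E : Finset (Fin v × Fin v)} {D : ℕ} {p q : ℝ}
    (S : GpSetup v E D p q) {n : ℕ} {τ : ℝ → Fin n} (h : GpTau τ) {M B : ℝ} (hM : 1 ≤ M) (hB : 0 ≤ B)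
    {Q : Fin n → Fin n → ℝ} (hQ : GpKer unif01 (q * D) M (gpQ τ Q)) {φ : (Fin v → X) → ℝ}
    (hφ : Measurable φ) (hφB : ∀ y, |φ y| ≤ B) {ν : Measure (ℝ × X)} (hν : inTM ν) :
    |gpT E (gpQ τ Q) ((gpJ v τ).indicator (gpS φ)) ν - gpT E (gpQ τ Q) (gpS φ) ν| ≤
      M ^ E.card * (B * ((v : ℝ) ^ 2 / n) ^ (1 / p)) := by
  have := hν.1
  have hp1 : 0 < p := S.hpq.pos
  have hJ := gpJ_meas (X := X) (v := v) h
  have hg1 : Measurable ((gpJ v τ).indicator (gpS (X := X) φ)) := (gpS_meas hφ).indicator hJ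
  have hb1 : ∀ z, |(gpJ v τ).indicator (gpS (X := X) φ) z| ≤ B := fun z => by
    by_cases hz : z ∈ gpJ v τ
    · rw [indicator_of_mem hz]; exact hφB _
    · rw [indicator_of_notMem hz]; simpa using hB
  rw [gpT_sub (gpT_intg S hν (by linarith) hQ _ hg1 (gp_bdd_pow _ hp1 _ B hb1))
    (gpT_intg S hν (by linarith) hQ _ (gpS_meas hφ) (gp_bdd_pow _ hp1 _ B fun z => hφB _))]
  have h1 := gpT_bound' S hν hM hQ (fun z => (gpJ v τ).indicator (gpS (X := X) φ) z - gpS φ z)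
    (hg1.sub (gpS_meas hφ))
  have h2 : eLpNorm' (fun z => (gpJ v τ).indicator (gpS (X := X) φ) z - gpS φ z) p
      (Measure.pi fun _ => ν) ≤ ENNReal.ofReal (B * ((v : ℝ) ^ 2 / n) ^ (1 / p)) := by
    unfold eLpNorm'
    have h3 : ∫⁻ z, ‖(gpJ v τ).indicator (gpS (X := X) φ) z - gpS φ z‖ₑ ^ p ∂(Measure.pi fun _ => ν) ≤
        ENNReal.ofReal B ^ p * ENNReal.ofReal ((v : ℝ) ^ 2 / n) := by
      calc _ ≤ ∫⁻ z, (gpJ v τ)ᶜ.indicator (fun _ => ENNReal.ofReal B ^ p) z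
              ∂(Measure.pi fun _ : Fin v => ν) := by
            refine lintegral_mono fun z => ?_
            by_cases hz : z ∈ gpJ v τ
            · simp [hz, hp1]
            · simp only [indicator_of_notMem hz, zero_sub, enorm_neg]
              rw [indicator_of_mem (by exact hz)]
              refine ENNReal.rpow_le_rpow ?_ hp1.le
              rw [← ofReal_norm]
              exact ENNReal.ofReal_le_ofReal (hφB _)
        _ = ENNReal.ofReal B ^ p * (Measure.pi fun _ : Fin v => ν) (gpJ v τ)ᶜ := by
            rw [lintegral_indicator hJ.compl, setLIntegral_const]
        _ ≤ _ := by gcongr; exact gp_noninj h hν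
    refine (ENNReal.rpow_le_rpow h3 (by positivity)).trans (le_of_eq ?_)
    rw [ENNReal.mul_rpow_of_nonneg _ _ (by positivity), ← ENNReal.rpow_mul, mul_one_div_cancel hp1.ne',
      ENNReal.rpow_one, ENNReal.ofReal_rpow_of_nonneg (by positivity) (by positivity),
      ← ENNReal.ofReal_mul hB]
  have h4 := h1.trans (mul_le_mul_right h2 _)
  rw [← ENNReal.ofReal_mul (by positivity)] at h4
  exact (ENNReal.ofReal_le_ofReal_iff (by positivity)).1 h4

lemma gp_pi_smul {α : Type*} [MeasurableSpace α] {v : ℕ} (μ : Fin v → Measure α)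
    [∀ a, IsFiniteMeasure (μ a)] (c : ℝ≥0∞) (hc : c ≠ ⊤) :
    Measure.pi (fun a => c • μ a) = c ^ v • Measure.pi μ := by
  have : ∀ a, IsFiniteMeasure (c • μ a) := fun a => Measure.smul_finite (μ a) hc
  refine Measure.pi_eq fun s hs => ?_
  simp only [Measure.smul_apply, smul_eq_mul, Measure.pi_pi]
  rw [Finset.prod_mul_distrib]
  simp

lemma gp_part_int {Z κ : Type*} [MeasurableSpace Z] [Fintype κ] [MeasurableSpace κ]
    [MeasurableSingletonClass κ] (P : Measure Z) {C : Z → κ} (hC : Measurable C) (F : Z → ℝ)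
    (hF : Integrable F P) :
    ∫ z, F z ∂P = ∑ k, ∫ z in C ⁻¹' {k}, F z ∂P := by
  have : (univ : Set Z) = ⋃ k, C ⁻¹' {k} := by ext; simp
  rw [← setIntegral_univ, this, integral_iUnion_fintype (fun k => hC (measurableSet_singleton k))]
  · intro i j hij
    refine Set.disjoint_left.2 fun z hz hz' => hij ?_
    simp only [mem_preimage, mem_singleton_iff] at hz hz'
    exact hz.symm.trans hz'
  · exact fun _ => hF.integrableOn

lemma gp_strat_U {X : Type*} [MeasurableSpace X] {v : ℕ} (E : Finset (Fin v × Fin v)) 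
    {n : ℕ} {τ : ℝ → Fin n} (h : GpTau τ) (Q : Fin n → Fin n → ℝ) {φ : (Fin v → X) → ℝ} {B : ℝ}
    (hφ : Measurable φ) (hφB : ∀ y, |φ y| ≤ B) {ν : Measure (ℝ × X)} (hν : inTM ν) :
    ∫ z, gpU E φ Q (fun i => (z i).2) ∂(Measure.pi (gpStrat (fun z : ℝ × X => τ z.1) ν)) =
      gpT E (gpQ τ Q) ((gpJ v τ).indicator (gpS φ)) ν := by
  classical
  have := hν.1
  have hn := h.pos
  have hn0 : (n : ℝ) ≠ 0 := by exact_mod_cast hn.ne'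
  set τ' : ℝ × X → Fin n := fun z => τ z.1 with hτ'
  have hτm' : Measurable τ' := h.meas.comp measurable_fst
  have hP : ∀ i, IsProbabilityMeasure (gpStrat τ' ν i) := fun i => gpStrat_prob i (gp_fst_cell h hν i)
  have hSm : Measurable (gpS (X := X) φ) := gpS_meas hφ
  have hSi : ∀ P : Measure (Fin v → ℝ × X), IsFiniteMeasure P → Integrable (gpS φ) P := fun P _ =>
    Integrable.of_bound hSm.aestronglyMeasurable B (Eventually.of_forall fun z => hφB _)
  -- left side
  have hcompm : ∀ i : Fin v → Fin n, Measurable (fun z : Fin n → ℝ × X => z ∘ i) := fun i => by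
    refine measurable_pi_lambda _ fun a => ?_
    exact measurable_pi_apply _
  have hterm : ∀ i : Fin v → Fin n, Function.Injective i →
      ∫ z, gpS φ (z ∘ i) ∂(Measure.pi (gpStrat τ' ν)) =
        (n : ℝ) ^ v * ∫ z in (fun (z : Fin v → ℝ × X) a => τ' (z a)) ⁻¹' {i}, gpS φ z
          ∂(Measure.pi fun _ => ν) := by
    intro i hi
    have e1 : ∫ z, gpS φ (z ∘ i) ∂(Measure.pi (gpStrat τ' ν)) =
        ∫ y, gpS φ y ∂(Measure.pi fun a => gpStrat τ' ν (i a)) := by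
      rw [← gp_marginal (gpStrat τ' ν) i hi,
        integral_map (hcompm i).aemeasurable hSm.aestronglyMeasurable]
    rw [e1]
    unfold gpStrat
    rw [gp_pi_smul (fun a => ν.restrict (τ' ⁻¹' {i a})) _ (by simp), ← Measure.restrict_pi_pi,
      integral_smul_measure]
    have e2 : (fun (z : Fin v → ℝ × X) a => τ' (z a)) ⁻¹' {i} = Set.pi univ (fun a => τ' ⁻¹' {i a}) := by
      ext z
      simp only [mem_preimage, mem_singleton_iff, Set.mem_pi, mem_univ, true_implies, funext_iff]
    rw [e2]
    simp
  have hL : ∫ z, gpU E φ Q (fun i => (z i).2) ∂(Measure.pi (gpStrat τ' ν)) =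
      ∑ i ∈ Finset.univ.filter (fun i : Fin v → Fin n => Function.Injective i),
        (∏ e ∈ E, Q (i e.1) (i e.2)) *
        ∫ z in (fun (z : Fin v → ℝ × X) a => τ' (z a)) ⁻¹' {i}, gpS φ z ∂(Measure.pi fun _ => ν) := by
    have : ∀ z : Fin n → ℝ × X, gpU E φ Q (fun i => (z i).2) =
        ∑ i ∈ Finset.univ.filter (fun i : Fin v → Fin n => Function.Injective i),
          ((∏ e ∈ E, Q (i e.1) (i e.2)) / (n : ℝ) ^ v) * gpS φ (z ∘ i) := fun z => by
      unfold gpU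
      rw [Finset.sum_div]
      refine Finset.sum_congr rfl fun i _ => ?_
      have : gpS φ (z ∘ i) = φ ((fun i => (z i).2) ∘ i) := rfl
      rw [this]; ring
    simp_rw [this]
    rw [integral_finsetSum]
    · refine Finset.sum_congr rfl fun i hi => ?_
      rw [integral_const_mul, hterm i (by simpa using hi)]
      field_simp
    · intro i _
      refine Integrable.const_mul ?_ _
      exact Integrable.of_bound (hSm.comp (hcompm i)).aestronglyMeasurable B
        (Eventually.of_forall fun z => hφB _)
  rw [hL]
  unfold gpT
  have hCm : Measurable (fun (z : Fin v → ℝ × X) a => τ' (z a)) := by fun_prop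
  have hJ := gpJ_meas (X := X) (v := v) h
  have hQm : Measurable (fun z : Fin v → ℝ × X => ∏ e ∈ E, gpQ τ Q (z e.1).1 (z e.2).1) := by
    have : (fun z : Fin v → ℝ × X => ∏ e ∈ E, gpQ τ Q (z e.1).1 (z e.2).1) =
      (fun k : Fin v → Fin n => ∏ e ∈ E, Q (k e.1) (k e.2)) ∘ (fun z a => τ' (z a)) := rfl
    rw [this]
    exact (measurable_of_finite _).comp hCm
  have hcell : ∀ (i : Fin v → Fin n) (z : Fin v → ℝ × X),
      z ∈ (fun (z : Fin v → ℝ × X) a => τ' (z a)) ⁻¹' {i} →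
      (gpJ v τ).indicator (gpS φ) z * ∏ e ∈ E, gpQ τ Q (z e.1).1 (z e.2).1 =
        if Function.Injective i then (∏ e ∈ E, Q (i e.1) (i e.2)) * gpS φ z else 0 := by
    intro i z hz
    simp only [mem_preimage, mem_singleton_iff] at hz
    subst hz
    by_cases hi : Function.Injective fun a => τ' (z a)
    · rw [if_pos hi, indicator_of_mem (by exact hi)]
      rw [mul_comm]; rfl
    · rw [if_neg hi, indicator_of_notMem (by exact hi), zero_mul]
  rw [gp_part_int _ hCm]
  · rw [Finset.sum_filter]
    refine Finset.sum_congr rfl fun i _ => ?_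
    rw [setIntegral_congr_fun (hCm (measurableSet_singleton i)) (hcell i)]
    split_ifs with hi
    · rw [integral_const_mul]
    · simp
  · refine Integrable.of_bound (((hSm.indicator hJ).mul hQm).aestronglyMeasurable)
      (∑ k : Fin v → Fin n, |∏ e ∈ E, Q (k e.1) (k e.2)| * B) (Eventually.of_forall fun z => ?_)
    rw [hcell (fun a => τ' (z a)) z rfl]
    have hB0 : 0 ≤ B := (abs_nonneg _).trans (hφB (fun a => (z a).2))
    refine le_trans ?_ (Finset.single_le_sum
      (f := fun k : Fin v → Fin n => |∏ e ∈ E, Q (k e.1) (k e.2)| * B)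
      (fun k _ => by positivity) (Finset.mem_univ (fun a => τ' (z a))))
    split_ifs
    · rw [norm_mul]
      exact mul_le_mul_of_nonneg_left (hφB _) (norm_nonneg _)
    · simp; positivity

lemma gpU_bdd {X : Type*} {v : ℕ} (E : Finset (Fin v × Fin v)) 
    {n : ℕ} (Q : Fin n → Fin n → ℝ) {φ : (Fin v → X) → ℝ} {B : ℝ} (hφB : ∀ y, |φ y| ≤ B) :
    ∃ C, ∀ x, |gpU E φ Q x| ≤ C := by
  refine ⟨(∑ i ∈ Finset.univ.filter (fun i : Fin v → Fin n => Function.Injective i),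
      B * |∏ e ∈ E, Q (i e.1) (i e.2)|) / (n : ℝ) ^ v, fun x => ?_⟩
  unfold gpU
  rw [abs_div, abs_of_nonneg (by positivity : (0:ℝ) ≤ (n:ℝ) ^ v)]
  gcongr
  refine (Finset.abs_sum_le_sum_abs _ _).trans (Finset.sum_le_sum fun i _ => ?_)
  rw [abs_mul]
  gcongr
  exact hφB _

lemma gp_rho_TM {X : Type*} [MeasurableSpace X] (μ : Measure X) [IsProbabilityMeasure μ] :
    inTM (unif01.prod μ) := ⟨inferInstance, by simp⟩

lemma gp_lower {X : Type*} [MeasurableSpace X] (μ : Measure X) [IsProbabilityMeasure μ]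
    {v : ℕ} (E : Finset (Fin v × Fin v)) 
    {n : ℕ} {τ : ℝ → Fin n} (h : GpTau τ) (Q : Fin n → Fin n → ℝ) {φ : (Fin v → X) → ℝ} {B : ℝ}
    (hφ : Measurable φ) (hφB : ∀ y, |φ y| ≤ B) {ν : Measure (ℝ × X)} (hν : inTM ν)
    (hKL : InformationTheory.klDiv ν (unif01.prod μ) ≠ ⊤) (θ : ℝ) :
    n * (θ * gpT E (gpQ τ Q) ((gpJ v τ).indicator (gpS φ)) ν) ≤
      n * (InformationTheory.klDiv ν (unif01.prod μ)).toReal +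
      Real.log (∫ x, Real.exp (n * (θ * gpU E φ Q x)) ∂(Measure.pi fun _ : Fin n => μ)) := by
  have := hν.1
  obtain ⟨C, hC⟩ := gpU_bdd E Q hφB
  set τ' : ℝ × X → Fin n := fun z => τ z.1 with hτ'
  have hτm' : Measurable τ' := h.meas.comp measurable_fst
  have hsnd : Measurable (fun (z : Fin n → ℝ × X) i => (z i).2) := by fun_prop
  have hUm : Measurable (gpU E φ Q) := gpU_meas E hφ Q
  have h1 := gp_gibbs_lower ν (unif01.prod μ) τ' hτm' (gp_fst_cell h hν) (gp_fst_cell h (gp_rho_TM μ))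
    hKL (fun z => n * (θ * gpU E φ Q (fun i => (z i).2)))
    (((hUm.comp hsnd).const_mul θ).const_mul _) (n * (|θ| * C)) (fun z => by
      rw [abs_mul, abs_mul, Nat.abs_cast]
      gcongr
      exact hC _)
  rw [integral_const_mul, integral_const_mul, gp_strat_U E h Q hφ hφB hν] at h1
  have hPρ : ∀ i, IsProbabilityMeasure (gpStrat τ' (unif01.prod μ) i) := fun i =>
    gpStrat_prob i (gp_fst_cell h (gp_rho_TM μ) i)
  have hmapi : ∀ i, (gpStrat τ' (unif01.prod μ) i).map Prod.snd = μ := by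
    intro i
    ext s hs
    have hms := h.meas (measurableSet_singleton i)
    rw [Measure.map_apply measurable_snd hs]
    unfold gpStrat
    rw [Measure.smul_apply, Measure.restrict_apply (measurable_snd hs)]
    have : (Prod.snd ⁻¹' s ∩ τ' ⁻¹' {i} : Set (ℝ × X)) = (τ ⁻¹' {i}) ×ˢ s := by
      ext z
      simp only [mem_inter_iff, mem_preimage, mem_prod, and_comm]; rfl
    rw [this, Measure.prod_prod, h.unif, smul_eq_mul, ← mul_assoc,
      ENNReal.mul_inv_cancel (by exact_mod_cast h.pos.ne') (by simp), one_mul]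
  have hmap : (Measure.pi (gpStrat τ' (unif01.prod μ))).map (fun (z : Fin n → ℝ × X) i => (z i).2) =
      Measure.pi fun _ : Fin n => μ := by
    have hp : ∀ i, IsProbabilityMeasure ((gpStrat τ' (unif01.prod μ) i).map Prod.snd) := fun i => by
      rw [hmapi i]; infer_instance
    rw [Measure.pi_map_pi (μ := gpStrat τ' (unif01.prod μ)) (f := fun _ => Prod.snd)
      (fun _ => measurable_snd.aemeasurable)]
    congr 1
    ext1 i
    exact hmapi i
  rw [← hmap, integral_map hsnd.aemeasurable]
  · exact h1
  · exact ((hUm.const_mul θ).const_mul _).exp.aestronglyMeasurable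

/-- Relative entropy as a real number. -/
noncomputable def gpKL {X : Type*} [MeasurableSpace X] (μ : Measure X) (ν : Measure (ℝ × X)) : ℝ :=
  (InformationTheory.klDiv ν (unif01.prod μ)).toReal

/-- Unnormalized log partition function. -/
noncomputable def gpLam {X : Type*} [MeasurableSpace X] (μ : Measure X) {v : ℕ}
    (E : Finset (Fin v × Fin v)) (θ : ℝ) (φ : (Fin v → X) → ℝ) {n : ℕ} (Q : Fin n → Fin n → ℝ) : ℝ :=
  Real.log (∫ x, Real.exp (n * (θ * gpU E φ Q x)) ∂(Measure.pi fun _ : Fin n => μ))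

lemma gp_pert {X : Type*} [MeasurableSpace X] {μ : Measure X} [IsProbabilityMeasure μ]
    {v : ℕ} {E : Finset (Fin v × Fin v)} {D : ℕ} {p q : ℝ} {φ : (Fin v → X) → ℝ} {ψ : X → ℝ}
    (d : GpData μ E D p q φ ψ) {M : ℝ} (hM : 1 ≤ M) (θ : ℝ) {ε : ℝ} (hε : 0 < ε) :
    ∃ B : ℝ, 0 ≤ B ∧ ∃ m : ℕ, ∃ c : X → Fin m, Measurable c ∧ ∃ h : (Fin v → Fin m) → ℝ,
      (∀ k, |h k| ≤ B) ∧
      (∀ (n : ℕ) (τ : ℝ → Fin n) (Q : Fin n → Fin n → ℝ), GpTau τ →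
        GpKer unif01 (q * D) M (gpQ τ Q) →
        |gpLam μ E θ (fun y => h (fun a => c (y a))) Q - gpLam μ E θ φ Q| ≤ n * ε) ∧
      (∀ (w : ℝ → ℝ → ℝ) (ν : Measure (ℝ × X)), GpKer unif01 (q * D) M w → inTM ν →
        InformationTheory.klDiv ν (unif01.prod μ) ≠ ⊤ →
        |θ * gpT E w (gpS φ) ν - θ * gpT E w (gpS (fun y => h (fun a => c (y a)))) ν| ≤
          ε * (gpKL μ ν + 1)) := by
  set ME := M ^ E.card with hME
  have hME1 : 1 ≤ ME := one_le_pow₀ hM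
  set A1 := gpA μ ψ p 1 with hA1
  have hA1' : 1 ≤ A1 := gpA_one_le d zero_le_one
  set C := max 2 (max (gpA μ ψ p (4 * |θ| * ME)) (Real.exp 1 * (A1 + 3))) with hC
  have hC2 : 2 ≤ C := le_max_left _ _
  have hlogC : 0 < Real.log C := Real.log_pos (by linarith)
  set t := min 1 (ε / (6 * Real.log C)) with ht
  have ht0 : 0 < t := lt_min one_pos (by positivity)
  have ht1 : t ≤ 1 := min_le_left _ _
  have ht2 : 6 * t * Real.log C ≤ ε := by
    have : t ≤ ε / (6 * Real.log C) := min_le_right _ _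
    rw [le_div_iff₀ (by positivity)] at this
    linarith
  set L := (4 * |θ| + 1) / t with hL
  have hL0 : 0 < L := by positivity
  set a1 := 2 * L * ME * v + 1 with ha1
  set a2 := |θ| * ME * (v + 3) * (A1 + 1) + 1 with ha2
  have ha1p : 0 < a1 := by positivity
  have ha2p : 0 < a2 := by positivity
  set δ := min (1 / a1) (ε / a2) with hδ
  have hδ0 : 0 < δ := lt_min (by positivity) (by positivity)
  have hδ1 : 2 * L * ME * v * δ ≤ 1 := by
    have : δ ≤ 1 / a1 := min_le_left _ _
    rw [le_div_iff₀ ha1p] at this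
    nlinarith
  have hδ2 : |θ| * ME * (v + 3) * (A1 + 1) * δ ≤ ε := by
    have : δ ≤ ε / a2 := min_le_right _ _
    rw [le_div_iff₀ ha2p] at this
    nlinarith
  obtain ⟨K, hK0, hK⟩ := gp_tail_K d δ
  obtain ⟨η1, hη1, h1⟩ := gp_dyn_approx d hM hL0 hδ0 hδ1 hK0 hK
  obtain ⟨η2, hη2, h2⟩ := gp_static_approx d hδ0 hK0 hK
  obtain ⟨m, c, hc, h, hhB, hh⟩ := gp_approx_bdd μ (gpCut ψ K φ) (gpCut_meas d.hψ K d.hφ) (K ^ v)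
    (gpCut_abs d.hψ0 hK0 d.hdom) (ENNReal.ofReal (min η1 η2)) (by
      simp only [ne_eq, ENNReal.ofReal_eq_zero, not_le]; exact lt_min hη1 hη2)
  set φ' : (Fin v → X) → ℝ := fun y => h (fun a => c (y a)) with hφ'
  have hφ'm : Measurable φ' := (measurable_of_finite h).comp (by fun_prop)
  have hφ'B : ∀ y, |φ' y| ≤ K ^ v := fun y => hhB _
  refine ⟨K ^ v, by positivity, m, c, hc, h, hhB, ?_, ?_⟩
  · intro n τ Q hτ hQ
    have hn := hτ.pos
    have hr := h1 φ' hφ'm hφ'B (hh.trans (ENNReal.ofReal_le_ofReal (min_le_left _ _))) n τ Q hτ hQ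
    have hUm := gpU_meas E d.hφ Q
    have hUm' := gpU_meas E hφ'm Q
    have key := gp_log_pert2 (P := Measure.pi fun _ : Fin n => μ)
      (F := fun x => n * (θ * gpU E φ Q x)) (G := fun x => n * (θ * gpU E φ' Q x))
      ((hUm.const_mul θ).const_mul _) ((hUm'.const_mul θ).const_mul _) ht0 ht1 hC2 hn ?_ ?_
    · refine key.trans ?_
      have : 6 * t * n * Real.log C = n * (6 * t * Real.log C) := by ring
      rw [this]
      gcongr
    · have h3 := gp_dyn_full d hM hτ hQ (L := 4 * |θ|) (by positivity)
      refine le_trans (le_of_eq ?_) (h3.trans ?_)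
      · refine lintegral_congr fun x => ?_
        congr 2
        rw [abs_mul, abs_mul, Nat.abs_cast]; ring
      · rw [ENNReal.ofReal_pow (by linarith)]
        gcongr
        exact (le_max_left _ _).trans (le_max_right _ _)
    · refine le_trans ?_ (hr.trans ?_)
      · refine lintegral_mono fun x => ENNReal.ofReal_le_ofReal (Real.exp_le_exp.2 ?_)
        have e1 : (n:ℝ) * (θ * gpU E φ' Q x) - n * (θ * gpU E φ Q x) =
          n * (θ * (gpU E φ' Q x - gpU E φ Q x)) := by ring
        rw [e1, abs_mul, abs_mul, Nat.abs_cast, abs_sub_comm (gpU E φ Q x)]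
        have e2 : 4 * ((n:ℝ) * (|θ| * |gpU E φ' Q x - gpU E φ Q x|) / t) =
          n * ((4 * |θ|) / t * |gpU E φ' Q x - gpU E φ Q x|) := by ring
        rw [e2, hL]
        gcongr
        linarith
      · rw [ENNReal.ofReal_pow (by linarith)]
        gcongr
        exact (le_max_right _ _).trans (le_max_right _ _)
  · intro w ν hw hν hKL
    have h3 := h2 φ' hφ'm hφ'B (hh.trans (ENNReal.ofReal_le_ofReal (min_le_right _ _))) M w ν hM hw hν hKL
    rw [← mul_sub, abs_mul]
    have hk0 : 0 ≤ gpKL μ ν := ENNReal.toReal_nonneg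
    change _ ≤ ME * (δ * (v + 3) * (A1 + 1) * (gpKL μ ν + 1)) at h3
    calc |θ| * |gpT E w (gpS φ) ν - gpT E w (gpS φ') ν| ≤
        |θ| * (ME * (δ * (v + 3) * (A1 + 1) * (gpKL μ ν + 1))) := by gcongr
      _ = |θ| * ME * (v + 3) * (A1 + 1) * δ * (gpKL μ ν + 1) := by ring
      _ ≤ _ := by gcongr

lemma gp_bounded_case {X : Type*} [MeasurableSpace X] {μ : Measure X} [IsProbabilityMeasure μ]
    {v : ℕ} {E : Finset (Fin v × Fin v)} {D : ℕ} {p q : ℝ}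
    (S : GpSetup v E D p q) {M : ℝ} (hM : 1 ≤ M) (θ : ℝ) {ε : ℝ} (hε : 0 < ε)
    {W : ℝ → ℝ → ℝ} (hW : GpKer unif01 (q * D) M W)
    (hstep : ∀ η > 0, ∃ m : ℕ, ∃ c : ℝ → Fin m, Measurable c ∧ ∃ ω : Fin m → Fin m → ℝ,
      GpKer unif01 (q * D) M (fun s t => ω (c s) (c t)) ∧ GpCut W (fun s t => ω (c s) (c t)) η)
    {B : ℝ} (hB : 0 ≤ B) {m : ℕ} {c : X → Fin m} (hc : Measurable c) (h : (Fin v → Fin m) → ℝ)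
    (hhB : ∀ k, |h k| ≤ B) :
    ∃ η > 0, ∃ N : ℕ, ∀ n ≥ N, ∀ (τ : ℝ → Fin n) (Q : Fin n → Fin n → ℝ), GpTau τ →
      GpKer unif01 (q * D) M (gpQ τ Q) → GpCut (gpQ τ Q) W η →
      (∀ Z : ℝ, (∀ ν : Measure (ℝ × X), inTM ν → InformationTheory.klDiv ν (unif01.prod μ) ≠ ⊤ →
          θ * gpT E W (gpS (fun y => h (fun a => c (y a)))) ν - gpKL μ ν ≤ Z) →
        gpLam μ E θ (fun y => h (fun a => c (y a))) Q ≤ n * (Z + ε)) ∧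
      (∀ ν : Measure (ℝ × X), inTM ν → InformationTheory.klDiv ν (unif01.prod μ) ≠ ⊤ →
        n * (θ * gpT E W (gpS (fun y => h (fun a => c (y a)))) ν - gpKL μ ν - ε) ≤
          gpLam μ E θ (fun y => h (fun a => c (y a))) Q) := by
  set φ' : (Fin v → X) → ℝ := fun y => h (fun a => c (y a)) with hφ'
  have hφ'm : Measurable φ' := (measurable_of_finite h).comp (by fun_prop)
  have hφ'B : ∀ y, |φ' y| ≤ B := fun y => hhB _
  have hM0 : 0 ≤ M := by linarith
  have hr := S.one_le_r
  set ε1 := ε / (5 * (|θ| + 1)) with hε1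
  have hε10 : 0 < ε1 := by positivity
  have hθε : |θ| * ε1 ≤ ε / 5 := by
    have e : |θ| * ε1 = (|θ| / (|θ| + 1)) * (ε / 5) := by rw [hε1]; field_simp
    rw [e]
    have : |θ| / (|θ| + 1) ≤ 1 := by
      rw [div_le_one (by positivity)]; linarith
    nlinarith
  have hθ' : ∀ a b : ℝ, |a - b| ≤ ε1 → θ * a ≤ θ * b + ε / 5 := by
    intro a b hab
    have h1 : θ * a - θ * b ≤ |θ| * |a - b| := by
      rw [← mul_sub, ← abs_mul]; exact le_abs_self _
    have h2 : |θ| * |a - b| ≤ |θ| * ε1 := by gcongr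
    linarith
  obtain ⟨η0, hη0, hcount⟩ := gp_counting S hM0 c hc h ε1 hε10
  obtain ⟨k, dd, hdd, ω, hω, hωc⟩ := hstep (η0 / 2) (by positivity)
  obtain ⟨F, hF, hFT⟩ := gp_finite_form E hdd hc ω h
  have hem : Measurable (fun z : ℝ × X => (dd z.1, c z.2)) := by fun_prop
  obtain ⟨K, hK, hmf⟩ := gp_meanfield μ hem (fun N => θ * F N) (hF.const_mul θ |> fun h => h)
    (ε := ε / 5) (by positivity)
  have hlim1 : Tendsto (fun n : ℕ => M ^ E.card * (B * ((v : ℝ) ^ 2 / n) ^ (1 / p))) atTop (nhds 0) := by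
    have h1 : Tendsto (fun n : ℕ => (v : ℝ) ^ 2 / n) atTop (nhds 0) :=
      tendsto_const_div_atTop_nhds_zero_nat _
    have hp : 0 < 1 / p := one_div_pos.2 S.hpq.pos
    have h2 := (h1.rpow_const (p := 1 / p) (Or.inr hp.le))
    rw [Real.zero_rpow hp.ne'] at h2
    simpa using (h2.const_mul B).const_mul (M ^ E.card)
  have hlim2 : Tendsto (fun n : ℕ => Real.log K / n) atTop (nhds 0) :=
    tendsto_const_div_atTop_nhds_zero_nat _
  obtain ⟨N, hN⟩ := eventually_atTop.1 ((hlim1.eventually (gt_mem_nhds hε10)).and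
    (hlim2.eventually (gt_mem_nhds (show 0 < ε / 5 by positivity))))
  refine ⟨η0 / 2, by positivity, N, fun n hn τ Q hτ hQ hQW => ?_⟩
  obtain ⟨hN1, hN2⟩ := hN n hn
  have hn0 : (0:ℝ) < n := by exact_mod_cast hτ.pos
  rw [div_lt_iff₀ hn0] at hN2
  have hdiag : ∀ ν : Measure (ℝ × X), inTM ν →
      |gpT E (gpQ τ Q) ((gpJ v τ).indicator (gpS φ')) ν - gpT E (gpQ τ Q) (gpS φ') ν| ≤ ε1 :=
    fun ν hν => (gp_diag S hτ hM hB hQ hφ'm hφ'B hν).trans hN1.le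
  have hWi := gp_ker_int unif01 hr _ hW
  have hωi := gp_ker_int unif01 hr _ hω
  have hQi := gp_ker_int unif01 hr _ hQ
  have hmono : ∀ {w w' : ℝ → ℝ → ℝ} {a b : ℝ}, a ≤ b → GpCut w w' a → GpCut w w' b :=
    fun hab hcut S T hS hT => (hcut S T hS hT).trans hab
  have hQω : ∀ ν : Measure (ℝ × X), inTM ν → |gpT E (gpQ τ Q) (gpS φ') ν -
      gpT E (fun s t => ω (dd s) (dd t)) (gpS φ') ν| ≤ ε1 :=
    hcount _ _ hQ hω (hmono (by linarith) (gpCut_trans hQi hWi hωi hQW hωc))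
  have hQW' : ∀ ν : Measure (ℝ × X), inTM ν → |gpT E W (gpS φ') ν - gpT E (gpQ τ Q) (gpS φ') ν| ≤ ε1 :=
    hcount _ _ hW hQ (hmono (by linarith) (gpCut_symm hQi hWi hQW))
  have hωW : ∀ ν : Measure (ℝ × X), inTM ν →
      |gpT E (fun s t => ω (dd s) (dd t)) (gpS φ') ν - gpT E W (gpS φ') ν| ≤ ε1 :=
    hcount _ _ hω hW (hmono (by linarith) (gpCut_symm hWi hωi hωc))
  constructor
  · intro Z hZ
    have hmf' := hmf n τ hτ (Z + ε / 5) (fun ν hν hKL => by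
      have h1 := hZ ν hν hKL
      have h2 := hθ' _ _ (hωW ν hν)
      have := hν.1
      rw [hFT ν hν.1] at h2
      unfold gpKL at h1
      linarith)
    have hpt : ∀ x : Fin n → X, n * (θ * gpU E φ' Q x) ≤ n * (2 * ε / 5) +
        n * (θ * F (fun j => (gpEmp τ x).real ((fun z : ℝ × X => (dd z.1, c z.2)) ⁻¹' {j}))) := by
      intro x
      have hx := gpEmp_inTM hτ x
      rw [← mul_add]
      gcongr
      rw [← hFT _ hx.1, gpU_eq hτ E hφ'm Q x]
      have h1 := hθ' _ _ (hdiag _ hx)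
      have h2 := hθ' _ _ (hQω _ hx)
      linarith
    have hlint : ∫⁻ x, ENNReal.ofReal (Real.exp (n * (θ * gpU E φ' Q x)))
        ∂(Measure.pi fun _ : Fin n => μ) ≤
        ENNReal.ofReal (Real.exp (n * (2 * ε / 5)) * (K * Real.exp (n * (Z + ε / 5 + ε / 5)))) := by
      calc _ ≤ ∫⁻ x, ENNReal.ofReal (Real.exp (n * (2 * ε / 5))) * ENNReal.ofReal (Real.exp
            (n * (θ * F (fun j => (gpEmp τ x).real ((fun z : ℝ × X => (dd z.1, c z.2)) ⁻¹' {j})))))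
              ∂(Measure.pi fun _ : Fin n => μ) := by
            refine lintegral_mono fun x => ?_
            rw [← ENNReal.ofReal_mul (Real.exp_pos _).le, ← Real.exp_add]
            exact ENNReal.ofReal_le_ofReal (Real.exp_le_exp.2 (hpt x))
        _ = ENNReal.ofReal (Real.exp (n * (2 * ε / 5))) * ∫⁻ x, ENNReal.ofReal (Real.exp
            (n * (θ * F (fun j => (gpEmp τ x).real ((fun z : ℝ × X => (dd z.1, c z.2)) ⁻¹' {j})))))
              ∂(Measure.pi fun _ : Fin n => μ) := lintegral_const_mul' _ _ ENNReal.ofReal_ne_top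
        _ ≤ ENNReal.ofReal (Real.exp (n * (2 * ε / 5))) *
            (K * ENNReal.ofReal (Real.exp (n * (Z + ε / 5 + ε / 5)))) := by gcongr
        _ = _ := by
            rw [ENNReal.ofReal_mul (p := Real.exp (n * (2 * ε / 5))) (Real.exp_pos _).le,
              ENNReal.ofReal_mul (p := (K:ℝ)) (by positivity), ENNReal.ofReal_natCast]
    have hUm' := gpU_meas E hφ'm Q
    have hIm : Measurable (fun x => Real.exp (n * (θ * gpU E φ' Q x))) :=
      ((hUm'.const_mul θ).const_mul _).exp
    have hK0 : (0:ℝ) < K := by exact_mod_cast hK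
    have hI : ∫ x, Real.exp (n * (θ * gpU E φ' Q x)) ∂(Measure.pi fun _ : Fin n => μ) ≤
        Real.exp (n * (2 * ε / 5)) * (K * Real.exp (n * (Z + ε / 5 + ε / 5))) := by
      rw [integral_eq_lintegral_of_nonneg_ae (Eventually.of_forall fun x => (Real.exp_pos _).le)
        hIm.aestronglyMeasurable]
      exact ENNReal.toReal_le_of_le_ofReal (by positivity) hlint
    have hbdd := gpU_bdd E Q hφ'B
    obtain ⟨Cb, hCb⟩ := hbdd
    have hIntegr : Integrable (fun x => Real.exp (n * (θ * gpU E φ' Q x)))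
        (Measure.pi fun _ : Fin n => μ) :=
      ⟨hIm.aestronglyMeasurable, by
        rw [hasFiniteIntegral_iff_ofReal (Eventually.of_forall fun x => (Real.exp_pos _).le)]
        exact hlint.trans_lt ENNReal.ofReal_lt_top⟩
    have hpos : 0 < ∫ x, Real.exp (n * (θ * gpU E φ' Q x)) ∂(Measure.pi fun _ : Fin n => μ) :=
      integral_exp_pos hIntegr
    have hlog := Real.log_le_log hpos hI
    rw [Real.log_mul (Real.exp_pos _).ne' (by positivity), Real.log_mul hK0.ne' (Real.exp_pos _).ne',
      Real.log_exp, Real.log_exp] at hlog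
    unfold gpLam
    refine hlog.trans ?_
    linarith
  · intro ν hν hKL
    have h1 := gp_lower μ E hτ Q hφ'm hφ'B hν hKL θ
    have h2 := hθ' _ _ (hQW' ν hν)
    have h3 := hθ' _ _ (by rw [abs_sub_comm]; exact hdiag ν hν)
    have h4 : θ * gpT E W (gpS φ') ν - gpKL μ ν - ε ≤
      θ * gpT E (gpQ τ Q) ((gpJ v τ).indicator (gpS φ')) ν - gpKL μ ν := by linarith
    have h5 := mul_le_mul_of_nonneg_left h4 hn0.le
    refine h5.trans ?_
    unfold gpLam gpKL
    linarith

/-- The variational set. -/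
def gpZ {X : Type*} [MeasurableSpace X] (μ : Measure X) {v : ℕ}
    (E : Finset (Fin v × Fin v)) (θ : ℝ) (φ : (Fin v → X) → ℝ) (W : ℝ → ℝ → ℝ) : Set ℝ :=
  {z | ∃ ν : Measure (ℝ × X), inTM ν ∧ InformationTheory.klDiv ν (unif01.prod μ) ≠ ⊤ ∧
    z = θ * gpT E W (gpS φ) ν - gpKL μ ν}

lemma gpZ_nonempty {X : Type*} [MeasurableSpace X] (μ : Measure X) [IsProbabilityMeasure μ] {v : ℕ}
    (E : Finset (Fin v × Fin v)) (θ : ℝ) (φ : (Fin v → X) → ℝ) (W : ℝ → ℝ → ℝ) :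
    (gpZ μ E θ φ W).Nonempty :=
  ⟨_, unif01.prod μ, gp_rho_TM μ, by simp [InformationTheory.klDiv_self], rfl⟩

lemma gp_half_bound {X : Type*} [MeasurableSpace X] {μ : Measure X} [IsProbabilityMeasure μ]
    {v : ℕ} {E : Finset (Fin v × Fin v)} {D : ℕ} {p q : ℝ} {φ : (Fin v → X) → ℝ} {ψ : X → ℝ}
    (d : GpData μ E D p q φ ψ) {M : ℝ} (hM : 1 ≤ M) (θ : ℝ) :
    ∃ A : ℝ, 0 ≤ A ∧ ∀ (w : ℝ → ℝ → ℝ) (ν : Measure (ℝ × X)), GpKer unif01 (q * D) M w → inTM ν →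
      InformationTheory.klDiv ν (unif01.prod μ) ≠ ⊤ →
      θ * gpT E w (gpS φ) ν ≤ (gpKL μ ν + A) / 2 := by
  set ME := M ^ E.card with hME
  have hME1 : 1 ≤ ME := one_le_pow₀ hM
  set L := 2 * (|θ| + 1) * ME with hL
  have hL0 : 0 < L := by positivity
  have hA := gpA_one_le d hL0.le
  refine ⟨gpA μ ψ p L, by linarith, fun w ν hw hν hKL => ?_⟩
  have h1 := (gp_static_bound d hM hw hν hKL hL0).1
  have hk0 : 0 ≤ gpKL μ ν := ENNReal.toReal_nonneg
  change _ ≤ ME / L * (gpKL μ ν + gpA μ ψ p L) at h1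
  have h2 : |θ| * (ME / L) ≤ 1 / 2 := by
    rw [hL, ← mul_div_assoc, div_le_iff₀ (by positivity)]
    nlinarith
  calc θ * gpT E w (gpS φ) ν ≤ |θ| * |gpT E w (gpS φ) ν| := by
        rw [← abs_mul]; exact le_abs_self _
    _ ≤ |θ| * (ME / L * (gpKL μ ν + gpA μ ψ p L)) := by gcongr
    _ = |θ| * (ME / L) * (gpKL μ ν + gpA μ ψ p L) := by ring
    _ ≤ 1 / 2 * (gpKL μ ν + gpA μ ψ p L) := by gcongr
    _ = _ := by ring

lemma gpZ_bdd {X : Type*} [MeasurableSpace X] {μ : Measure X} [IsProbabilityMeasure μ]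
    {v : ℕ} {E : Finset (Fin v × Fin v)} {D : ℕ} {p q : ℝ} {φ : (Fin v → X) → ℝ} {ψ : X → ℝ}
    (d : GpData μ E D p q φ ψ) {M : ℝ} (hM : 1 ≤ M) (θ : ℝ) {W : ℝ → ℝ → ℝ}
    (hW : GpKer unif01 (q * D) M W) : BddAbove (gpZ μ E θ φ W) := by
  obtain ⟨A, hA, h⟩ := gp_half_bound d hM θ
  refine ⟨A / 2, ?_⟩
  rintro z ⟨ν, hν, hKL, rfl⟩
  have := h W ν hW hν hKL
  have hk0 : 0 ≤ gpKL μ ν := ENNReal.toReal_nonneg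
  linarith

lemma gp_core {X : Type*} [MeasurableSpace X] {μ : Measure X} [IsProbabilityMeasure μ]
    {v : ℕ} {E : Finset (Fin v × Fin v)} {D : ℕ} {p q : ℝ} {φ : (Fin v → X) → ℝ} {ψ : X → ℝ}
    (d : GpData μ E D p q φ ψ) {M : ℝ} (hM : 1 ≤ M) (θ : ℝ) {W : ℝ → ℝ → ℝ}
    (hW : GpKer unif01 (q * D) M W)
    (hstep : ∀ η > 0, ∃ m : ℕ, ∃ c : ℝ → Fin m, Measurable c ∧ ∃ ω : Fin m → Fin m → ℝ,
      GpKer unif01 (q * D) M (fun s t => ω (c s) (c t)) ∧ GpCut W (fun s t => ω (c s) (c t)) η)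
    {ε : ℝ} (hε : 0 < ε) :
    ∃ η > 0, ∃ N : ℕ, ∀ n ≥ N, ∀ (τ : ℝ → Fin n) (Q : Fin n → Fin n → ℝ), GpTau τ →
      GpKer unif01 (q * D) M (gpQ τ Q) → GpCut (gpQ τ Q) W η →
      |(n : ℝ)⁻¹ * gpLam μ E θ φ Q - sSup (gpZ μ E θ φ W)| ≤ ε := by
  obtain ⟨A, hA, hhalf⟩ := gp_half_bound d hM θ
  have hne := gpZ_nonempty μ E θ φ W
  have hbd := gpZ_bdd d hM θ hW
  set Z := sSup (gpZ μ E θ φ W) with hZ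
  obtain ⟨z0, ⟨ν0, hν0, hKL0, rfl⟩, hz0⟩ := exists_lt_of_lt_csSup hne (show Z - ε / 2 < Z by linarith)
  set k0 := gpKL μ ν0 with hk0
  have hk00 : 0 ≤ k0 := ENNReal.toReal_nonneg
  set C1 := 2 * A + 4 * |Z| with hC1
  have hC10 : 0 ≤ C1 := by positivity
  set ε' := min (1 / 4) (ε / (2 * (k0 + C1 + 3))) with hε'
  have hε'0 : 0 < ε' := lt_min (by norm_num) (by positivity)
  have hε'1 : ε' ≤ 1 / 4 := min_le_left _ _
  have hε'2 : ε' * (k0 + C1 + 3) ≤ ε / 2 := by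
    have : ε' ≤ ε / (2 * (k0 + C1 + 3)) := min_le_right _ _
    rw [le_div_iff₀ (by positivity)] at this
    linarith
  obtain ⟨B, hB, m, c, hc, h, hhB, hdyn, hstat⟩ := gp_pert d hM θ hε'0
  obtain ⟨η, hη, N, hN⟩ := gp_bounded_case (μ := μ) d.S hM θ hε'0 hW hstep hB hc h hhB
  refine ⟨η, hη, N, fun n hn τ Q hτ hQ hQW => ?_⟩
  obtain ⟨hup, hlo⟩ := hN n hn τ Q hτ hQ hQW
  have hd := hdyn n τ Q hτ hQ
  set φ' : (Fin v → X) → ℝ := fun y => h (fun a => c (y a)) with hφ'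
  have hn0 : (0:ℝ) < n := by exact_mod_cast hτ.pos
  have hup1 := hup (Z + ε' * (C1 + 1)) (fun ν hν hKL => by
    have h1 := hstat W ν hW hν hKL
    have h2 := hhalf W ν hW hν hKL
    have h3 : θ * gpT E W (gpS φ) ν - gpKL μ ν ≤ Z := le_csSup hbd ⟨ν, hν, hKL, rfl⟩
    have hkn : 0 ≤ gpKL μ ν := ENNReal.toReal_nonneg
    have h4 := (abs_le.1 h1).1
    by_cases hk : gpKL μ ν ≤ C1
    · have : ε' * (gpKL μ ν + 1) ≤ ε' * (C1 + 1) := by gcongr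
      linarith
    · push Not at hk
      have h5 : ε' * gpKL μ ν ≤ 1 / 4 * gpKL μ ν := by gcongr
      have h6 : 0 ≤ ε' * C1 := by positivity
      have h7 := neg_abs_le Z
      have h8 : -ε' * (gpKL μ ν + 1) = - (ε' * gpKL μ ν) - ε' := by ring
      have h9 : ε' * (C1 + 1) = ε' * C1 + ε' := by ring
      have h10 : ε' * (gpKL μ ν + 1) = (ε' * gpKL μ ν) + ε' := by ring
      rw [h9]
      rw [h10] at h4
      linarith)
  have hlo1 := hlo ν0 hν0 hKL0
  have hs0 := (abs_le.1 (hstat W ν0 hW hν0 hKL0)).2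
  obtain ⟨hd1, hd2⟩ := abs_le.1 hd
  have e1 : ε' * (C1 + 1) + 2 * ε' ≤ ε / 2 := by nlinarith
  have e2 : ε' * (k0 + 1) + 2 * ε' ≤ ε / 2 := by nlinarith
  have hu : gpLam μ E θ φ Q ≤ n * (Z + ε) := by
    have : n * (Z + ε' * (C1 + 1) + ε') + n * ε' ≤ n * (Z + ε) := by
      rw [← mul_add]; refine mul_le_mul_of_nonneg_left ?_ hn0.le; linarith
    linarith
  have hl : n * (Z - ε) ≤ gpLam μ E θ φ Q := by
    have : n * (Z - ε) ≤ n * (θ * gpT E W (gpS φ') ν0 - k0 - ε') - n * ε' := by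
      rw [← mul_sub]; refine mul_le_mul_of_nonneg_left ?_ hn0.le; linarith
    linarith
  rw [abs_le]
  constructor
  · have := mul_le_mul_of_nonneg_left hl (inv_nonneg.2 hn0.le)
    rw [← mul_assoc, inv_mul_cancel₀ hn0.ne'] at this
    linarith
  · have := mul_le_mul_of_nonneg_left hu (inv_nonneg.2 hn0.le)
    rw [← mul_assoc, inv_mul_cancel₀ hn0.ne'] at this
    linarith

lemma gp_seq {X : Type*} [MeasurableSpace X] {μ : Measure X} [IsProbabilityMeasure μ]
    {v : ℕ} {E : Finset (Fin v × Fin v)} {D : ℕ} {p q : ℝ} {φ : (Fin v → X) → ℝ} {ψ : X → ℝ}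
    (d : GpData μ E D p q φ ψ) {M : ℝ} (hM : 1 ≤ M) (θ : ℝ) {W : ℝ → ℝ → ℝ}
    (hW : Measurable (Function.uncurry W))
    (hWi : Integrable (Function.uncurry W) (unif01.prod unif01))
    (Q : ∀ n : ℕ, Fin n → Fin n → ℝ)
    (hQ : ∀ η > 0, ∀ᶠ n : ℕ in atTop, ∃ τ : ℝ → Fin n, GpTau τ ∧
      GpKer unif01 (q * D) M (gpQ τ (Q n)) ∧ GpCut (gpQ τ (Q n)) W η) :
    (∀ᶠ n : ℕ in atTop,
      ∫⁻ x, ENNReal.ofReal (Real.exp (n * θ * gpU E φ (Q n) x))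
        ∂(Measure.pi fun _ : Fin n => μ) < ⊤) ∧
    BddAbove (gpZ μ E θ φ W) ∧
    Tendsto (fun n : ℕ => (n : ℝ)⁻¹ * gpLam μ E θ φ (Q n)) atTop
      (nhds (sSup (gpZ μ E θ φ W))) := by
  have hr := d.S.one_le_r
  have hcut : ∀ η > 0, ∃ w, GpKer unif01 (q * D) M w ∧ GpCut w W η := by
    intro η hη
    obtain ⟨n, τ, hτ, h1, h2⟩ := (hQ η hη).exists
    exact ⟨_, h1, h2⟩
  have hWk := gp_W_ker hr hW hWi hcut
  refine ⟨?_, gpZ_bdd d hM θ hWk, ?_⟩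
  · filter_upwards [hQ 1 one_pos] with n ⟨τ, hτ, h1, h2⟩
    refine lt_of_le_of_lt (lintegral_mono fun x => ?_)
      ((gp_dyn_full d hM hτ h1 (abs_nonneg θ)).trans_lt (by finiteness))
    refine ENNReal.ofReal_le_ofReal (Real.exp_le_exp.2 ?_)
    rw [mul_assoc, ← abs_mul]
    exact mul_le_mul_of_nonneg_left (le_abs_self _) (Nat.cast_nonneg n)
  · rw [Metric.tendsto_nhds]
    intro ε hε
    obtain ⟨η, hη, N, hN⟩ := gp_core d hM θ hWk (fun η hη => by
      obtain ⟨m, c, hc, ω, hk, hl⟩ := gp_step_exists hr hW hWi hcut η hη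
      exact ⟨m, c, hc, ω, hk, gpCut_of_l1 hWi (gp_ker_int unif01 hr _ hk) hη.le hl⟩) (half_pos hε)
    filter_upwards [hQ η hη, eventually_ge_atTop N] with n ⟨τ, hτ, h1, h2⟩ hn
    rw [Real.dist_eq]
    exact (hN n hn τ (Q n) hτ h1 h2).trans_lt (half_lt_self hε)

/-- index map -/
noncomputable def gpIdx (n : ℕ) [NeZero n] (a : ℝ) : Fin n := Fin.ofNat n (⌈n * a⌉₊ - 1)

lemma gpIdx_iff {n : ℕ} [NeZero n] {a : ℝ} (h0 : 0 < a) (h1 : a ≤ 1) (i : Fin n) :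
    gpIdx n a = i ↔ a ∈ Set.Ioc (((i : ℕ) : ℝ)/n) ((((i : ℕ) : ℝ)+1)/n) := by
  have hn : 0 < n := NeZero.pos n
  have hnr : (0:ℝ) < n := by exact_mod_cast hn
  have hc0 : 0 < ⌈n * a⌉₊ := Nat.ceil_pos.2 (by positivity)
  have hc1 : ⌈n * a⌉₊ ≤ n := Nat.ceil_le.2 (by nlinarith)
  rw [Fin.ext_iff]
  have : ((gpIdx n a : Fin n) : ℕ) = ⌈n * a⌉₊ - 1 := by
    simp only [gpIdx, Fin.val_ofNat]
    exact Nat.mod_eq_of_lt (by omega)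
  rw [this, mem_Ioc, div_lt_iff₀ hnr, le_div_iff₀ hnr]
  have h2 : ⌈n * a⌉₊ - 1 = (i:ℕ) ↔ ⌈n * a⌉₊ = (i:ℕ) + 1 := by omega
  rw [h2, Nat.ceil_eq_iff (by omega)]
  push_cast
  simp [mul_comm]

lemma gpIdx_meas (n : ℕ) [NeZero n] : Measurable (gpIdx n) := by
  have : Measurable (fun k : ℕ => Fin.ofNat n (k - 1)) := measurable_from_nat
  exact this.comp (Nat.measurable_ceil.comp (by fun_prop))

lemma gp_unif01_ae : ∀ᵐ x ∂unif01, 0 < x ∧ x ≤ 1 := by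
  have h1 : ∀ᵐ x ∂unif01, x ∈ Set.Icc (0:ℝ) 1 := ae_restrict_mem measurableSet_Icc
  have h2 : ∀ᵐ x ∂unif01, x ≠ 0 := by
    refine ae_restrict_of_ae ?_
    simp [ae_iff]
  filter_upwards [h1, h2] with x hx hx0
  exact ⟨lt_of_le_of_ne hx.1 (Ne.symm hx0), hx.2⟩

lemma gpIdx_tau (n : ℕ) [NeZero n] : GpTau (gpIdx n) := by
  refine ⟨gpIdx_meas n, fun i => ?_⟩
  have hn : 0 < n := NeZero.pos n
  have hnr : (0:ℝ) < n := by exact_mod_cast hn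
  have h1 : (gpIdx n ⁻¹' {i} : Set ℝ) =ᵐ[unif01] Set.Ioc (((i : ℕ) : ℝ)/n) ((((i : ℕ) : ℝ)+1)/n) := by
    filter_upwards [gp_unif01_ae] with x hx
    exact propext (gpIdx_iff hx.1 hx.2 i)
  rw [measure_congr h1, unif01, Measure.restrict_apply measurableSet_Ioc, inter_eq_left.2,
    Real.volume_Ioc]
  · rw [← sub_div, add_sub_cancel_left, one_div, ENNReal.ofReal_inv_of_pos hnr, ENNReal.ofReal_natCast]
  · intro x hx
    have hi : ((i:ℕ):ℝ) + 1 ≤ n := by exact_mod_cast i.2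
    refine ⟨le_trans (by positivity) hx.1.le, hx.2.trans ?_⟩
    rw [div_le_one hnr]; exact hi

lemma GpTau.comp {n : ℕ} {τ : ℝ → Fin n} (h : GpTau τ) {σ : ℝ → ℝ}
    (hσ : MeasurePreserving σ unif01 unif01) : GpTau (τ ∘ σ) := by
  refine ⟨h.meas.comp hσ.measurable, fun i => ?_⟩
  rw [preimage_comp, hσ.measure_preimage (h.meas (measurableSet_singleton i)).nullMeasurableSet]
  exact h.unif i

lemma gp_step_eq {n : ℕ} [NeZero n] (Q : Fin n → Fin n → ℝ) {x y : ℝ} (hx : 0 < x ∧ x ≤ 1)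
    (hy : 0 < y ∧ y ≤ 1) : stepKernel n Q x y = Q (gpIdx n x) (gpIdx n y) := by
  unfold stepKernel
  simp only [← gpIdx_iff hx.1 hx.2, ← gpIdx_iff hy.1 hy.2]
  rw [Finset.sum_eq_single (gpIdx n x), Finset.sum_eq_single (gpIdx n y)]
  · simp
  · intro b _ hb; simp [Ne.symm hb]
  · simp
  · intro b _ hb; simp [Ne.symm hb]
  · simp

lemma gp_icc_restrict (S : Set ℝ) (hS : MeasurableSet S) :
    volume.restrict (Set.Icc (0:ℝ) 1 ∩ S) = unif01.restrict S := by
  rw [unif01, Measure.restrict_restrict hS, inter_comm]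

lemma gp_cutDist_le {w w' : ℝ → ℝ → ℝ}
    (hw : Integrable (Function.uncurry w) (unif01.prod unif01))
    (hw' : Integrable (Function.uncurry w') (unif01.prod unif01)) {u : ℝ → ℝ → ℝ}
    (hu : ∀ᵐ x ∂unif01, ∀ᵐ y ∂unif01, u x y = w x y) :
    GpCut w w' (cutDist u w') := by
  intro S T hS hT
  have key : ∀ S T : Set ℝ, MeasurableSet S → MeasurableSet T →
      |∫ x in Set.Icc (0:ℝ) 1 ∩ S, ∫ y in Set.Icc (0:ℝ) 1 ∩ T, (u x y - w' x y)| =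
      |∫ s in S, ∫ t in T, (w s t - w' s t) ∂unif01 ∂unif01| := by
    intro S T hS hT
    rw [gp_icc_restrict S hS, gp_icc_restrict T hT]
    congr 1
    refine integral_congr_ae (ae_restrict_of_ae ?_)
    filter_upwards [hu] with x hx
    refine integral_congr_ae (ae_restrict_of_ae ?_)
    filter_upwards [hx] with y hy
    rw [hy]
  set B := (∫⁻ z, ‖Function.uncurry w z - Function.uncurry w' z‖ₑ ∂(unif01.prod unif01)).toReal with hB
  have hfin : ∫⁻ z, ‖Function.uncurry w z - Function.uncurry w' z‖ₑ ∂(unif01.prod unif01) ≠ ⊤ :=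
    (hw.sub hw').2.ne
  have hbd : GpCut w w' B := gpCut_of_l1 hw hw' ENNReal.toReal_nonneg
    (by rw [hB, ENNReal.ofReal_toReal hfin])
  have hb1 : ∀ S : {S : Set ℝ // MeasurableSet S}, BddAbove (Set.range fun T : {T : Set ℝ // MeasurableSet T} =>
      |∫ x in Set.Icc (0:ℝ) 1 ∩ S.1, ∫ y in Set.Icc (0:ℝ) 1 ∩ T.1, (u x y - w' x y)|) := by
    intro S
    refine ⟨B, ?_⟩
    rintro _ ⟨T, rfl⟩
    dsimp only
    rw [key S.1 T.1 S.2 T.2]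
    exact hbd _ _ S.2 T.2
  have : Nonempty {T : Set ℝ // MeasurableSet T} := ⟨⟨∅, MeasurableSet.empty⟩⟩
  have hb2 : BddAbove (Set.range fun S : {S : Set ℝ // MeasurableSet S} =>
      ⨆ T : {T : Set ℝ // MeasurableSet T},
      |∫ x in Set.Icc (0:ℝ) 1 ∩ S.1, ∫ y in Set.Icc (0:ℝ) 1 ∩ T.1, (u x y - w' x y)|) := by
    refine ⟨B, ?_⟩
    rintro _ ⟨S, rfl⟩
    refine ciSup_le fun T => ?_
    rw [key S.1 T.1 S.2 T.2]
    exact hbd _ _ S.2 T.2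
  rw [← key S T hS hT]
  unfold cutDist
  exact (le_ciSup (hb1 ⟨S, hS⟩) ⟨T, hT⟩).trans (le_ciSup hb2 ⟨S, hS⟩)

lemma gp_mpb_id : MPB id := ⟨Set.bijOn_id _, MeasurePreserving.id _⟩

lemma gpQ_meas {n : ℕ} {τ : ℝ → Fin n} (h : Measurable τ) (Q : Fin n → Fin n → ℝ) :
    Measurable (Function.uncurry (gpQ τ Q)) := by
  have : Measurable (fun z : Fin n × Fin n => Q z.1 z.2) := measurable_of_finite _
  exact this.comp ((h.comp measurable_fst).prodMk (h.comp measurable_snd))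

/-- Kernel norms are preserved by rearrangement. -/
lemma gp_kerNorm {n : ℕ} [NeZero n] (Q : Fin n → Fin n → ℝ) {σ : ℝ → ℝ}
    (hσ : MeasurePreserving σ unif01 unif01) (r : ℝ≥0∞) :
    eLpNorm (fun y : ℝ × ℝ => gpQ (gpIdx n ∘ σ) Q y.1 y.2) r (unif01.prod unif01) =
      kerNorm (stepKernel n Q) r := by
  have h1 : kerNorm (stepKernel n Q) r =
      eLpNorm (fun y : ℝ × ℝ => gpQ (gpIdx n) Q y.1 y.2) r (unif01.prod unif01) := by
    unfold kerNorm
    refine eLpNorm_congr_ae ?_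
    have ha : ∀ᵐ z ∂(unif01.prod unif01), 0 < z.1 ∧ z.1 ≤ 1 :=
      Measure.quasiMeasurePreserving_fst.ae gp_unif01_ae
    have hb : ∀ᵐ z ∂(unif01.prod unif01), 0 < z.2 ∧ z.2 ≤ 1 :=
      Measure.quasiMeasurePreserving_snd.ae gp_unif01_ae
    filter_upwards [ha, hb] with z hz1 hz2
    exact gp_step_eq Q hz1 hz2
  rw [h1]
  have h2 := hσ.prod hσ
  have hm : AEStronglyMeasurable (fun y : ℝ × ℝ => gpQ (gpIdx n) Q y.1 y.2) (unif01.prod unif01) :=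
    (gpQ_meas (gpIdx_meas n) Q).aestronglyMeasurable
  rw [← eLpNorm_comp_measurePreserving (p := r) hm h2]
  rfl

/-- Extract rearrangements from weak cut convergence. -/
lemma gp_extract {W : ℝ → ℝ → ℝ}
    (hWi : Integrable (Function.uncurry W) (unif01.prod unif01))
    (Q : ∀ n : ℕ, Fin n → Fin n → ℝ)
    (hcut : Tendsto (fun n => weakCutDist (stepKernel n (Q n)) W) atTop (nhds 0))
    {r M : ℝ} (hr : 1 ≤ r)
    (hQ : ∀ᶠ n : ℕ in atTop, kerNorm (stepKernel n (Q n)) (ENNReal.ofReal r) ≤ ENNReal.ofReal M) :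
    ∀ η > 0, ∀ᶠ n : ℕ in atTop, ∃ τ : ℝ → Fin n, GpTau τ ∧
      GpKer unif01 r M (gpQ τ (Q n)) ∧ GpCut (gpQ τ (Q n)) W η := by
  intro η hη
  filter_upwards [hQ, hcut.eventually_lt_const hη, eventually_gt_atTop 0] with n hn hlt hn0
  have : NeZero n := ⟨hn0.ne'⟩
  have : Nonempty {σ : ℝ → ℝ // MPB σ} := ⟨⟨id, gp_mpb_id⟩⟩
  obtain ⟨⟨σ, hσ⟩, hlt'⟩ := exists_lt_of_ciInf_lt hlt
  have hτ := (gpIdx_tau n).comp hσ.2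
  have hk : GpKer unif01 r M (gpQ (gpIdx n ∘ σ) (Q n)) := by
    refine ⟨gpQ_meas hτ.meas _, ?_⟩
    have h1 := gp_kerNorm (Q n) hσ.2 (ENNReal.ofReal r)
    rw [eLpNorm_eq_eLpNorm' (by simp; linarith) (by simp), ENNReal.toReal_ofReal (by linarith)] at h1
    rw [h1]; exact hn
  refine ⟨_, hτ, hk, fun S T hS hT => ?_⟩
  refine (gp_cutDist_le (gp_ker_int unif01 hr _ hk) hWi ?_ S T hS hT).trans hlt'.le
  have hae : ∀ᵐ x ∂unif01, 0 < σ x ∧ σ x ≤ 1 := hσ.2.quasiMeasurePreserving.ae gp_unif01_ae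
  filter_upwards [hae] with x hx
  filter_upwards [hae] with y hy
  exact gp_step_eq (Q n) hx hy

/-- Edge set of a graph. -/
def gpE {v : ℕ} (G : SimpleGraph (Fin v)) [DecidableRel G.Adj] : Finset (Fin v × Fin v) :=
  Finset.univ.filter (fun p : Fin v × Fin v => G.Adj p.1 p.2 ∧ p.1 < p.2)

lemma gpE_deg {v : ℕ} (G : SimpleGraph (Fin v)) [DecidableRel G.Adj] (i : Fin v) :
    ((gpE G).filter (fun e => e.1 = i ∨ e.2 = i)).card ≤ G.maxDegree := by
  refine le_trans ?_ (G.degree_le_maxDegree i)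
  rw [← G.card_neighborFinset_eq_degree]
  refine Finset.card_le_card_of_injOn (fun e => if e.1 = i then e.2 else e.1) ?_ ?_
  · intro e he
    simp only [gpE, Finset.coe_filter, Finset.mem_filter, Finset.mem_univ, true_and, mem_ofPred_eq] at he
    obtain ⟨⟨hadj, hlt⟩, h⟩ := he
    simp only [Finset.mem_coe, SimpleGraph.mem_neighborFinset]
    split_ifs with h1
    · rw [← h1]; exact hadj
    · have h2 : e.2 = i := h.resolve_left h1
      rw [← h2]; exact hadj.symm
  · intro e he f hf hef
    simp only [gpE, Finset.coe_filter, Finset.mem_filter, Finset.mem_univ, true_and, mem_ofPred_eq] at he hf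
    obtain ⟨⟨hadj, hlt⟩, h⟩ := he
    obtain ⟨⟨hadj', hlt'⟩, h'⟩ := hf
    dsimp only at hef
    rw [Prod.ext_iff]
    split_ifs at hef with h1 h2 h2
    · exact ⟨h1.trans h2.symm, hef⟩
    · have h3 := h'.resolve_left h2
      omega
    · have h3 := h.resolve_left h1
      omega
    · exact ⟨hef, (h.resolve_left h1).trans (h'.resolve_left h2).symm⟩

lemma gp_step_meas (n : ℕ) (Q : Fin n → Fin n → ℝ) :
    Measurable (fun z : ℝ × ℝ => stepKernel n Q z.1 z.2) := by
  unfold stepKernel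
  refine Finset.measurable_sum _ fun i _ => Finset.measurable_sum _ fun j _ => ?_
  refine Measurable.ite ?_ measurable_const measurable_const
  exact (measurable_fst measurableSet_Ioc).inter (measurable_snd measurableSet_Ioc)

lemma gp_choose_p {X : Type*} [MeasurableSpace X] (μ : Measure X) [IsProbabilityMeasure μ]
    {v : ℕ} (hv : 2 ≤ v) (ψ : X → ℝ) (hψpos : ∀ x, 0 ≤ ψ x)
    (p : ℝ≥0∞) (hpv : (v : ℝ≥0∞) ≤ p) (hTail : TailCond μ ψ p)
    (q : ℝ≥0∞) (hq : 1 < q) (hpq : p⁻¹ + q⁻¹ ≤ 1) :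
    ∃ p' q' : ℝ, p'.HolderConjugate q' ∧ (v : ℝ) ≤ p' ∧ ENNReal.ofReal q' ≤ q ∧
      ∀ lam : ℝ, ∫⁻ x, ENNReal.ofReal (Real.exp (lam * ψ x ^ p')) ∂μ < ⊤ := by
  have hv2 : (2:ℝ) ≤ v := by exact_mod_cast hv
  have hbound : ∀ (p' : ℝ) (B : ℝ), (∀ x, ψ x ^ p' ≤ B) → ∀ lam : ℝ, 0 < lam →
      ∫⁻ x, ENNReal.ofReal (Real.exp (lam * ψ x ^ p')) ∂μ < ⊤ := by
    intro p' B hB lam hlam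
    calc _ ≤ ∫⁻ x, ENNReal.ofReal (Real.exp (lam * B)) ∂μ := by
          refine lintegral_mono fun x => ENNReal.ofReal_le_ofReal (Real.exp_le_exp.2 ?_)
          exact mul_le_mul_of_nonneg_left (hB x) hlam.le
      _ < ⊤ := by simp
  obtain ⟨p', hvp, hpq', ht⟩ : ∃ p' : ℝ, (v:ℝ) ≤ p' ∧ (ENNReal.ofReal p')⁻¹ + q⁻¹ ≤ 1 ∧
      ∀ lam : ℝ, 0 < lam → ∫⁻ x, ENNReal.ofReal (Real.exp (lam * ψ x ^ p')) ∂μ < ⊤ := by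
    unfold TailCond at hTail
    split_ifs at hTail with hp
    · obtain ⟨C, hC⟩ := hTail
      have hq1 : q⁻¹ < 1 := ENNReal.inv_lt_one.2 hq
      have hδ : 1 - q⁻¹ ≠ 0 := (tsub_pos_of_lt hq1).ne'
      refine ⟨max v ((1 - q⁻¹)⁻¹).toReal, le_max_left _ _, ?_, ?_⟩
      · have h1 : (1 - q⁻¹)⁻¹ ≤ ENNReal.ofReal (max v ((1 - q⁻¹)⁻¹).toReal) := by
          refine le_trans ?_ (ENNReal.ofReal_le_ofReal (le_max_right _ _))
          rw [ENNReal.ofReal_toReal (ENNReal.inv_ne_top.2 hδ)]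
        have h2 := ENNReal.inv_le_inv.2 h1
        rw [inv_inv] at h2
        calc _ ≤ (1 - q⁻¹) + q⁻¹ := by gcongr
          _ = 1 := tsub_add_cancel_of_le hq1.le
      · refine hbound _ (C ^ (max (v:ℝ) ((1 - q⁻¹)⁻¹).toReal)) fun x => ?_
        exact Real.rpow_le_rpow (hψpos x) (hC x) (le_trans (by linarith) (le_max_left _ _))
    · refine ⟨p.toReal, ?_, by rwa [ENNReal.ofReal_toReal hp], hTail⟩
      have := ENNReal.toReal_mono hp hpv
      simpa using this
  have hp1 : 1 < p' := by linarith
  have hconj := Real.HolderConjugate.conjExponent hp1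
  refine ⟨p', p'.conjExponent, hconj, hvp, ?_, ?_⟩
  · have h1 := hconj.inv_add_inv_eq_one
    have h2 : (ENNReal.ofReal p')⁻¹ + (ENNReal.ofReal p'.conjExponent)⁻¹ = 1 := by
      rw [← ENNReal.ofReal_inv_of_pos hconj.pos, ← ENNReal.ofReal_inv_of_pos hconj.symm.pos,
        ← ENNReal.ofReal_add (inv_nonneg.2 hconj.nonneg) (inv_nonneg.2 hconj.symm.nonneg), h1,
        ENNReal.ofReal_one]
    rw [← h2] at hpq'
    have hfin : (ENNReal.ofReal p')⁻¹ ≠ ⊤ := ENNReal.inv_ne_top.2 (by simpa using hconj.pos)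
    exact ENNReal.inv_le_inv.1 ((ENNReal.add_le_add_iff_left hfin).1 hpq')
  · intro lam
    by_cases hl : 0 < lam
    · exact ht lam hl
    · push Not at hl
      refine lt_of_le_of_lt (lintegral_mono (g := fun _ => 1) fun x => ?_) (by simp)
      rw [← ENNReal.ofReal_one]
      refine ENNReal.ofReal_le_ofReal (Real.exp_le_one_iff.2 ?_)
      exact mul_nonpos_of_nonpos_of_nonneg hl (Real.rpow_nonneg (hψpos x) _)

lemma gp_Zset {X : Type*} [MeasurableSpace X] (μ : Measure X) [IsProbabilityMeasure μ]
    {v : ℕ} (G : SimpleGraph (Fin v)) [DecidableRel G.Adj] (W : ℝ → ℝ → ℝ)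
    (φ : (Fin v → X) → ℝ) (θ : ℝ) : Zset G W φ μ θ = gpZ μ (gpE G) θ φ W := by
  ext z
  unfold Zset gpZ
  simp only [mem_ofPred_eq]
  refine exists_congr fun ν => and_congr_right fun hν => ?_
  have := hν.1
  have h1 : TWphi G W φ ν = gpT (gpE G) W (gpS φ) ν := by
    unfold TWphi gpT piProb probOr
    simp only [this, if_true]
    rfl
  rw [gp_KLdiv_eq, h1]
  rfl

lemma gp_final {X : Type*} [MeasurableSpace X]
    (μ : Measure X) [IsProbabilityMeasure μ]
    {v : ℕ} (hv : 2 ≤ v) (G : SimpleGraph (Fin v)) [DecidableRel G.Adj]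
    (φ : (Fin v → X) → ℝ) (hφ : Measurable φ)
    (Q : ∀ n : ℕ, Fin n → Fin n → ℝ)
    (W : ℝ → ℝ → ℝ) (hWmeas : Measurable (Function.uncurry W))
    (hWL1 : kerNorm W 1 ≠ ⊤)
    (hcut : Tendsto (fun n => weakCutDist (stepKernel n (Q n)) W) atTop (nhds 0))
    (ψ : X → ℝ) (hψmeas : Measurable ψ) (hψpos : ∀ x, 0 ≤ ψ x)
    (p : ℝ≥0∞) (hpv : (v : ℝ≥0∞) ≤ p) (hTail : TailCond μ ψ p)
    (hdom : ∀ y : Fin v → X, |φ y| ≤ ∏ a, ψ (y a))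
    (q : ℝ≥0∞) (hq : 1 < q) (hpq : p⁻¹ + q⁻¹ ≤ 1)
    (hnorm : Filter.atTop.limsup
        (fun n => kerNorm (stepKernel n (Q n)) (q * (G.maxDegree : ℝ≥0∞))) ≠ ⊤)
    (θ : ℝ) :
    (∀ᶠ n : ℕ in atTop,
      ∫⁻ x, ENNReal.ofReal (Real.exp (n * θ * gpU (gpE G) φ (Q n) x))
        ∂(Measure.pi fun _ : Fin n => μ) < ⊤) ∧
    BddAbove (gpZ μ (gpE G) θ φ W) ∧
    Tendsto (fun n : ℕ => (n : ℝ)⁻¹ * gpLam μ (gpE G) θ φ (Q n)) atTop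
      (nhds (sSup (gpZ μ (gpE G) θ φ W))) := by
  obtain ⟨p', q', hconj, hvp, hq', ht⟩ := gp_choose_p μ hv ψ hψpos p hpv hTail q hq hpq
  have hElt : ∀ e ∈ gpE G, e.1 < e.2 := fun e he => by
    simp only [gpE, Finset.mem_filter, Finset.mem_univ, true_and] at he
    exact he.2
  rcases Nat.eq_zero_or_pos G.maxDegree with h0 | hpos
  · have hE : gpE G = ∅ := by
      rw [Finset.eq_empty_iff_forall_notMem]
      intro e he
      have h1 := gpE_deg G e.1
      rw [h0, Nat.le_zero, Finset.card_eq_zero] at h1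
      have h2 : e ∈ (gpE G).filter (fun f => f.1 = e.1 ∨ f.2 = e.1) := by simp [he]
      rw [h1] at h2
      simp at h2
    have d : GpData μ (gpE G) 1 p' q' φ ψ :=
      ⟨⟨hElt, le_rfl, fun i => by simp [hE], hconj⟩, by omega, hvp, hφ, hψmeas, hψpos, hdom, ht⟩
    have hr := d.S.one_le_r
    have key := gp_seq d (le_refl (1:ℝ)) θ (W := fun _ _ => 0) measurable_const
      (integrable_const (0:ℝ)) (fun n _ _ => 0) (by
        intro η hη
        filter_upwards [eventually_gt_atTop 0] with n hn0
        have : NeZero n := ⟨hn0.ne'⟩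
        refine ⟨gpIdx n, gpIdx_tau n, ⟨gpQ_meas (gpIdx_meas n) _, ?_⟩, fun S T _ _ => ?_⟩
        · rw [gp_norm_iff _ _ (by linarith)]
          simp only [gpQ, enorm_zero]
          rw [ENNReal.zero_rpow_of_pos (by linarith)]
          simp
        · simp [gpQ, hη.le])
    have hUeq : ∀ (n : ℕ) (x : Fin n → X), gpU (gpE G) φ (Q n) x = gpU (gpE G) φ (fun _ _ => 0) x := by
      intro n x; simp [gpU, hE]
    have hLeq : ∀ n : ℕ, gpLam μ (gpE G) θ φ (Q n) = gpLam (n := n) μ (gpE G) θ φ (fun _ _ => 0) := by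
      intro n; simp only [gpLam, hUeq]
    have hZeq : gpZ μ (gpE G) θ φ W = gpZ μ (gpE G) θ φ (fun _ _ => 0) := by
      simp [gpZ, gpT, hE]
    simp only [hUeq, hLeq, hZeq]
    exact key
  · have d : GpData μ (gpE G) G.maxDegree p' q' φ ψ :=
      ⟨⟨hElt, hpos, gpE_deg G, hconj⟩, by omega, hvp, hφ, hψmeas, hψpos, hdom, ht⟩
    have hr := d.S.one_le_r
    have hWi : Integrable (Function.uncurry W) (unif01.prod unif01) := by
      rw [← memLp_one_iff_integrable]
      exact ⟨hWmeas.aestronglyMeasurable, lt_top_iff_ne_top.2 hWL1⟩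
    obtain ⟨b, hb1, hb2⟩ := exists_between (lt_top_iff_ne_top.2 hnorm)
    have hev := eventually_lt_of_limsup_lt hb1
    refine gp_seq d (le_max_right b.toReal 1) θ hWmeas hWi Q (gp_extract hWi Q hcut hr ?_)
    filter_upwards [hev] with n hn
    have hexp : ENNReal.ofReal (q' * G.maxDegree) ≤ q * (G.maxDegree : ℝ≥0∞) := by
      rw [ENNReal.ofReal_mul hconj.symm.nonneg, ENNReal.ofReal_natCast]
      gcongr
    calc kerNorm (stepKernel n (Q n)) (ENNReal.ofReal (q' * G.maxDegree))
        ≤ kerNorm (stepKernel n (Q n)) (q * (G.maxDegree : ℝ≥0∞)) :=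
          eLpNorm_le_eLpNorm_of_exponent_le hexp (gp_step_meas n (Q n)).aestronglyMeasurable
      _ ≤ b := hn.le
      _ = ENNReal.ofReal b.toReal := (ENNReal.ofReal_toReal hb2.ne).symm
      _ ≤ _ := ENNReal.ofReal_le_ofReal (le_max_left _ _)

/-- Corollary 1.1 (i): convergence of the log-normalizing constant. -/
theorem gibbs_log_partition_limit
    {X : Type*} [MeasurableSpace X] [TopologicalSpace X] [PolishSpace X] [BorelSpace X]
    (μ : Measure X) [IsProbabilityMeasure μ]
    (hnondeg : ∀ x : X, μ ≠ Measure.dirac x)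
    {v : ℕ} (hv : 2 ≤ v) (G : SimpleGraph (Fin v)) [DecidableRel G.Adj]
    (φ : (Fin v → X) → ℝ) (hφ : Measurable φ)
    (Q : ∀ n : ℕ, Fin n → Fin n → ℝ)
    (hQsymm : ∀ n i j, Q n i j = Q n j i) (hQzero : ∀ n i, Q n i i = 0)
    (W : ℝ → ℝ → ℝ) (hWmeas : Measurable (Function.uncurry W))
    (hWsymm : ∀ x y, W x y = W y x) (hWL1 : kerNorm W 1 ≠ ⊤)
    (hcut : Tendsto (fun n => weakCutDist (stepKernel n (Q n)) W) atTop (nhds 0))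
    (ψ : X → ℝ) (hψmeas : Measurable ψ) (hψpos : ∀ x, 0 ≤ ψ x)
    (p : ℝ≥0∞) (hpv : (v : ℝ≥0∞) ≤ p) (hTail : TailCond μ ψ p)
    (hdom : ∀ y : Fin v → X, |φ y| ≤ ∏ a, ψ (y a))
    (q : ℝ≥0∞) (hq : 1 < q) (hpq : p⁻¹ + q⁻¹ ≤ 1)
    (hnorm : Filter.atTop.limsup
        (fun n => kerNorm (stepKernel n (Q n)) (q * (G.maxDegree : ℝ≥0∞))) ≠ ⊤)
    (θ : ℝ) :
    (∀ᶠ n : ℕ in atTop,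
      ∫⁻ x, ENNReal.ofReal (Real.exp (n * θ * Ustat G φ n (Q n) x))
        ∂(Measure.pi fun _ : Fin n => μ) < ⊤) ∧
    (Zset G W φ μ θ).Nonempty ∧ BddAbove (Zset G W φ μ θ) ∧
    Tendsto (fun n => ZnGen μ (fun n => Ustat G φ n (Q n)) n θ) atTop
      (nhds (sSup (Zset G W φ μ θ))) := by

  obtain ⟨h1, h2, h3⟩ := gp_final μ hv G φ hφ Q W hWmeas hWL1 hcut ψ hψmeas hψpos p hpv hTail
    hdom q hq hpq hnorm θ
  have hU : ∀ (n : ℕ) (x : Fin n → X), Ustat G φ n (Q n) x = gpU (gpE G) φ (Q n) x :=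
    fun n x => rfl
  rw [gp_Zset]
  refine ⟨?_, gpZ_nonempty μ _ θ φ W, h2, ?_⟩
  · filter_upwards [h1] with n hn
    simpa only [hU] using hn
  · refine h3.congr fun n => ?_
    simp only [ZnGen, gpLam, hU, mul_assoc]
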